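/- Let k be a field, A a finite-dimensional self-injective k-algebra, M a finitely generated self-orthogonal generator for A-mod, and Λ = End_A(M). Then the following are equivalent: (i) Λ is virtually Gorenstein; (ii) every module in 𝒢 is a filtered colimit of finitely generated modules lying in 𝒢; (iii) every M-compact A-module X is M-stably isomorphic to a finitely generated module, i.e., there exist a finitely generated A-module Z and modules M₁, M₂ ∈ Add(M) with X ⊕ M₁ ≅ Z ⊕ M₂. (Proposition 3.12 on virtually Gorenstein endomorphism algebras.) -/

import Mathlib

open CategoryTheory
/-! ## Additive closure classes -/

section AddClosure

variable (A : Type) [Ring A]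

/-- `X ∈ add M`: `X` is a direct summand of a finite direct sum of copies of `M`. -/
def MemAdd (M X : ModuleCat.{0} A) : Prop :=
  ∃ (n : ℕ) (Y : ModuleCat.{0} A), Nonempty ((↥X × ↥Y) ≃ₗ[A] (Fin n → ↥M))

/-- `X ∈ Add M`: `X` is a direct summand of an arbitrary direct sum of copies of `M`. -/
def MemAddBig (M X : ModuleCat.{0} A) : Prop :=
  ∃ (I : Type) (Y : ModuleCat.{0} A), Nonempty ((↥X × ↥Y) ≃ₗ[A] (I →₀ ↥M))

/-- a morphism of `A`-modules factors through a projective module -/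
def FactorsThroughProj {X Y : ModuleCat.{0} A} (f : X ⟶ Y) : Prop :=
  ∃ (P : ModuleCat.{0} A) (_ : Module.Projective A P) (g : X ⟶ P) (h : P ⟶ Y), f = g ≫ h

/-- a morphism of `A`-modules factors through a module in `Add M` -/
def FactorsThroughAddM (M : ModuleCat.{0} A) {X Y : ModuleCat.{0} A} (f : X ⟶ Y) : Prop :=
  ∃ (Z : ModuleCat.{0} A) (_ : MemAddBig A M Z) (g : X ⟶ Z) (h : Z ⟶ Y), f = g ≫ h

/-- `X ∈ add M` for unbundled modules. -/
def MemAddPlain (M : Type) [AddCommGroup M] [Module A M]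
    (X : Type) [AddCommGroup X] [Module A X] : Prop :=
  ∃ (n : ℕ) (Y : ModuleCat.{0} A), Nonempty ((X × ↥Y) ≃ₗ[A] (Fin n → M))

end AddClosure

/-! ## Ext vanishing -/

section ExtDefs

variable (A : Type) [Ring A]

/-- vanishing of `Ext^n_A(X, Y)` -/
noncomputable def extZero (n : ℕ) (X Y : ModuleCat.{0} A) : Prop :=
  Subsingleton (((Ext ℤ (ModuleCat.{0} A) n).obj (Opposite.op X)).obj Y)

/-- `M` is self-orthogonal: `Ext^n_A(M,M) = 0` for all `n ≥ 1`. -/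
noncomputable def SelfOrthogonal (M : ModuleCat.{0} A) : Prop :=
  ∀ n : ℕ, 1 ≤ n → extZero A n M M

/-- `M` is a generator for `A`-mod: `A ∈ add M`. -/
def IsGen (M : ModuleCat.{0} A) : Prop :=
  MemAdd A M (ModuleCat.of A A)

/-- membership in the `M`-Gorenstein subcategory `𝒢`:
`Ext^n_A(M,X) = 0 = Ext^n_A(X,M)` for all `n ≥ 1`. -/
noncomputable def MemG (M X : ModuleCat.{0} A) : Prop :=
  ∀ n : ℕ, 1 ≤ n → extZero A n M X ∧ extZero A n X M

end ExtDefs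

/-! ## Relative stable Hom-groups and `M`-compact objects -/

section StableM

variable (A : Type) [Ring A]

/-- the subgroup of `Hom_A(X,Y)` generated by morphisms factoring through `Add M` -/
def addMSub (M X Y : ModuleCat.{0} A) : AddSubgroup (X ⟶ Y) :=
  AddSubgroup.closure {f : X ⟶ Y | FactorsThroughAddM A M f}

/-- the relative stable Hom-group `StHom_M(X,Y) = Hom_A(X,Y)/[M]` -/
def StHomM (M X Y : ModuleCat.{0} A) : Type :=
  (X ⟶ Y) ⧸ addMSub A M X Y

instance (M X Y : ModuleCat.{0} A) : AddCommGroup (StHomM A M X Y) :=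
  inferInstanceAs (AddCommGroup ((X ⟶ Y) ⧸ addMSub A M X Y))

/-- postcomposition as an additive map on Hom-groups. -/
def postCompHom {Y Z : ModuleCat.{0} A} (X : ModuleCat.{0} A) (h : Y ⟶ Z) :
    (X ⟶ Y) →+ (X ⟶ Z) :=
  AddMonoidHom.mk' (fun f => f ≫ h) (fun f g => by simp [Preadditive.add_comp])

/-- postcomposition descends to the relative stable Hom-groups. -/
def stPostComp (M : ModuleCat.{0} A) (X : ModuleCat.{0} A) {Y Z : ModuleCat.{0} A}
    (h : Y ⟶ Z) : StHomM A M X Y →+ StHomM A M X Z :=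
  QuotientAddGroup.map _ _ (postCompHom A X h) (by
    rw [addMSub, AddSubgroup.closure_le]
    rintro f ⟨W, hW, u, v, rfl⟩
    rw [SetLike.mem_coe, AddSubgroup.mem_comap]
    exact AddSubgroup.subset_closure ⟨W, hW, u, v ≫ h, by simp [postCompHom]⟩)

/-- the canonical map `⊕ᵢ StHom_M(X, Y i) → StHom_M(X, ⊕ᵢ Y i)`. -/
noncomputable def stCanonMap (M X : ModuleCat.{0} A) (I : Type) (Y : I → ModuleCat.{0} A) :
    DirectSum I (fun i => StHomM A M X (Y i)) →+ StHomM A M X (∐ Y) :=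
  letI : DecidableEq I := Classical.decEq I
  DirectSum.toAddMonoid fun i => stPostComp A M X (Limits.Sigma.ι Y i)

/-- `X` is `M`-compact: `X ∈ 𝒢` and for every family `(Y i)` in `𝒢` the canonical map
`⊕ᵢ StHom_M(X, Y i) → StHom_M(X, ⊕ᵢ Y i)` is bijective. -/
noncomputable def MCompact (M X : ModuleCat.{0} A) : Prop :=
  MemG A M X ∧
    ∀ (I : Type) (Y : I → ModuleCat.{0} A), (∀ i, MemG A M (Y i)) →
      Function.Bijective (stCanonMap A M X I Y)

end StableM

/-! ## Filtered colimits -/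

section FiltColim

variable (A : Type) [Ring A]

/-- `X` is a filtered colimit of finitely generated modules lying in `𝒢`. -/
noncomputable def FiltColimOfFgG (M X : ModuleCat.{0} A) : Prop :=
  ∃ (J : Cat.{0, 0}) (_ : IsFiltered J) (F : J ⥤ ModuleCat.{0} A)
    (c : Limits.Cocone F),
    (∀ j, Module.Finite A (F.obj j) ∧ MemG A M (F.obj j)) ∧
      Nonempty (Limits.IsColimit c) ∧ Nonempty (c.pt ≅ X)

end FiltColim

/-! ## Gorenstein homological algebra -/

section Gorenstein

variable (B : Type) [Ring B]

/-- `G` is a Gorenstein-projective `B`-module: `G` is the kernel at degree `0` of an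
exact complex `P•` of projective modules such that `Hom_B(P•, B)` is exact. -/
def IsGProj (G : ModuleCat.{0} B) : Prop :=
  ∃ (P : ℤ → ModuleCat.{0} B) (d : ∀ i : ℤ, P i ⟶ P (i + 1)),
    (∀ i, Module.Projective B (P i)) ∧
    (∀ i, LinearMap.range (d i).hom = LinearMap.ker (d (i + 1)).hom) ∧
    (∀ (i : ℤ) (φ : P (i + 1) ⟶ ModuleCat.of B B),
      d i ≫ φ = 0 ↔ ∃ ψ : P (i + 1 + 1) ⟶ ModuleCat.of B B, φ = d (i + 1) ≫ ψ) ∧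
    Nonempty (↥G ≃ₗ[B] ↥(LinearMap.ker (d 0).hom))

/-- `G` is a Gorenstein-injective `B`-module: `G` is the kernel at degree `0` of an
exact complex `I•` of injective modules such that `Hom_B(E, I•)` is exact for every
injective module `E`. -/
def IsGInj (G : ModuleCat.{0} B) : Prop :=
  ∃ (I : ℤ → ModuleCat.{0} B) (d : ∀ i : ℤ, I i ⟶ I (i + 1)),
    (∀ i, Module.Injective B ↥(I i)) ∧
    (∀ i, LinearMap.range (d i).hom = LinearMap.ker (d (i + 1)).hom) ∧
    (∀ (E : ModuleCat.{0} B), Module.Injective B ↥E →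
      ∀ (i : ℤ) (φ : E ⟶ I (i + 1)), φ ≫ d (i + 1) = 0 ↔ ∃ ψ : E ⟶ I i, φ = ψ ≫ d i) ∧
    Nonempty (↥G ≃ₗ[B] ↥(LinearMap.ker (d 0).hom))

/-- vanishing of `Ext^n_B(X, Y)` -/
noncomputable def extZero' (n : ℕ) (X Y : ModuleCat.{0} B) : Prop :=
  Subsingleton (((Ext ℤ (ModuleCat.{0} B) n).obj (Opposite.op X)).obj Y)

/-- `B` is virtually Gorenstein. -/
noncomputable def VirtGorenstein : Prop :=
  ∀ X : ModuleCat.{0} B,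
    (∀ G : ModuleCat.{0} B, IsGProj B G → ∀ n : ℕ, 1 ≤ n → extZero' B n G X) ↔
    (∀ E : ModuleCat.{0} B, IsGInj B E → ∀ n : ℕ, 1 ≤ n → extZero' B n X E)

/-- `X` has projective dimension at most `n`. -/
def ProjDimLE : ℕ → ModuleCat.{0} B → Prop
  | 0, X => Module.Projective B X
  | n + 1, X => ∃ (P : ModuleCat.{0} B) (_ : Module.Projective B P) (g : P ⟶ X),
      Function.Surjective g ∧ ProjDimLE n (ModuleCat.of B ↥(LinearMap.ker g.hom))

/-- `X` has finite projective dimension. -/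
def FiniteProjDim (X : ModuleCat.{0} B) : Prop :=
  ∃ n, ProjDimLE B n X

/-- `X` is compactly filtered: it carries an exhaustive ascending chain of submodules
whose subquotients are finitely generated of finite projective dimension. -/
def CompactlyFiltered (X : ModuleCat.{0} B) : Prop :=
  ∃ F : ℕ → Submodule B ↥X,
    Monotone F ∧ F 0 = ⊥ ∧ (⨆ n, F n) = ⊤ ∧
      ∀ n, Module.Finite B
          (↥(F (n + 1)) ⧸ (Submodule.comap (F (n + 1)).subtype (F n))) ∧
        FiniteProjDim B (ModuleCat.of B
          (↥(F (n + 1)) ⧸ (Submodule.comap (F (n + 1)).subtype (F n))))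

/-- `X` is countably generated. -/
def CountablyGenerated (X : ModuleCat.{0} B) : Prop :=
  ∃ s : Set ↥X, s.Countable ∧ Submodule.span B s = ⊤

/-- the subgroup of `Hom_B(X,Y)` generated by morphisms factoring through projectives. -/
def projSub (X Y : ModuleCat.{0} B) : AddSubgroup (X ⟶ Y) :=
  AddSubgroup.closure {f : X ⟶ Y |
    ∃ (P : ModuleCat.{0} B) (_ : Module.Projective B P) (g : X ⟶ P) (h : P ⟶ Y), f = g ≫ h}

/-- the stable Hom-group `StHom_B(X,Y)` modulo projectives. -/
def StHomP (X Y : ModuleCat.{0} B) : Type :=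
  (X ⟶ Y) ⧸ projSub B X Y

instance (X Y : ModuleCat.{0} B) : AddCommGroup (StHomP B X Y) :=
  inferInstanceAs (AddCommGroup ((X ⟶ Y) ⧸ projSub B X Y))

/-- postcomposition as an additive map on Hom-groups. -/
def postCompHom' {Y Z : ModuleCat.{0} B} (X : ModuleCat.{0} B) (h : Y ⟶ Z) :
    (X ⟶ Y) →+ (X ⟶ Z) :=
  AddMonoidHom.mk' (fun f => f ≫ h) (fun f g => by simp [Preadditive.add_comp])

/-- postcomposition descends to the projectively stable Hom-groups. -/
def stpPostComp (X : ModuleCat.{0} B) {Y Z : ModuleCat.{0} B} (h : Y ⟶ Z) :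
    StHomP B X Y →+ StHomP B X Z :=
  QuotientAddGroup.map _ _ (postCompHom' B X h) (by
    rw [projSub, AddSubgroup.closure_le]
    rintro f ⟨P, hP, u, v, rfl⟩
    rw [SetLike.mem_coe, AddSubgroup.mem_comap]
    exact AddSubgroup.subset_closure ⟨P, hP, u, v ≫ h, by simp [postCompHom']⟩)

/-- the canonical map `⊕ᵢ StHom_B(X, Y i) → StHom_B(X, ⊕ᵢ Y i)`. -/
noncomputable def stpCanonMap (X : ModuleCat.{0} B) (I : Type) (Y : I → ModuleCat.{0} B) :
    DirectSum I (fun i => StHomP B X (Y i)) →+ StHomP B X (∐ Y) :=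
  letI : DecidableEq I := Classical.decEq I
  DirectSum.toAddMonoid fun i => stpPostComp B X (Limits.Sigma.ι Y i)

/-- `G` is compactly Gorenstein-projective: `G` is Gorenstein-projective and compact in
the stable category of Gorenstein-projective modules. -/
noncomputable def CompactlyGProj (G : ModuleCat.{0} B) : Prop :=
  IsGProj B G ∧
    ∀ (I : Type) (Z : I → ModuleCat.{0} B), (∀ i, IsGProj B (Z i)) →
      Function.Bijective (stpCanonMap B G I Z)

/-- Condition (CI): the direct sum of countably many finitely generated modules of
finite projective dimension is right `Ext`-orthogonal to all countably generated,
compactly Gorenstein-projective modules. -/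
noncomputable def CondCI : Prop :=
  ∀ Y : ℕ → ModuleCat.{0} B,
    (∀ n, Module.Finite B (Y n) ∧ FiniteProjDim B (Y n)) →
      ∀ G : ModuleCat.{0} B, CountablyGenerated B G → CompactlyGProj B G →
        ∀ i : ℕ, 1 ≤ i → extZero' B i G (∐ Y)

/-- Condition (CII): every compactly Gorenstein-projective, compactly filtered module
is projective. -/
noncomputable def CondCII : Prop :=
  ∀ X : ModuleCat.{0} B, CompactlyGProj B X → CompactlyFiltered B X →
    Module.Projective B X

/-- `B` has infinite dominant dimension: there is an exact sequence
`0 → B → I⁰ → I¹ → ⋯` with all `Iⁿ` projective-injective. -/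
def InfiniteDomDim : Prop :=
  ∃ (I : ℕ → ModuleCat.{0} B) (d0 : ModuleCat.of B B ⟶ I 0) (d : ∀ n, I n ⟶ I (n + 1)),
    (∀ n, Module.Injective B ↥(I n) ∧ Module.Projective B ↥(I n)) ∧
    Function.Injective d0 ∧ LinearMap.range d0.hom = LinearMap.ker (d 0).hom ∧
    ∀ n, LinearMap.range (d n).hom = LinearMap.ker (d (n + 1)).hom

/-- `B` has finite finitistic dimension. -/
def FiniteFinitisticDim : Prop :=
  ∃ d : ℕ, ∀ X : ModuleCat.{0} B, Module.Finite B X → FiniteProjDim B X → ProjDimLE B d X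

end Gorenstein

namespace VG

/-! ## Short exact sequences and vanishing of the first extension group -/

section Basics

variable {R : Type} [Ring R]
variable {X Y Z T K B X' Y' Z' P I C : Type}
variable [AddCommGroup X] [Module R X] [AddCommGroup Y] [Module R Y]
variable [AddCommGroup Z] [Module R Z] [AddCommGroup T] [Module R T]
variable [AddCommGroup K] [Module R K] [AddCommGroup B] [Module R B]
variable [AddCommGroup X'] [Module R X'] [AddCommGroup Y'] [Module R Y']
variable [AddCommGroup Z'] [Module R Z'] [AddCommGroup P] [Module R P]
variable [AddCommGroup I] [Module R I] [AddCommGroup C] [Module R C]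

/-- `0 → X → Y → Z → 0` is a short exact sequence. -/
structure SES (f : X →ₗ[R] Y) (g : Y →ₗ[R] Z) : Prop where
  inj : Function.Injective f
  surj : Function.Surjective g
  exact : ∀ y, g y = 0 ↔ ∃ x, f x = y

namespace SES

variable {f : X →ₗ[R] Y} {g : Y →ₗ[R] Z}

lemma apply_apply (h : SES f g) (x : X) : g (f x) = 0 := (h.exact _).2 ⟨x, rfl⟩

lemma lift (h : SES f g) (u : T →ₗ[R] Y) (hu : ∀ t, g (u t) = 0) :
    ∃ v : T →ₗ[R] X, ∀ t, f (v t) = u t := by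
  choose v hv using fun t => (h.exact _).1 (hu t)
  refine ⟨⟨⟨v, fun a b => h.inj ?_⟩, fun r a => h.inj ?_⟩, hv⟩
  · simp [hv]
  · simp [hv]

lemma desc (h : SES f g) (u : Y →ₗ[R] T) (hu : ∀ x, u (f x) = 0) :
    ∃ v : Z →ₗ[R] T, ∀ y, v (g y) = u y := by
  choose s hs using h.surj
  have key : ∀ a b, g a = g b → u a = u b := by
    intro a b hab
    obtain ⟨x, hx⟩ := (h.exact (a - b)).1 (by simp [hab])
    have := hu x
    rwa [hx, map_sub, sub_eq_zero] at this
  refine ⟨⟨⟨fun z => u (s z), fun a b => ?_⟩, fun r a => ?_⟩, fun y => key _ _ (hs _)⟩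
  · rw [← map_add]; exact key _ _ (by simp [hs])
  · rw [← map_smul]; exact key _ _ (by simp [hs])

end SES

lemma ses_ker (g : Y →ₗ[R] Z) (hg : Function.Surjective g) :
    SES (LinearMap.ker g).subtype g :=
  ⟨Subtype.val_injective, hg, fun y => ⟨fun h => ⟨⟨y, h⟩, rfl⟩, by rintro ⟨x, rfl⟩; exact x.2⟩⟩

lemma ses_mkQ (N : Submodule R Y) : SES N.subtype N.mkQ :=
  ⟨Subtype.val_injective, N.mkQ_surjective, fun y => by simp⟩

lemma ses_coker (f : X →ₗ[R] Y) (hf : Function.Injective f) :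
    SES f (LinearMap.range f).mkQ :=
  ⟨hf, Submodule.mkQ_surjective _, fun y => by simp⟩

lemma SES.congr_left {f : X →ₗ[R] Y} {g : Y →ₗ[R] Z} (h : SES f g) (e : X' ≃ₗ[R] X) :
    SES (f ∘ₗ (e : X' →ₗ[R] X)) g :=
  ⟨by simpa using h.inj, h.surj, fun y => by
    rw [h.exact]
    exact ⟨fun ⟨x, hx⟩ => ⟨e.symm x, by simp [hx]⟩, fun ⟨x, hx⟩ => ⟨e x, hx⟩⟩⟩

lemma SES.congr_right {f : X →ₗ[R] Y} {g : Y →ₗ[R] Z} (h : SES f g) (e : Z ≃ₗ[R] Z') :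
    SES f ((e : Z →ₗ[R] Z') ∘ₗ g) :=
  ⟨h.inj, by simpa using h.surj, fun y => by rw [← h.exact]; simp⟩

/-- The kernel of the difference of two maps with the same target. -/
abbrev Pull (g : Y →ₗ[R] Z) (h : X →ₗ[R] Z) : Submodule R (Y × X) :=
  LinearMap.ker (g ∘ₗ LinearMap.fst R Y X - h ∘ₗ LinearMap.snd R Y X)

lemma mem_pull {g : Y →ₗ[R] Z} {h : X →ₗ[R] Z} {p : Y × X} : p ∈ Pull g h ↔ g p.1 = h p.2 := by
  simp [sub_eq_zero]

/-- The pullback of a short exact sequence. -/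
lemma SES.pullback {f : X →ₗ[R] Y} {g : Y →ₗ[R] Z} (h : SES f g) (u : T →ₗ[R] Z) :
    ∃ i : X →ₗ[R] Pull g u, (∀ x, (i x : Y × T) = (f x, 0)) ∧
      SES i (LinearMap.snd R Y T ∘ₗ (Pull g u).subtype) := by
  refine ⟨LinearMap.codRestrict _ (LinearMap.inl R Y T ∘ₗ f) ?_, fun x => rfl, ?_, ?_, ?_⟩
  · intro x
    rw [mem_pull]
    simp [h.apply_apply]
  · intro a b hab
    have := congrArg (fun z : Pull g u => (z : Y × T).1) hab
    exact h.inj this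
  · intro t
    obtain ⟨y, hy⟩ := h.surj (u t)
    exact ⟨⟨(y, t), mem_pull.2 hy⟩, rfl⟩
  · rintro ⟨⟨y, t⟩, hp⟩
    rw [mem_pull] at hp
    constructor
    · intro ht
      obtain rfl : t = 0 := ht
      obtain ⟨x, hx⟩ := (h.exact y).1 (by simpa using hp)
      exact ⟨x, Subtype.ext (by simp [hx])⟩
    · rintro ⟨x, hx⟩
      have := congrArg (fun z : Pull g u => (z : Y × T).2) hx
      exact this.symm

variable (R X Y) in
/-- `X` is a direct summand of `Y`. -/
def Retract : Prop := ∃ (i : X →ₗ[R] Y) (p : Y →ₗ[R] X), ∀ x, p (i x) = x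

lemma Retract.of_equiv (e : X ≃ₗ[R] Y) : Retract R X Y := ⟨e, e.symm, fun x => by simp⟩

lemma Retract.refl : Retract R X X := ⟨LinearMap.id, LinearMap.id, fun _ => rfl⟩

lemma Retract.trans (h : Retract R X Y) (h' : Retract R Y Z) : Retract R X Z := by
  obtain ⟨i, p, h⟩ := h
  obtain ⟨j, q, h'⟩ := h'
  exact ⟨j ∘ₗ i, p ∘ₗ q, fun x => by simp [h, h']⟩

lemma Retract.prod (h : Retract R X X') (h' : Retract R Y Y') :
    Retract R (X × Y) (X' × Y') := by
  obtain ⟨i, p, h⟩ := h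
  obtain ⟨j, q, h'⟩ := h'
  exact ⟨i.prodMap j, p.prodMap q, fun x => by simp [h, h']⟩

lemma Retract.finsupp (h : Retract R X Y) (J : Type) : Retract R (J →₀ X) (J →₀ Y) := by
  obtain ⟨i, p, h⟩ := h
  refine ⟨Finsupp.mapRange.linearMap i, Finsupp.mapRange.linearMap p, fun x => ?_⟩
  ext j
  simp [h]

lemma nonempty_prod_ker_equiv {i : X →ₗ[R] Y} {p : Y →ₗ[R] X} (h : ∀ x, p (i x) = x) :
    Nonempty ((X × LinearMap.ker p) ≃ₗ[R] Y) := by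
  refine ⟨LinearEquiv.ofBijective (i.coprod (LinearMap.ker p).subtype) ⟨?_, ?_⟩⟩
  · rw [← LinearMap.ker_eq_bot, LinearMap.ker_eq_bot']
    rintro ⟨x, c, hc⟩ hx
    have h1 : p (i x + c) = 0 := by
      have : i x + c = 0 := by simpa using hx
      rw [this, map_zero]
    rw [LinearMap.mem_ker] at hc
    rw [map_add, h, hc, add_zero] at h1
    subst h1
    simpa using hx
  · intro y
    refine ⟨(p y, ⟨y - i (p y), by simp [h]⟩), by simp⟩

/-- A direct summand has a complement. -/
lemma Retract.exists_equiv (h : Retract R X Y) :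
    ∃ (C : Type) (_ : AddCommGroup C) (_ : Module R C), Nonempty ((X × C) ≃ₗ[R] Y) := by
  obtain ⟨i, p, h⟩ := h
  exact ⟨LinearMap.ker p, inferInstance, inferInstance, nonempty_prod_ker_equiv h⟩

variable (R X Y) in
/-- `Ext¹(X, Y) = 0`, expressed by extension of maps along kernels of epimorphisms onto `X`. -/
def Ext1 : Prop :=
  ∀ ⦃K B : Type⦄ [AddCommGroup K] [AddCommGroup B] [Module R K] [Module R B]
    ⦃f : K →ₗ[R] B⦄ ⦃g : B →ₗ[R] X⦄, SES f g → ∀ u : K →ₗ[R] Y,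
      ∃ v : B →ₗ[R] Y, ∀ x, v (f x) = u x

lemma Ext1.lift (hE : Ext1 R X Y) {f : Y →ₗ[R] I} {g : I →ₗ[R] C} (h : SES f g)
    (u : X →ₗ[R] C) : ∃ v : X →ₗ[R] I, ∀ x, g (v x) = u x := by
  obtain ⟨i, hi, hs⟩ := h.pullback u
  obtain ⟨r, hr⟩ := hE hs LinearMap.id
  obtain ⟨v, hv⟩ := hs.desc (LinearMap.fst R I X ∘ₗ (Pull g u).subtype - f ∘ₗ r)
    (fun x => by simp [hr, hi])
  refine ⟨v, fun x => ?_⟩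
  obtain ⟨p, rfl⟩ := hs.surj x
  rw [hv]
  have := mem_pull.1 p.2
  simp [h.apply_apply, this]

lemma Ext1.of_coresolution {f : Y →ₗ[R] I} {g : I →ₗ[R] C} (h : SES f g) (hI : Ext1 R X I)
    (hl : ∀ u : X →ₗ[R] C, ∃ v : X →ₗ[R] I, ∀ x, g (v x) = u x) : Ext1 R X Y := by
  intro K B _ _ _ _ a b hab u
  obtain ⟨v, hv⟩ := hI hab (f ∘ₗ u)
  obtain ⟨w, hw⟩ := hab.desc (g ∘ₗ v) (fun x => by simp [hv, h.apply_apply])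
  obtain ⟨w', hw'⟩ := hl w
  obtain ⟨z, hz⟩ := h.lift (v - w' ∘ₗ b) (fun x => by simp [hw', hw])
  exact ⟨z, fun x => h.inj (by simp [hz, hv, hab.apply_apply])⟩

lemma Ext1.of_resolution {f : K →ₗ[R] P} {g : P →ₗ[R] X} (h : SES f g) (hP : Ext1 R P Y)
    (hl : ∀ u : K →ₗ[R] Y, ∃ v : P →ₗ[R] Y, ∀ x, v (f x) = u x) : Ext1 R X Y := by
  intro K' B _ _ _ _ a b hab u
  obtain ⟨i, hi, hs⟩ := hab.pullback g
  obtain ⟨w, hw⟩ := hP hs u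
  let j : K →ₗ[R] Pull b g := LinearMap.codRestrict _ (LinearMap.inr R B P ∘ₗ f)
    (fun x => by rw [mem_pull]; simp [h.apply_apply])
  obtain ⟨v, hv⟩ := hl (w ∘ₗ j)
  have hs' : SES j (LinearMap.fst R B P ∘ₗ (Pull b g).subtype) := by
    refine ⟨fun x y hxy => h.inj (congrArg (fun z : Pull b g => (z : B × P).2) hxy),
      fun x => ?_, ?_⟩
    · obtain ⟨p, hp⟩ := h.surj (b x)
      exact ⟨⟨(x, p), mem_pull.2 hp.symm⟩, rfl⟩
    · rintro ⟨⟨x, p⟩, hp⟩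
      rw [mem_pull] at hp
      constructor
      · intro hx
        obtain rfl : x = 0 := hx
        obtain ⟨y, hy⟩ := (h.exact p).1 (by simpa using hp.symm)
        exact ⟨y, Subtype.ext (by simp [j, hy])⟩
      · rintro ⟨y, hy⟩
        exact (congrArg (fun z : Pull b g => (z : B × P).1) hy).symm
  obtain ⟨z, hz⟩ := hs'.desc (w - v ∘ₗ LinearMap.snd R B P ∘ₗ (Pull b g).subtype)
    (fun x => by simp [j] at hv ⊢; simp [hv])
  refine ⟨z, fun x => ?_⟩
  have h1 : a x = (LinearMap.fst R B P ∘ₗ (Pull b g).subtype) (i x) := by simp [hi]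
  rw [h1, hz]
  simp [hi, hw]

lemma Ext1.of_projective [Module.Projective R X] : Ext1 R X Y := by
  intro K B _ _ _ _ a b hab u
  obtain ⟨s, hs⟩ := Module.projective_lifting_property b LinearMap.id hab.surj
  obtain ⟨r, hr⟩ := hab.lift (LinearMap.id - s ∘ₗ b) (fun x => by
    have := LinearMap.congr_fun hs (b x)
    simp at this
    simp [this])
  exact ⟨u ∘ₗ r, fun x => congrArg u (hab.inj (by simp [hr, hab.apply_apply]))⟩

lemma Ext1.of_injective [Module.Injective R Y] : Ext1 R X Y :=
  fun _ _ _ _ _ _ f _ h u => Module.Injective.out f h.inj u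

lemma Ext1.retract_right (h : Ext1 R X Y) (hr : Retract R Z Y) : Ext1 R X Z := by
  obtain ⟨i, p, hip⟩ := hr
  intro K B _ _ _ _ a b hab u
  obtain ⟨v, hv⟩ := h hab (i ∘ₗ u)
  exact ⟨p ∘ₗ v, fun x => by simp [hv, hip]⟩

lemma Ext1.retract_left (h : Ext1 R X Y) (hr : Retract R Z X) : Ext1 R Z Y := by
  obtain ⟨i, p, hip⟩ := hr
  intro K B _ _ _ _ a b hab u
  obtain ⟨j, hj, hs⟩ := hab.pullback p
  obtain ⟨v, hv⟩ := h hs u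
  let s : B →ₗ[R] Pull b p := LinearMap.codRestrict _ (LinearMap.prod LinearMap.id (i ∘ₗ b))
    (fun x => by rw [mem_pull]; simp [hip])
  refine ⟨v ∘ₗ s, fun x => ?_⟩
  have : s (a x) = j x := Subtype.ext (by simp [hj, s, hab.apply_apply])
  simp [this, hv]

lemma Ext1.congr_left (h : Ext1 R X Y) (e : X ≃ₗ[R] Z) : Ext1 R Z Y :=
  h.retract_left (.of_equiv e.symm)

lemma Ext1.congr_right (h : Ext1 R X Y) (e : Y ≃ₗ[R] Z) : Ext1 R X Z :=
  h.retract_right (.of_equiv e.symm)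

/-- The kernel of an epimorphism, as an abstract module. -/
lemma exists_ses_of_surjective (g : Y →ₗ[R] Z) (hg : Function.Surjective g) :
    ∃ (K : Type) (_ : AddCommGroup K) (_ : Module R K) (f : K →ₗ[R] Y), SES f g :=
  ⟨_, _, _, _, ses_ker g hg⟩

/-- The cokernel of a monomorphism, as an abstract module. -/
lemma exists_ses_of_injective (f : X →ₗ[R] Y) (hf : Function.Injective f) :
    ∃ (C : Type) (_ : AddCommGroup C) (_ : Module R C) (g : Y →ₗ[R] C), SES f g :=
  ⟨_, _, _, _, ses_coker f hf⟩

variable (R) in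
/-- Enough projectives, with free middle term. -/
lemma exists_free_ses (X : Type) [AddCommGroup X] [Module R X] :
    ∃ (J K : Type) (_ : AddCommGroup K) (_ : Module R K) (f : K →ₗ[R] (J →₀ R))
      (g : (J →₀ R) →ₗ[R] X), SES f g := by
  have h : Function.Surjective (Finsupp.linearCombination R (id : X → X)) :=
    fun x => ⟨Finsupp.single x 1, by simp⟩
  obtain ⟨K, _, _, f, hf⟩ := exists_ses_of_surjective _ h
  exact ⟨X, K, _, _, f, _, hf⟩

variable (R) in
/-- Enough injectives. -/
lemma exists_injective_ses (X : Type) [AddCommGroup X] [Module R X] :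
    ∃ (I C : Type) (_ : AddCommGroup I) (_ : Module R I) (_ : AddCommGroup C) (_ : Module R C)
      (f : X →ₗ[R] I) (g : I →ₗ[R] C), Module.Injective R I ∧ SES f g := by
  obtain ⟨⟨J, hJ, f, hf⟩⟩ := EnoughInjectives.presentation (ModuleCat.of R X)
  obtain ⟨C, _, _, g, h⟩ := exists_ses_of_injective f.hom ((ModuleCat.mono_iff_injective f).1 hf)
  exact ⟨J, C, _, _, _, _, f.hom, g, (Module.injective_iff_injective_object R J).2 hJ, h⟩

lemma Ext1.ext_right {f : X →ₗ[R] Y} {g : Y →ₗ[R] Z} (h : SES f g) (h1 : Ext1 R T X)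
    (h2 : Ext1 R T Z) : Ext1 R T Y := by
  obtain ⟨J, K, _, _, a, q, hs⟩ := exists_free_ses R T
  refine Ext1.of_resolution hs Ext1.of_projective fun u => ?_
  obtain ⟨v, hv⟩ := h2 hs (g ∘ₗ u)
  obtain ⟨w, hw⟩ := Module.projective_lifting_property g v h.surj
  have hw' : ∀ x, g (w x) = v x := fun x => LinearMap.congr_fun hw x
  obtain ⟨z, hz⟩ := h.lift (u - w ∘ₗ a) (fun x => by simp [hw', hv])
  obtain ⟨z', hz'⟩ := h1 hs z
  exact ⟨w + f ∘ₗ z', fun x => by simp [hz', hz]⟩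

lemma Ext1.ext_left {f : X →ₗ[R] Y} {g : Y →ₗ[R] Z} (h : SES f g) (h1 : Ext1 R X T)
    (h2 : Ext1 R Z T) : Ext1 R Y T := by
  obtain ⟨I, C, _, _, _, _, i, q, _, hs⟩ := exists_injective_ses R T
  refine Ext1.of_coresolution hs Ext1.of_injective fun u => ?_
  obtain ⟨v, hv⟩ := h1.lift hs (u ∘ₗ f)
  obtain ⟨w, hw⟩ := Module.Injective.out f h.inj v
  obtain ⟨z, hz⟩ := h.desc (u - q ∘ₗ w) (fun x => by simp [hw, hv])
  obtain ⟨z', hz'⟩ := h2.lift hs z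
  exact ⟨w + z' ∘ₗ g, fun x => by simp [hz', hz]⟩

lemma ses_prod : SES (LinearMap.inl R X Y) (LinearMap.snd R X Y) :=
  ⟨LinearMap.inl_injective, LinearMap.snd_surjective, fun y => by
    constructor
    · intro h; exact ⟨y.1, by ext <;> simp_all⟩
    · rintro ⟨x, rfl⟩; rfl⟩

lemma Ext1.prod_left (h1 : Ext1 R X T) (h2 : Ext1 R Y T) : Ext1 R (X × Y) T :=
  Ext1.ext_left ses_prod h1 h2

lemma Ext1.finsupp_left (h : Ext1 R X Y) (J : Type) : Ext1 R (J →₀ X) Y := by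
  obtain ⟨I, C, _, _, _, _, i, q, _, hs⟩ := exists_injective_ses R Y
  refine Ext1.of_coresolution hs Ext1.of_injective fun u => ?_
  choose v hv using fun j => h.lift hs (u ∘ₗ Finsupp.lsingle j)
  refine ⟨Finsupp.lsum ℕ v, fun x => ?_⟩
  induction x using Finsupp.induction_linear with
  | zero => simp
  | add a b ha hb => simp only [map_add, ha, hb]
  | single j x => have := hv j x; simp at this; simp [this]

lemma Ext1.pi_right {J : Type} {Y : J → Type} [∀ j, AddCommGroup (Y j)] [∀ j, Module R (Y j)]
    (h : ∀ j, Ext1 R X (Y j)) : Ext1 R X (∀ j, Y j) := by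
  intro K B _ _ _ _ a b hab u
  choose v hv using fun j => h j hab (LinearMap.proj j ∘ₗ u)
  exact ⟨LinearMap.pi v, fun x => by ext j; simp [hv]⟩

/-- Dimension shift, from the left variable to the right one. -/
lemma Ext1.shift_right {a : K →ₗ[R] P} {b : P →ₗ[R] X} {f : Y →ₗ[R] I} {g : I →ₗ[R] C}
    (hX : SES a b) (hY : SES f g) [Module.Injective R I] (hP : Ext1 R P C)
    (h : Ext1 R K Y) : Ext1 R X C := by
  refine Ext1.of_resolution hX hP fun u => ?_
  obtain ⟨v, hv⟩ := h.lift hY u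
  obtain ⟨w, hw⟩ := Module.Injective.out a hX.inj v
  exact ⟨g ∘ₗ w, fun x => by simp [hw, hv]⟩

/-- Dimension shift, from the right variable to the left one. -/
lemma Ext1.shift_left {a : K →ₗ[R] P} {b : P →ₗ[R] X} {f : Y →ₗ[R] I} {g : I →ₗ[R] C}
    (hX : SES a b) (hY : SES f g) (hKI : Ext1 R K I) (hPY : Ext1 R P Y)
    (h : Ext1 R X C) : Ext1 R K Y := by
  refine Ext1.of_coresolution hY hKI fun u => ?_
  obtain ⟨v, hv⟩ := h hX u
  obtain ⟨w, hw⟩ := hPY.lift hY v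
  exact ⟨w ∘ₗ a, fun x => by simp [hw, hv]⟩

end Basics


/-! ## Duality over a finite-dimensional algebra -/

section Scalars

variable (k Λ : Type) [Field k] [Ring Λ] [Algebra k Λ]

lemma exists_tower (N : Type) [AddCommGroup N] [Module Λ N] :
    ∃ _ : Module k N, IsScalarTower k Λ N := by
  let _ := Module.compHom N (algebraMap k Λ)
  refine ⟨inferInstance, ⟨fun c x n => ?_⟩⟩
  change (c • x) • n = algebraMap k Λ c • (x • n)
  rw [Algebra.smul_def, mul_smul]

/-- The canonical map from `N^(K)` to `N^J` determined by a family of functions on `J`. -/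
noncomputable def coordMap {J K : Type} (b : K → J → k) (N : Type) [AddCommGroup N] [Module Λ N]
    [Module k N] [IsScalarTower k Λ N] : (K →₀ N) →ₗ[Λ] (J → N) :=
  letI := IsScalarTower.to_smulCommClass (R := k) (A := Λ) (M := N)
  Finsupp.lsum ℕ fun κ => LinearMap.pi fun i => b κ i • (LinearMap.id : N →ₗ[Λ] N)

variable {k Λ}

lemma coordMap_apply {J K : Type} (b : K → J → k) (N : Type) [AddCommGroup N] [Module Λ N]
    [Module k N] [IsScalarTower k Λ N] (m : K →₀ N) (i : J) :
    coordMap k Λ b N m i = m.sum fun κ n => b κ i • n := by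
  simp [coordMap, Finsupp.sum, Finset.sum_apply]

lemma coordMap_single {J K : Type} (b : K → J → k) (N : Type) [AddCommGroup N] [Module Λ N]
    [Module k N] [IsScalarTower k Λ N] (κ : K) (n : N) (i : J) :
    coordMap k Λ b N (Finsupp.single κ n) i = b κ i • n := by
  simp [coordMap_apply]

lemma coordMap_naturality {J K : Type} (b : K → J → k) {N N' : Type} [AddCommGroup N] [Module Λ N]
    [Module k N] [IsScalarTower k Λ N] [AddCommGroup N'] [Module Λ N']
    [Module k N'] [IsScalarTower k Λ N'] (f : N →ₗ[Λ] N') (m : K →₀ N) (i : J) :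
    coordMap k Λ b N' (m.mapRange f (map_zero f)) i = f (coordMap k Λ b N m i) := by
  induction m using Finsupp.induction_linear with
  | zero => simp
  | add x y hx hy =>
    rw [Finsupp.mapRange_add (fun a b => map_add f a b)]
    simp [hx, hy]
  | single κ n => simp [coordMap_single]

lemma coordMap_bijective {J K : Type} (b : Module.Basis K k (J → k)) (N : Type) [AddCommGroup N]
    [Module Λ N] [Module k N] [IsScalarTower k Λ N] [Module.Finite k N] :
    Function.Bijective (coordMap k Λ b N) := by
  let e := Module.finBasis k N
  constructor
  · rw [← LinearMap.ker_eq_bot, LinearMap.ker_eq_bot']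
    intro m hm
    ext κ
    refine e.ext_elem fun j => ?_
    have h1 : Finsupp.linearCombination k b (m.mapRange (e.coord j) (map_zero _)) = 0 := by
      ext i
      have h2 := congrArg (e.coord j) (congrFun hm i)
      rw [coordMap_apply, Finsupp.sum, map_sum] at h2
      rw [Finsupp.linearCombination_apply, Finsupp.sum_mapRange_index (by simp)]
      simpa [Finsupp.sum, Finset.sum_apply, mul_comm] using h2
    have h3 := (linearIndependent_iff.1 b.linearIndependent) _ h1
    simpa using DFunLike.congr_fun h3 κ
  · intro f
    refine ⟨∑ j, (b.repr (fun i => e.coord j (f i))).mapRange (fun c => c • e j) (by simp), ?_⟩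
    ext i
    rw [map_sum, Finset.sum_apply]
    have : ∀ g : J → k, ∀ n : N,
        coordMap k Λ b N ((b.repr g).mapRange (fun c => c • n) (by simp)) i = g i • n := by
      intro g n
      rw [coordMap_apply, Finsupp.sum_mapRange_index (by simp)]
      conv_rhs => rw [← b.linearCombination_repr g]
      rw [Finsupp.linearCombination_apply, Finsupp.sum, Finsupp.sum, Finset.sum_apply,
        Finset.sum_smul]
      refine Finset.sum_congr rfl fun κ _ => ?_
      rw [Pi.smul_apply, smul_eq_mul, smul_smul, mul_comm]
    simp only [this]
    conv_rhs => rw [← e.sum_repr (f i)]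
    rfl

variable (k Λ) [FiniteDimensional k Λ]

lemma finite_tower (N : Type) [AddCommGroup N] [Module Λ N] [Module k N] [IsScalarTower k Λ N]
    [Module.Finite Λ N] : Module.Finite k N := Module.Finite.trans Λ N

lemma exists_pi_equiv_finsupp (k Λ : Type) [Field k] [Ring Λ] [Algebra k Λ]
    [FiniteDimensional k Λ] (N : Type) [AddCommGroup N] [Module Λ N] [Module.Finite Λ N]
    (J : Type) : ∃ K : Type, Nonempty ((J → N) ≃ₗ[Λ] (K →₀ N)) ∧ Nonempty (J ↪ K) := by
  obtain ⟨_, _⟩ := exists_tower k Λ N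
  have := finite_tower k Λ N
  let b := Module.Basis.ofVectorSpace k (J → k)
  refine ⟨_, ⟨(LinearEquiv.ofBijective _ (coordMap_bijective (Λ := Λ) b N)).symm⟩, ?_⟩
  classical
  have h := (Pi.linearIndependent_single_one J k).cardinal_le_rank
  rw [← b.mk_eq_rank''] at h
  exact h

lemma finsupp_retract {R : Type} [Ring R] (N : Type) [AddCommGroup N] [Module R N] {J K : Type}
    (i : J ↪ K) : Retract R (J →₀ N) (K →₀ N) :=
  ⟨Finsupp.lmapDomain N R i, Finsupp.lcomapDomain i i.injective, fun x => by
    ext j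
    simp [Finsupp.lcomapDomain, Finsupp.mapDomain_apply i.injective]⟩

lemma finsupp_retract_pi (k Λ : Type) [Field k] [Ring Λ] [Algebra k Λ] [FiniteDimensional k Λ]
    (N : Type) [AddCommGroup N] [Module Λ N] [Module.Finite Λ N]
    (J : Type) : Retract Λ (J →₀ N) (J → N) := by
  obtain ⟨K, ⟨e⟩, ⟨i⟩⟩ := exists_pi_equiv_finsupp k Λ N J
  exact (finsupp_retract N i).trans (.of_equiv e.symm)

end Scalars

section Dual

/-- The `k`-dual of a module `N` on which a ring acts from the right through `ρ`. -/
def DualMod {k Λ N : Type} [Field k] [Ring Λ] [AddCommGroup N] [Module k N]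
    (_ρ : Λ →+* (Module.End k N)ᵐᵒᵖ) : Type := N →ₗ[k] k

namespace DualMod

variable {k Λ N : Type} [Field k] [Ring Λ] [AddCommGroup N] [Module k N]
  (ρ : Λ →+* (Module.End k N)ᵐᵒᵖ)

instance : AddCommGroup (DualMod ρ) := inferInstanceAs (AddCommGroup (N →ₗ[k] k))

instance : FunLike (DualMod ρ) N k := inferInstanceAs (FunLike (N →ₗ[k] k) N k)

instance : LinearMapClass (DualMod ρ) k N k :=
  inferInstanceAs (LinearMapClass (N →ₗ[k] k) k N k)

instance : SMul Λ (DualMod ρ) := ⟨fun x ξ => (LinearMap.comp ξ (ρ x).unop : N →ₗ[k] k)⟩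

variable {ρ}

@[ext] lemma ext {ξ η : DualMod ρ} (h : ∀ n, ξ n = η n) : ξ = η := DFunLike.ext _ _ h

@[simp] lemma smul_apply (x : Λ) (ξ : DualMod ρ) (n : N) : (x • ξ) n = ξ ((ρ x).unop n) := rfl

@[simp] lemma add_apply (ξ η : DualMod ρ) (n : N) : (ξ + η) n = ξ n + η n := rfl

@[simp] lemma zero_apply (n : N) : (0 : DualMod ρ) n = 0 := rfl

@[simp] lemma sub_apply (ξ η : DualMod ρ) (n : N) : (ξ - η) n = ξ n - η n := rfl

@[simp] lemma neg_apply (ξ : DualMod ρ) (n : N) : (-ξ) n = -ξ n := rfl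

/-- View a functional as an element of the dual module. -/
def mk (ρ : Λ →+* (Module.End k N)ᵐᵒᵖ) (ξ : N →ₗ[k] k) : DualMod ρ := ξ

@[simp] lemma mk_apply (ξ : N →ₗ[k] k) (n : N) : mk ρ ξ n = ξ n := rfl

instance : Module Λ (DualMod ρ) where
  one_smul ξ := by ext; simp
  mul_smul x y ξ := by ext; simp
  smul_zero x := by ext; simp
  smul_add x ξ η := by ext; simp
  add_smul x y ξ := by ext; simp
  zero_smul ξ := by ext; simp

@[simp] lemma sum_apply {ι : Type} (s : Finset ι) (ξ : ι → DualMod ρ) (n : N) :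
    (∑ i ∈ s, ξ i) n = ∑ i ∈ s, ξ i n := LinearMap.sum_apply (R := k) s ξ n

end DualMod

variable (k Λ : Type) [Field k] [Ring Λ] [Algebra k Λ]

/-- Right multiplication as a ring homomorphism to the opposite endomorphism ring. -/
def rightMul : Λ →+* (Module.End k Λ)ᵐᵒᵖ where
  toFun x := MulOpposite.op (LinearMap.mulRight k x)
  map_one' := by simp; rfl
  map_mul' x y := by rw [← MulOpposite.op_mul]; congr 1; ext; simp [mul_assoc]
  map_zero' := by simp
  map_add' x y := by rw [← MulOpposite.op_add]; congr 1; ext; simp [mul_add]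

/-- The injective cogenerator `Hom_k(Λ, k)`. -/
abbrev W : Type := DualMod (rightMul k Λ)

variable {k Λ}

lemma W.smul_apply' (x : Λ) (φ : W k Λ) (y : Λ) : (x • φ) y = φ (y * x) := rfl

section toW

variable {V : Type} [AddCommGroup V] [Module Λ V] [Module k V] [IsScalarTower k Λ V]

/-- The homomorphism to `W` determined by a functional. -/
def toW (ξ : V →ₗ[k] k) : V →ₗ[Λ] W k Λ where
  toFun v := DualMod.mk _ (ξ ∘ₗ (LinearMap.toSpanSingleton Λ V v).restrictScalars k)
  map_add' v w := by ext; simp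
  map_smul' x v := DualMod.ext fun y => congrArg ξ (mul_smul y x v).symm

lemma toW_apply (ξ : V →ₗ[k] k) (v : V) (x : Λ) : toW (Λ := Λ) ξ v x = ξ (x • v) := rfl

/-- The functional determined by a homomorphism to `W`. -/
def ofW (f : V →ₗ[Λ] W k Λ) : V →ₗ[k] k where
  toFun v := f v 1
  map_add' v w := by simp
  map_smul' c v := by
    rw [← algebraMap_smul Λ c v, map_smul, W.smul_apply', one_mul, RingHom.id_apply,
      Algebra.algebraMap_eq_smul_one, map_smul]

lemma ofW_apply (f : V →ₗ[Λ] W k Λ) (v : V) : ofW f v = f v 1 := rfl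

lemma toW_ofW (f : V →ₗ[Λ] W k Λ) : toW (ofW f) = f := by
  ext v x
  rw [toW_apply, ofW_apply, map_smul, W.smul_apply', one_mul]

lemma ofW_toW (ξ : V →ₗ[k] k) : ofW (toW (Λ := Λ) ξ) = ξ := by
  ext v
  simp [ofW_apply, toW_apply]

end toW

instance W.injective : Module.Injective Λ (W k Λ) where
  out X Y _ _ _ _ f hf g := by
    obtain ⟨_, _⟩ := exists_tower k Λ X
    obtain ⟨_, _⟩ := exists_tower k Λ Y
    obtain ⟨r, hr⟩ := LinearMap.exists_leftInverse_of_injective (f.restrictScalars k)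
      (LinearMap.ker_eq_bot.2 hf)
    refine ⟨toW (ofW g ∘ₗ r), fun x => ?_⟩
    conv_rhs => rw [← toW_ofW g]
    ext y
    rw [toW_apply, toW_apply, ← map_smul]
    exact congrArg (ofW g) (LinearMap.congr_fun hr (y • x))

variable (k) in
lemma exists_W_ne_zero {V : Type} [AddCommGroup V] [Module Λ V] {v : V} (hv : v ≠ 0) :
    ∃ f : V →ₗ[Λ] W k Λ, f v ≠ 0 := by
  obtain ⟨_, _⟩ := exists_tower k Λ V
  by_contra! h
  have : ∀ ξ : V →ₗ[k] k, ξ v = 0 := fun ξ => by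
    have := congrArg (fun φ : W k Λ => φ 1) (h (toW ξ))
    simpa [toW_apply] using this
  exact hv ((Module.forall_dual_apply_eq_zero_iff k v).1 this)

variable (k) in
lemma exists_W_separating {V : Type} [AddCommGroup V] [Module Λ V] {N : Submodule Λ V} {v : V}
    (hv : v ∉ N) : ∃ f : V →ₗ[Λ] W k Λ, (∀ n ∈ N, f n = 0) ∧ f v ≠ 0 := by
  obtain ⟨f, hf⟩ := exists_W_ne_zero k (Λ := Λ) (v := N.mkQ v) (by simpa using hv)
  exact ⟨f ∘ₗ N.mkQ, fun n hn => by
    rw [LinearMap.comp_apply, (by simpa using hn : N.mkQ n = 0), map_zero], hf⟩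

variable (k) in
lemma exists_pi_W_embedding (V : Type) [AddCommGroup V] [Module Λ V] :
    ∃ (J : Type) (f : V →ₗ[Λ] (J → W k Λ)), Function.Injective f := by
  refine ⟨V →ₗ[Λ] W k Λ, LinearMap.pi fun f => f, ?_⟩
  rw [← LinearMap.ker_eq_bot, LinearMap.ker_eq_bot']
  intro v hv
  by_contra h
  obtain ⟨f, hf⟩ := exists_W_ne_zero k (Λ := Λ) h
  exact hf (congrFun hv f)

instance W.moduleScalars : Module k (W k Λ) := inferInstanceAs (Module k (Λ →ₗ[k] k))

lemma W.scalar_smul_apply (c : k) (φ : W k Λ) (x : Λ) : (c • φ) x = c * φ x := rfl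

instance W.tower : IsScalarTower k Λ (W k Λ) where
  smul_assoc c x φ := by
    ext y
    rw [W.smul_apply', mul_smul_comm, map_smul, W.scalar_smul_apply, W.smul_apply', smul_eq_mul]

variable [FiniteDimensional k Λ]

instance W.finiteScalars : Module.Finite k (W k Λ) :=
  inferInstanceAs (Module.Finite k (Λ →ₗ[k] k))

instance W.finite : Module.Finite Λ (W k Λ) := Module.Finite.of_restrictScalars_finite k Λ _

variable (k) in
lemma exists_fin_W_embedding (V : Type) [AddCommGroup V] [Module Λ V] [Module.Finite Λ V] :
    ∃ (n : ℕ) (f : V →ₗ[Λ] (Fin n → W k Λ)), Function.Injective f := by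
  obtain ⟨_, _⟩ := exists_tower k Λ V
  have := finite_tower k Λ V
  let b := Module.finBasis k V
  refine ⟨_, LinearMap.pi fun i => toW (b.coord i), ?_⟩
  rw [← LinearMap.ker_eq_bot, LinearMap.ker_eq_bot']
  intro v hv
  refine b.ext_elem fun i => ?_
  have := congrArg (fun φ : W k Λ => φ 1) (congrFun hv i)
  simpa [toW_apply] using this

lemma injective_of_retract {R : Type} [Ring R] {X Y : Type} [AddCommGroup X] [Module R X]
    [AddCommGroup Y] [Module R Y] [Module.Injective R Y] (h : Retract R X Y) :
    Module.Injective R X := by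
  obtain ⟨i, p, hip⟩ := h
  refine ⟨fun U V _ _ _ _ f hf g => ?_⟩
  obtain ⟨h, hh⟩ := Module.Injective.out f hf (i ∘ₗ g)
  exact ⟨p ∘ₗ h, fun x => by simp [hh, hip]⟩

lemma retract_of_injective {R : Type} [Ring R] {X Y : Type} [AddCommGroup X] [Module R X]
    [AddCommGroup Y] [Module R Y] [Module.Injective R X] (i : X →ₗ[R] Y)
    (hi : Function.Injective i) : Retract R X Y := by
  obtain ⟨p, hp⟩ := Module.Injective.out i hi LinearMap.id
  exact ⟨i, p, hp⟩

instance W.injective_finsupp (J : Type) : Module.Injective Λ (J →₀ W k Λ) :=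
  injective_of_retract (finsupp_retract_pi k Λ (W k Λ) J)

variable (k) in
/-- Every module embeds into a direct sum of copies of `W`. -/
lemma exists_finsupp_W_embedding (V : Type) [AddCommGroup V] [Module Λ V] :
    ∃ (J : Type) (f : V →ₗ[Λ] (J →₀ W k Λ)), Function.Injective f := by
  obtain ⟨J, f, hf⟩ := exists_pi_W_embedding k (Λ := Λ) V
  obtain ⟨K, ⟨e⟩, _⟩ := exists_pi_equiv_finsupp k Λ (W k Λ) J
  exact ⟨K, e.toLinearMap ∘ₗ f, by simpa using hf⟩

variable (k) in
lemma exists_finsupp_W_ses (V : Type) [AddCommGroup V] [Module Λ V] :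
    ∃ (J C : Type) (_ : AddCommGroup C) (_ : Module Λ C) (f : V →ₗ[Λ] (J →₀ W k Λ))
      (g : (J →₀ W k Λ) →ₗ[Λ] C), SES f g := by
  obtain ⟨J, f, hf⟩ := exists_finsupp_W_embedding k (Λ := Λ) V
  obtain ⟨C, _, _, g, h⟩ := exists_ses_of_injective f hf
  exact ⟨J, C, _, _, f, g, h⟩

end Dual


/-! ## Direct sums in the second variable -/

section DirectSums

variable {R : Type} [Ring R]

/-- A map from a finitely generated module to a direct sum lands in a finite subsum. -/
lemma exists_finset_component_eq_zero {K J : Type} [AddCommGroup K] [Module R K]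
    [Module.Finite R K] {Y : J → Type} [∀ j, AddCommGroup (Y j)] [∀ j, Module R (Y j)]
    (u : K →ₗ[R] DirectSum J Y) : ∃ s : Finset J, ∀ x, ∀ j ∉ s, u x j = 0 := by
  classical
  obtain ⟨t, ht⟩ := (Module.Finite.fg_top : (⊤ : Submodule R K).FG)
  refine ⟨t.biUnion fun x => DFinsupp.support (u x), fun x j hj => ?_⟩
  have hx : x ∈ Submodule.span R (t : Set K) := ht ▸ Submodule.mem_top
  induction hx using Submodule.span_induction with
  | mem x hx =>
    simp only [Finset.mem_biUnion, not_exists, not_and] at hj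
    simpa using hj x hx
  | zero => simp
  | add x y _ _ hx hy => simp [hx, hy]
  | smul r x _ hx =>
    rw [map_smul]
    exact (DirectSum.smul_apply r (u x) j).trans (by rw [hx, smul_zero])

lemma Ext1.directSum_right {X K P J : Type} [AddCommGroup X] [Module R X] [AddCommGroup K]
    [Module R K] [AddCommGroup P] [Module R P] [Module.Projective R P] [Module.Finite R K]
    {a : K →ₗ[R] P} {b : P →ₗ[R] X} (hs : SES a b)
    {Y : J → Type} [∀ j, AddCommGroup (Y j)] [∀ j, Module R (Y j)]
    (h : ∀ j, Ext1 R X (Y j)) : Ext1 R X (DirectSum J Y) := by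
  classical
  refine Ext1.of_resolution hs Ext1.of_projective fun u => ?_
  obtain ⟨s, hs'⟩ := exists_finset_component_eq_zero u
  choose v hv using fun j => h j hs (DirectSum.component R J Y j ∘ₗ u)
  refine ⟨∑ j ∈ s, DirectSum.lof R J Y j ∘ₗ v j, fun x => ?_⟩
  refine DirectSum.ext_component R fun j => ?_
  simp only [LinearMap.sum_apply, LinearMap.comp_apply, hv, map_sum]
  by_cases hj : j ∈ s
  · rw [Finset.sum_eq_single j]
    · rw [DirectSum.component.lof_self]
    · intro i _ hi
      rw [DirectSum.component.of, dif_neg hi]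
    · intro h; exact absurd hj h
  · rw [Finset.sum_eq_zero]
    · exact (hs' x j hj).symm
    · intro i hi
      rw [DirectSum.component.of, dif_neg]
      rintro rfl
      exact hj hi

lemma Ext1.finsupp_right {X K P J : Type} [AddCommGroup X] [Module R X] [AddCommGroup K]
    [Module R K] [AddCommGroup P] [Module R P] [Module.Projective R P] [Module.Finite R K]
    {a : K →ₗ[R] P} {b : P →ₗ[R] X} (hs : SES a b)
    {Y : Type} [AddCommGroup Y] [Module R Y]
    (h : Ext1 R X Y) : Ext1 R X (J →₀ Y) := by
  classical
  exact (Ext1.directSum_right (J := J) hs (fun _ => h)).congr_right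
    (finsuppLEquivDirectSum R Y J).symm

end DirectSums

/-! ## Bi-infinite chains -/

lemma exists_int_chain {α : Type*} (s : α → α → Prop) (h1 : ∀ x, ∃ y, s x y)
    (h2 : ∀ y, ∃ x, s x y) (x₀ : α) : ∃ c : ℤ → α, c 0 = x₀ ∧ ∀ i, s (c i) (c (i + 1)) := by
  choose up hup using h1
  choose dn hdn using h2
  refine ⟨fun i => if 0 ≤ i then up^[i.toNat] x₀ else dn^[(-i).toNat] x₀, by simp, fun i => ?_⟩
  dsimp only
  rcases lt_trichotomy i (-1) with hi | rfl | hi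
  · rw [if_neg (by omega), if_neg (by omega),
      (by omega : (-i).toNat = (-(i + 1)).toNat + 1), Function.iterate_succ_apply']
    exact hdn _
  · simp [hdn]
  · rw [if_pos (by omega), if_pos (by omega), (by omega : (i + 1).toNat = i.toNat + 1),
      Function.iterate_succ_apply']
    exact hup _

/-! ## Gorenstein-injective modules over an algebra of infinite dominant dimension -/

/-- A resolution of `W` by finitely generated projectives and a coresolution of `Λ` by
finitely generated projective-injectives. -/
structure DomData (k Λ : Type) [Field k] [Ring Λ] [Algebra k Λ] where
  (Ω P Z I : ℕ → ModuleCat.{0} Λ)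
  a : ∀ n, Ω (n + 1) →ₗ[Λ] P n
  b : ∀ n, P n →ₗ[Λ] Ω n
  sesΩ : ∀ n, SES (a n) (b n)
  zeroΩ : Ω 0 ≃ₗ[Λ] W k Λ
  finΩ : ∀ n, Module.Finite Λ (Ω n)
  finP : ∀ n, Module.Finite Λ (P n)
  projP : ∀ n, Module.Projective Λ (P n)
  c : ∀ n, Z n →ₗ[Λ] I n
  d : ∀ n, I n →ₗ[Λ] Z (n + 1)
  sesZ : ∀ n, SES (c n) (d n)
  zeroZ : Z 0 ≃ₗ[Λ] Λ
  finZ : ∀ n, Module.Finite Λ (Z n)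
  finI : ∀ n, Module.Finite Λ (I n)
  projI : ∀ n, Module.Projective Λ (I n)
  injI : ∀ n, Module.Injective Λ (I n)

attribute [instance] DomData.finΩ DomData.finP DomData.projP DomData.finZ DomData.finI
  DomData.projI DomData.injI

section GI

variable {k Λ : Type} [Field k] [Ring Λ] [Algebra k Λ]
variable (D : DomData k Λ)
variable {X Y Z T K B X' Y' Z' P I C L : Type}
variable [AddCommGroup X] [Module Λ X] [AddCommGroup Y] [Module Λ Y]
variable [AddCommGroup Z] [Module Λ Z] [AddCommGroup L] [Module Λ L]
variable [AddCommGroup K] [Module Λ K] [AddCommGroup I] [Module Λ I]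
variable [AddCommGroup C] [Module Λ C]

/-- The `Ext`-orthogonality description of Gorenstein-injective modules. -/
def GI (L : Type) [AddCommGroup L] [Module Λ L] : Prop :=
  ∀ n, Ext1 Λ (D.Ω n) L ∧ Ext1 Λ (D.Z n) L

variable {D}

lemma GI.ext1_W (h : GI D L) : Ext1 Λ (W k Λ) L := (h 0).1.congr_left D.zeroΩ

lemma GI.ext {f : X →ₗ[Λ] Y} {g : Y →ₗ[Λ] Z} (h : SES f g) (h1 : GI D X) (h2 : GI D Z) :
    GI D Y :=
  fun n => ⟨.ext_right h (h1 n).1 (h2 n).1, .ext_right h (h1 n).2 (h2 n).2⟩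

lemma GI.retract (h : GI D Y) (hr : Retract Λ X Y) : GI D X :=
  fun n => ⟨(h n).1.retract_right hr, (h n).2.retract_right hr⟩

lemma GI.congr (h : GI D Y) (e : Y ≃ₗ[Λ] X) : GI D X := h.retract (.of_equiv e.symm)

lemma GI.of_injective [Module.Injective Λ L] : GI D L :=
  fun _ => ⟨.of_injective, .of_injective⟩

lemma GI.pi {J : Type} {Y : J → Type} [∀ j, AddCommGroup (Y j)] [∀ j, Module Λ (Y j)]
    (h : ∀ j, GI D (Y j)) : GI D (∀ j, Y j) :=
  fun n => ⟨.pi_right fun j => (h j n).1, .pi_right fun j => (h j n).2⟩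

lemma ext1_zeroZ : Ext1 Λ (D.Z 0) L :=
  (Ext1.of_projective (R := Λ) (X := Λ)).congr_left D.zeroZ.symm

lemma GI.directSum {J : Type} {Y : J → Type} [∀ j, AddCommGroup (Y j)] [∀ j, Module Λ (Y j)]
    (h : ∀ j, GI D (Y j)) : GI D (DirectSum J Y) := by
  refine fun n => ⟨.directSum_right (D.sesΩ n) fun j => (h j n).1, ?_⟩
  rcases n with _ | n
  · exact ext1_zeroZ
  · exact .directSum_right (D.sesZ n) fun j => (h j _).2

lemma GI.finsupp (h : GI D L) (J : Type) : GI D (J →₀ L) := by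
  classical
  exact (GI.directSum (J := J) fun _ => h).congr (finsuppLEquivDirectSum Λ L J).symm

/-- The cokernel of an embedding of a Gorenstein-injective module into an injective one. -/
lemma GI.coker {f : L →ₗ[Λ] I} {g : I →ₗ[Λ] C} (h : SES f g) [Module.Injective Λ I]
    (hL : GI D L) : GI D C := by
  refine fun n => ⟨.shift_right (D.sesΩ n) h .of_projective (hL _).1, ?_⟩
  rcases n with _ | n
  · exact ext1_zeroZ
  · exact .shift_right (D.sesZ n) h .of_projective (hL n).2

lemma GI.ker {f : K →ₗ[Λ] I} {g : I →ₗ[Λ] L} (h : SES f g) [Module.Injective Λ I]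
    (hL : GI D L) (hW : ∀ u : W k Λ →ₗ[Λ] L, ∃ v : W k Λ →ₗ[Λ] I, ∀ x, g (v x) = u x) :
    GI D K := by
  refine fun n => ⟨?_, .shift_left (D.sesZ n) h .of_injective .of_projective (hL _).2⟩
  rcases n with _ | n
  · exact (Ext1.of_coresolution h .of_injective hW).congr_left D.zeroΩ.symm
  · exact .shift_left (D.sesΩ n) h .of_injective .of_projective (hL n).1

lemma GI.ext1_injective [FiniteDimensional k Λ] (h : GI D L) [Module.Injective Λ I] :
    Ext1 Λ I L := by
  obtain ⟨J, f, hf⟩ := exists_finsupp_W_embedding k (Λ := Λ) I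
  exact (h.ext1_W.finsupp_left J).retract_left (retract_of_injective f hf)

/-- Every element of a Gorenstein-injective module lies in the trace of `W`. -/
lemma GI.exists_cover [FiniteDimensional k Λ] (h : GI D L) :
    ∃ (J K : Type) (_ : AddCommGroup K) (_ : Module Λ K) (f : K →ₗ[Λ] (J →₀ W k Λ))
      (g : (J →₀ W k Λ) →ₗ[Λ] L), SES f g ∧ GI D K := by
  let g : ((W k Λ →ₗ[Λ] L) →₀ W k Λ) →ₗ[Λ] L := Finsupp.lsum ℕ fun u => u
  have hg : Function.Surjective g := by
    intro x
    obtain ⟨v, hv⟩ := (h 1).2 (D.sesZ 0) (LinearMap.toSpanSingleton Λ L x ∘ₗ D.zeroZ.toLinearMap)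
    obtain ⟨n, f, hf⟩ := exists_fin_W_embedding k (Λ := Λ) (D.I 0)
    obtain ⟨i, p, hip⟩ := retract_of_injective f hf
    have key : ∀ y : Fin n → W k Λ, ∃ z, g z = v (p y) := by
      intro y
      refine ⟨∑ j, Finsupp.single (v ∘ₗ p ∘ₗ LinearMap.single Λ (fun _ => W k Λ) j) (y j), ?_⟩
      rw [map_sum]
      simp only [g, Finsupp.lsum_single, LinearMap.comp_apply, LinearMap.coe_single, ← map_sum,
        Finset.univ_sum_single]
    obtain ⟨z, hz⟩ := key (i (D.c 0 (D.zeroZ.symm 1)))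
    exact ⟨z, by rw [hz, hip, hv]; simp⟩
  obtain ⟨K, _, _, f, hf⟩ := exists_ses_of_surjective g hg
  refine ⟨_, K, _, _, f, g, hf, h.ker hf fun u => ⟨Finsupp.lsingle u, fun x => ?_⟩⟩
  simp [g]

lemma ses_of_exact {d : X →ₗ[Λ] Y} {d' : Y →ₗ[Λ] Z} (h : LinearMap.range d = LinearMap.ker d') :
    SES (LinearMap.ker d).subtype
      (d.codRestrict (LinearMap.ker d') fun x => h ▸ LinearMap.mem_range_self d x) := by
  refine ⟨Subtype.val_injective, ?_, ?_⟩
  · rintro ⟨y, hy⟩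
    rw [← h] at hy
    obtain ⟨x, rfl⟩ := hy
    exact ⟨x, rfl⟩
  · intro y
    constructor
    · intro hy
      exact ⟨⟨y, congrArg Subtype.val hy⟩, rfl⟩
    · rintro ⟨x, rfl⟩
      exact Subtype.ext x.2

/-- A class of modules closed under syzygies and cosyzygies, in the sense of complete injective
resolutions, consists of Gorenstein-injective modules. -/
lemma GI.of_chain {L I : ℤ → Type} [∀ i, AddCommGroup (L i)] [∀ i, Module Λ (L i)]
    [∀ i, AddCommGroup (I i)] [∀ i, Module Λ (I i)] [∀ i, Module.Injective Λ (I i)]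
    (f : ∀ i, L i →ₗ[Λ] I i) (g : ∀ i, I i →ₗ[Λ] L (i + 1)) (h : ∀ i, SES (f i) (g i))
    (hW : ∀ i, ∀ u : W k Λ →ₗ[Λ] L (i + 1), ∃ v : W k Λ →ₗ[Λ] I i, ∀ x, g i (v x) = u x) (i : ℤ) :
    GI D (L i) := by
  refine fun n => ⟨?_, ?_⟩
  · induction n generalizing i with
    | zero => exact (Ext1.of_coresolution (h i) .of_injective (hW i)).congr_left D.zeroΩ.symm
    | succ n ih => exact .shift_left (D.sesΩ n) (h i) .of_injective .of_projective (ih (i + 1))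
  · induction n generalizing i with
    | zero => exact ext1_zeroZ
    | succ n ih =>
      obtain ⟨j, rfl⟩ : ∃ j, i = j + 1 := ⟨i - 1, by ring⟩
      exact .shift_right (D.sesZ n) (h j) .of_projective (ih j)

/-- Gorenstein-injective modules have complete injective resolutions. -/
lemma GI.exists_chain [FiniteDimensional k Λ] {L : Type} [AddCommGroup L] [Module Λ L]
    (hL : GI D L) :
    ∃ (N : ℤ → ModuleCat.{0} Λ) (J : ℤ → Type) (f : ∀ i, N i →ₗ[Λ] (J i →₀ W k Λ))
      (g : ∀ i, (J i →₀ W k Λ) →ₗ[Λ] N (i + 1)),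
      (∀ i, SES (f i) (g i)) ∧ (∀ i, GI D (N i)) ∧ Nonempty (N 0 ≃ₗ[Λ] L) := by
  let s : {N : ModuleCat.{0} Λ // GI D N} → {N : ModuleCat.{0} Λ // GI D N} → Prop :=
    fun N N' => ∃ (J : Type) (f : N.1 →ₗ[Λ] (J →₀ W k Λ)) (g : (J →₀ W k Λ) →ₗ[Λ] N'.1), SES f g
  obtain ⟨c, h0, hc⟩ := exists_int_chain s
    (by
      rintro ⟨N, hN⟩
      obtain ⟨J, C, _, _, f, g, h⟩ := exists_finsupp_W_ses k (Λ := Λ) N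
      exact ⟨⟨ModuleCat.of Λ C, hN.coker h⟩, J, f, g, h⟩)
    (by
      rintro ⟨N, hN⟩
      obtain ⟨J, K, _, _, f, g, h, hK⟩ := hN.exists_cover
      exact ⟨⟨ModuleCat.of Λ K, hK⟩, J, f, g, h⟩)
    ⟨ModuleCat.of Λ L, hL⟩
  choose J f g h using hc
  exact ⟨fun i => (c i).1, J, f, g, h, fun i => (c i).2, ⟨by beta_reduce; rw [h0]⟩⟩

end GI


/-! ## Special preenvelopes -/

section Sequences

variable {R : Type} [Ring R]

/-- The union of a chain of monomorphisms. -/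
lemma exists_sequential_union {X : ℕ → Type} [∀ n, AddCommGroup (X n)] [∀ n, Module R (X n)]
    (t : ∀ n, X n →ₗ[R] X (n + 1)) (ht : ∀ n, Function.Injective (t n)) :
    ∃ (E : Type) (_ : AddCommGroup E) (_ : Module R E) (ι : ∀ n, X n →ₗ[R] E),
      (∀ n x, ι (n + 1) (t n x) = ι n x) ∧ (∀ n, Function.Injective (ι n)) ∧
      (∀ e, ∃ n x, ι n x = e) ∧
      ∀ (Q : Type) [AddCommGroup Q] [Module R Q] (v : ∀ n, X n →ₗ[R] Q),
        (∀ n x, v (n + 1) (t n x) = v n x) → ∃ w : E →ₗ[R] Q, ∀ n x, w (ι n x) = v n x := by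
  let T : ∀ i j, i ≤ j → X i →ₗ[R] X j := fun i j h =>
    Nat.leRecOn (C := fun j => X i →ₗ[R] X j) h (fun {n} g => t n ∘ₗ g) LinearMap.id
  have hT0 : ∀ i x, T i i le_rfl x = x := fun i x => by simp [T, Nat.leRecOn_self]
  have hTs : ∀ i j (h : i ≤ j) x, T i (j + 1) (h.trans j.le_succ) x = t j (T i j h x) := by
    intro i j h x
    simp only [T]
    rw [Nat.leRecOn_succ h]
    rfl
  have hTT : ∀ i j l (h : i ≤ j) (h' : j ≤ l) x, T j l h' (T i j h x) = T i l (h.trans h') x := by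
    intro i j l h h' x
    induction l, h' using Nat.le_induction with
    | base => rw [hT0]
    | succ l h' ih => rw [hTs j l h', hTs i l (h.trans h'), ih]
  have hTi : ∀ i j h, Function.Injective (T i j h) := by
    intro i j h
    induction j, h using Nat.le_induction with
    | base => intro x y hxy; simpa [hT0] using hxy
    | succ l h' ih =>
      intro x y hxy
      rw [hTs i l h', hTs i l h'] at hxy
      exact ih (ht _ hxy)
  have : DirectedSystem X fun i j h => T i j h :=
    ⟨fun i x => hT0 i x, fun _ _ _ h h' x => hTT _ _ _ h h' x⟩
  refine ⟨Module.DirectLimit X T, inferInstance, inferInstance,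
    fun n => Module.DirectLimit.of R ℕ X T n, fun n x => ?_, fun n => ?_, fun e => ?_, ?_⟩
  · have := Module.DirectLimit.of_f (R := R) (G := X) (f := T) (hij := n.le_succ) (x := x)
    rw [← this, hTs n n le_rfl, hT0]
  · rw [← LinearMap.ker_eq_bot, LinearMap.ker_eq_bot']
    intro x hx
    obtain ⟨j, hj, hx⟩ := Module.DirectLimit.of.zero_exact hx
    exact hTi _ _ hj (by rw [hx, map_zero])
  · exact Module.DirectLimit.exists_of e
  · intro Q _ _ v hv
    refine ⟨Module.DirectLimit.lift R ℕ X T v fun i j h x => ?_, fun n x => by simp⟩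
    induction j, h using Nat.le_induction with
    | base => rw [hT0]
    | succ l h' ih => rw [hTs i l h', hv, ih]

/-- One step of the small object argument. -/
lemma exists_step {ι : Type} {K P C : ι → Type} [∀ j, AddCommGroup (K j)] [∀ j, Module R (K j)]
    [∀ j, AddCommGroup (P j)] [∀ j, Module R (P j)]
    [∀ j, AddCommGroup (C j)] [∀ j, Module R (C j)]
    (a : ∀ j, K j →ₗ[R] P j) (b : ∀ j, P j →ₗ[R] C j) (h : ∀ j, SES (a j) (b j))
    (X : Type) [AddCommGroup X] [Module R X] :
    ∃ (X' Q : Type) (_ : AddCommGroup X') (_ : Module R X') (_ : AddCommGroup Q) (_ : Module R Q)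
      (t : X →ₗ[R] X') (q : X' →ₗ[R] Q), SES t q ∧
      (∀ j (u : K j →ₗ[R] X), ∃ v : P j →ₗ[R] X', ∀ x, v (a j x) = t (u x)) ∧
      ∀ (L : Type) [AddCommGroup L] [Module R L], (∀ j, Ext1 R (C j) L) → Ext1 R Q L := by
  classical
  let σ := Σ j, K j →ₗ[R] X
  let aa : DirectSum σ (fun s => K s.1) →ₗ[R] DirectSum σ (fun s => P s.1) :=
    DirectSum.lmap fun s => a s.1
  let uu : DirectSum σ (fun s => K s.1) →ₗ[R] X := DirectSum.toModule R σ X fun s => s.2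
  let N : Submodule R (X × DirectSum σ (fun s => P s.1)) := LinearMap.range (uu.prod (-aa))
  have haa : Function.Injective aa := (DirectSum.lmap_injective _).2 fun s => (h s.1).inj
  let t : X →ₗ[R] (X × DirectSum σ (fun s => P s.1)) ⧸ N := N.mkQ ∘ₗ LinearMap.inl R _ _
  have ht : Function.Injective t := by
    rw [← LinearMap.ker_eq_bot, LinearMap.ker_eq_bot']
    intro x hx
    have hx' : ((x, 0) : X × DirectSum σ (fun s => P s.1)) ∈ N := by
      simpa [t] using hx
    obtain ⟨z, hz⟩ := hx'
    have h2 : aa z = 0 := by simpa using congrArg Prod.snd hz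
    have h1 : uu z = x := congrArg Prod.fst hz
    rw [← h1, haa (h2.trans (map_zero aa).symm), map_zero]
  obtain ⟨Q, _, _, q, hq⟩ := exists_ses_of_injective t ht
  have hrel : ∀ z, N.mkQ (0, aa z) = t (uu z) := by
    intro z
    refine ((Submodule.Quotient.eq N).2 ⟨-z, ?_⟩)
    ext <;> simp
  refine ⟨_, Q, _, _, _, _, t, q, hq, fun j u => ?_, fun L _ _ hL => ?_⟩
  · let s : σ := ⟨j, u⟩
    refine ⟨N.mkQ ∘ₗ LinearMap.inr R _ _ ∘ₗ DirectSum.lof R σ (fun s => P s.1) s, fun x => ?_⟩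
    have := hrel (DirectSum.lof R σ (fun s => K s.1) s x)
    simp only [aa, uu, DirectSum.toModule_lof, DirectSum.lmap_lof] at this
    exact this
  · obtain ⟨I, C', _, _, _, _, i, p, _, hs⟩ := exists_injective_ses R L
    refine Ext1.of_coresolution hs Ext1.of_injective fun w => ?_
    let qq : DirectSum σ (fun s => P s.1) →ₗ[R] Q := q ∘ₗ N.mkQ ∘ₗ LinearMap.inr R _ _
    have hqq : ∀ z, qq (aa z) = 0 := fun z => by
      change q (N.mkQ (0, aa z)) = 0
      rw [hrel, hq.apply_apply]
    have hses : SES aa qq := by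
      refine ⟨haa, ?_, fun y => ⟨fun hy => ?_, ?_⟩⟩
      · intro y
        obtain ⟨y, rfl⟩ := hq.surj y
        obtain ⟨⟨x, z⟩, rfl⟩ := N.mkQ_surjective y
        refine ⟨z, ?_⟩
        have : N.mkQ (x, z) = t x + N.mkQ (0, z) := by
          rw [LinearMap.comp_apply, ← map_add]; simp
        rw [this, map_add, hq.apply_apply, zero_add]
        rfl
      · obtain ⟨x, hx⟩ := (hq.exact _).1 hy
        obtain ⟨z, hz⟩ := (Submodule.Quotient.eq N).1 hx
        refine ⟨z, ?_⟩
        have := congrArg Prod.snd hz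
        simpa using this
      · rintro ⟨z, rfl⟩
        exact hqq z
    have hc : ∀ s : σ, ∃ v : P s.1 →ₗ[R] I,
        (∀ x, p (v x) = w (qq (DirectSum.lof R σ (fun s => P s.1) s x))) ∧
          ∀ x, v (a s.1 x) = 0 := by
      intro s
      obtain ⟨v, hv⟩ := (h s.1).desc (w ∘ₗ qq ∘ₗ DirectSum.lof R σ (fun s => P s.1) s) (fun x => by
        have := hqq (DirectSum.lof R σ (fun s => K s.1) s x)
        simp only [aa, DirectSum.lmap_lof] at this
        rw [LinearMap.comp_apply, LinearMap.comp_apply, this, map_zero])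
      obtain ⟨v', hv'⟩ := (hL s.1).lift hs v
      exact ⟨v' ∘ₗ b s.1, fun x => by simp [hv', hv], fun x => by simp [(h s.1).apply_apply]⟩
    choose v hv hv' using hc
    obtain ⟨z, hz⟩ := hses.desc (DirectSum.toModule R σ I v) (fun x => by
      rw [← LinearMap.comp_apply]
      have : DirectSum.toModule R σ I v ∘ₗ aa = 0 := by
        refine DirectSum.linearMap_ext R fun s => LinearMap.ext fun x => ?_
        simp [aa, hv', DirectSum.lmap_lof]
      rw [this, LinearMap.zero_apply])
    refine ⟨z, fun x => ?_⟩
    obtain ⟨y, rfl⟩ := hses.surj x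
    rw [hz]
    have : p ∘ₗ DirectSum.toModule R σ I v = w ∘ₗ qq := by
      refine DirectSum.linearMap_ext R fun s => LinearMap.ext fun x => ?_
      simp [hv]
    exact LinearMap.congr_fun this y

/-- The small object argument for finitely generated test modules. -/
lemma exists_preenvelope {ι : Type} {K P C : ι → Type}
    [∀ j, AddCommGroup (K j)] [∀ j, Module R (K j)]
    [∀ j, AddCommGroup (P j)] [∀ j, Module R (P j)]
    [∀ j, AddCommGroup (C j)] [∀ j, Module R (C j)] [∀ j, Module.Finite R (K j)]
    [∀ j, Module.Projective R (P j)]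
    (a : ∀ j, K j →ₗ[R] P j) (b : ∀ j, P j →ₗ[R] C j) (h : ∀ j, SES (a j) (b j))
    (N : Type) [AddCommGroup N] [Module R N] :
    ∃ (E U : Type) (_ : AddCommGroup E) (_ : Module R E) (_ : AddCommGroup U) (_ : Module R U)
      (f : N →ₗ[R] E) (g : E →ₗ[R] U), SES f g ∧ (∀ j, Ext1 R (C j) E) ∧
      ∀ (L : Type) [AddCommGroup L] [Module R L], (∀ j, Ext1 R (C j) L) → Ext1 R U L := by
  choose S Q _ _ _ _ t q hq hext hQ using fun X : ModuleCat.{0} R => exists_step a b h X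
  let X : ℕ → ModuleCat.{0} R := fun n => (fun Y => ModuleCat.of R (S Y))^[n] (ModuleCat.of R N)
  have hX : ∀ n, X (n + 1) = ModuleCat.of R (S (X n)) := fun n =>
    Function.iterate_succ_apply' _ _ _
  have key : ∀ n, ∃ (Q : Type) (_ : AddCommGroup Q) (_ : Module R Q) (t : X n →ₗ[R] X (n + 1))
      (q : X (n + 1) →ₗ[R] Q), SES t q ∧
      (∀ j (u : K j →ₗ[R] X n), ∃ v : P j →ₗ[R] X (n + 1), ∀ x, v (a j x) = t (u x)) ∧
      ∀ (L : Type) [AddCommGroup L] [Module R L], (∀ j, Ext1 R (C j) L) → Ext1 R Q L := by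
    intro n
    rw [hX]
    exact ⟨Q (X n), inferInstance, inferInstance, t (X n), q (X n), hq _, hext _, hQ _⟩
  clear hQ hext hq q t
  choose Q' _ _ t q hq hext hQ using key
  obtain ⟨E, _, _, ι', h1, h2, h3, h4⟩ := exists_sequential_union t fun n => (hq n).inj
  obtain ⟨U, _, _, g, hg⟩ := exists_ses_of_injective (ι' 0) (h2 0)
  have hmono : ∀ m n, m ≤ n → LinearMap.range (ι' m) ≤ LinearMap.range (ι' n) := by
    intro m n hmn
    induction n, hmn using Nat.le_induction with
    | base => exact le_rfl
    | succ n _ ih =>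
      refine ih.trans ?_
      rintro _ ⟨x, rfl⟩
      exact ⟨t n x, h1 n x⟩
  refine ⟨E, U, _, _, _, _, ι' 0, g, hg, fun j => ?_, fun L _ _ hL => ?_⟩
  · refine Ext1.of_resolution (h j) .of_projective fun u => ?_
    have hfin : ∃ n, ∀ x, u x ∈ LinearMap.range (ι' n) := by
      obtain ⟨s, hs⟩ := (Module.Finite.fg_top : (⊤ : Submodule R (K j)).FG)
      choose m x hm using fun y => h3 (u y)
      refine ⟨s.sup m, fun y => ?_⟩
      have hy : y ∈ Submodule.span R (s : Set (K j)) := hs ▸ Submodule.mem_top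
      have : Submodule.span R (s : Set (K j)) ≤ (LinearMap.range (ι' (s.sup m))).comap u := by
        rw [Submodule.span_le]
        intro z hz
        exact hmono _ _ (Finset.le_sup (f := m) hz) ⟨x z, hm z⟩
      exact this hy
    obtain ⟨n, hn⟩ := hfin
    obtain ⟨C', _, _, g', hg'⟩ := exists_ses_of_injective (ι' n) (h2 n)
    obtain ⟨u', hu'⟩ := hg'.lift u fun x => (hg'.exact _).2 (hn x)
    obtain ⟨v, hv⟩ := hext n j u'
    exact ⟨ι' (n + 1) ∘ₗ v, fun x => by simp [hv, h1, hu']⟩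
  · obtain ⟨I, C', _, _, _, _, i, p, _, hs⟩ := exists_injective_ses R L
    refine Ext1.of_coresolution hs Ext1.of_injective fun u => ?_
    let good : ∀ n, (X n →ₗ[R] I) → Prop := fun n v => ∀ x, p (v x) = u (g (ι' n x))
    have ext_good : ∀ n (v : {v // good n v}), ∃ w : {w // good (n + 1) w},
        ∀ x, w.1 (t n x) = v.1 x := by
      rintro n ⟨v, hv⟩
      obtain ⟨w, hw⟩ := Module.Injective.out (t n) (hq n).inj v
      obtain ⟨z, hz⟩ := (hq n).desc (u ∘ₗ g ∘ₗ ι' (n + 1) - p ∘ₗ w)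
        (fun x => by simp [hw, hv x, h1])
      obtain ⟨z', hz'⟩ := (hQ n L hL).lift hs z
      exact ⟨⟨w + z' ∘ₗ q n, fun x => by simp [hz', hz]⟩,
        fun x => by simp [hw, (hq n).apply_apply]⟩
    choose nx hnx using ext_good
    let v : ∀ n, {v // good n v} := fun n =>
      Nat.rec ⟨0, fun x => by simp [hg.apply_apply]⟩ nx n
    obtain ⟨w, hw⟩ := h4 I (fun n => (v n).1) (fun n x => hnx n (v n) x)
    obtain ⟨w', hw'⟩ := hg.desc w (fun x => by rw [hw]; rfl)
    refine ⟨w', fun x => ?_⟩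
    obtain ⟨e, rfl⟩ := hg.surj x
    obtain ⟨n, y, rfl⟩ := h3 e
    rw [hw', hw]
    exact (v n).2 y

end Sequences

section Approximation

variable {k Λ : Type} [Field k] [Ring Λ] [Algebra k Λ] (D : DomData k Λ)

/-- The left orthogonal class of the Gorenstein-injective modules. -/
def PerpGI (U : Type) [AddCommGroup U] [Module Λ U] : Prop :=
  ∀ (L : Type) [AddCommGroup L] [Module Λ L], GI D L → Ext1 Λ U L

/-- Every module embeds into a Gorenstein-injective module with cokernel in the left orthogonal
class. -/
lemma exists_GI_preenvelope (N : Type) [AddCommGroup N] [Module Λ N] :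
    ∃ (E U : Type) (_ : AddCommGroup E) (_ : Module Λ E) (_ : AddCommGroup U) (_ : Module Λ U)
      (f : N →ₗ[Λ] E) (g : E →ₗ[Λ] U), SES f g ∧ GI D E ∧ PerpGI D U := by
  let K : ℕ ⊕ ℕ → ModuleCat.{0} Λ := Sum.elim (fun n => D.Ω (n + 1)) D.Z
  let P : ℕ ⊕ ℕ → ModuleCat.{0} Λ := Sum.elim D.P D.I
  let C : ℕ ⊕ ℕ → ModuleCat.{0} Λ := Sum.elim D.Ω (fun n => D.Z (n + 1))
  let a : ∀ j, K j →ₗ[Λ] P j := fun j => match j with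
    | .inl n => D.a n
    | .inr n => D.c n
  let b : ∀ j, P j →ₗ[Λ] C j := fun j => match j with
    | .inl n => D.b n
    | .inr n => D.d n
  have hs : ∀ j, SES (a j) (b j) := fun j => match j with
    | .inl n => D.sesΩ n
    | .inr n => D.sesZ n
  have hK : ∀ j, Module.Finite Λ (K j) := fun j => match j with
    | .inl n => D.finΩ (n + 1)
    | .inr n => D.finZ n
  have hP : ∀ j, Module.Projective Λ (P j) := fun j => match j with
    | .inl n => D.projP n
    | .inr n => D.projI n
  obtain ⟨E, U, _, _, _, _, f, g, h, hE, hU⟩ := exists_preenvelope a b hs N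
  refine ⟨E, U, _, _, _, _, f, g, h, fun n => ⟨hE (.inl n), ?_⟩, fun L _ _ hL => hU L fun j => ?_⟩
  · rcases n with _ | n
    · exact ext1_zeroZ
    · exact hE (.inr n)
  · rcases j with n | n
    · exact (hL n).1
    · exact (hL (n + 1)).2

end Approximation


/-! ## Strong generation of the Gorenstein-injective modules -/

section StrongGeneration

/-- A class of modules closed under extensions and direct summands. -/
structure ExtClosed (Λ : Type) [Ring Λ]
    (C : ∀ (L : Type) [AddCommGroup L] [Module Λ L], Prop) : Prop where
  retract : ∀ (X Y : Type) [AddCommGroup X] [Module Λ X] [AddCommGroup Y] [Module Λ Y],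
    Retract Λ X Y → C Y → C X
  ext : ∀ (X Y Z : Type) [AddCommGroup X] [Module Λ X] [AddCommGroup Y] [Module Λ Y]
    [AddCommGroup Z] [Module Λ Z] (f : X →ₗ[Λ] Y) (g : Y →ₗ[Λ] Z), SES f g → C X → C Z → C Y

variable {k Λ : Type} [Field k] [Ring Λ] [Algebra k Λ] (D : DomData k Λ)

/-- `V` embeds into a Gorenstein-injective module of the class `C` with cokernel in the left
orthogonal class of the Gorenstein-injective modules. -/
def HasEnvelopeIn (C : ∀ (L : Type) [AddCommGroup L] [Module Λ L], Prop)
    (V : Type) [AddCommGroup V] [Module Λ V] : Prop :=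
  ∃ (L U : Type) (_ : AddCommGroup L) (_ : Module Λ L) (_ : AddCommGroup U) (_ : Module Λ U)
    (f : V →ₗ[Λ] L) (g : L →ₗ[Λ] U), SES f g ∧ C L ∧ GI D L ∧ PerpGI D U

variable {D}

lemma SES.finsupp {R : Type} [Ring R] {X Y Z : Type} [AddCommGroup X] [Module R X]
    [AddCommGroup Y] [Module R Y] [AddCommGroup Z] [Module R Z] {f : X →ₗ[R] Y} {g : Y →ₗ[R] Z}
    (h : SES f g) (J : Type) :
    SES (Finsupp.mapRange.linearMap f : (J →₀ X) →ₗ[R] J →₀ Y)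
      (Finsupp.mapRange.linearMap g) := by
  refine ⟨Finsupp.mapRange_injective _ (map_zero f) h.inj,
    Finsupp.mapRange_surjective _ (map_zero g) h.surj, fun y => ⟨fun hy => ?_, ?_⟩⟩
  · have : ∀ j, ∃ x, f x = y j := fun j => (h.exact _).1 (by simpa using DFunLike.congr_fun hy j)
    choose x hx using this
    refine ⟨Finsupp.onFinset y.support x fun j hj => ?_, ?_⟩
    · rw [Finsupp.mem_support_iff]
      rintro h0
      exact hj (h.inj ((hx j).trans (h0.trans (map_zero f).symm)))
    · ext j
      simp [hx]
  · rintro ⟨x, rfl⟩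
    ext j
    simp [h.apply_apply]

lemma SES.prodMap {R : Type} [Ring R] {X Y Z X' Y' Z' : Type} [AddCommGroup X] [Module R X]
    [AddCommGroup Y] [Module R Y] [AddCommGroup Z] [Module R Z] [AddCommGroup X'] [Module R X']
    [AddCommGroup Y'] [Module R Y'] [AddCommGroup Z'] [Module R Z']
    {f : X →ₗ[R] Y} {g : Y →ₗ[R] Z} {f' : X' →ₗ[R] Y'} {g' : Y' →ₗ[R] Z'}
    (h : SES f g) (h' : SES f' g') : SES (f.prodMap f') (g.prodMap g') := by
  refine ⟨?_, ?_, fun y => ⟨fun hy => ?_, ?_⟩⟩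
  · exact Function.Injective.prodMap h.inj h'.inj
  · exact Function.Surjective.prodMap h.surj h'.surj
  · obtain ⟨x, hx⟩ := (h.exact _).1 (congrArg Prod.fst hy)
    obtain ⟨x', hx'⟩ := (h'.exact _).1 (congrArg Prod.snd hy)
    exact ⟨(x, x'), Prod.ext hx hx'⟩
  · rintro ⟨x, rfl⟩
    simp [h.apply_apply, h'.apply_apply]

lemma HasEnvelopeIn.congr {C : ∀ (L : Type) [AddCommGroup L] [Module Λ L], Prop}
    {V V' : Type} [AddCommGroup V] [Module Λ V] [AddCommGroup V'] [Module Λ V']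
    (h : HasEnvelopeIn D C V) (e : V' ≃ₗ[Λ] V) : HasEnvelopeIn D C V' := by
  obtain ⟨L, U, _, _, _, _, f, g, hs, h⟩ := h
  exact ⟨L, U, _, _, _, _, _, g, hs.congr_left e, h⟩

lemma HasEnvelopeIn.ext {C : ∀ (L : Type) [AddCommGroup L] [Module Λ L], Prop}
    (hC : ExtClosed Λ C)
    {V' V V'' : Type} [AddCommGroup V'] [Module Λ V'] [AddCommGroup V] [Module Λ V]
    [AddCommGroup V''] [Module Λ V''] {f : V' →ₗ[Λ] V} {g : V →ₗ[Λ] V''} (hs : SES f g)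
    (h1 : HasEnvelopeIn D C V') (h2 : HasEnvelopeIn D C V'') : HasEnvelopeIn D C V := by
  obtain ⟨L', U', _, _, _, _, i', c', hs', hCL', hL', hU'⟩ := h1
  obtain ⟨L'', U'', _, _, _, _, i'', c'', hs'', hCL'', hL'', hU''⟩ := h2
  obtain ⟨I, K, _, _, _, _, a, b, _, hab⟩ := exists_injective_ses Λ L'
  have hK := hL'.coker hab
  obtain ⟨v, hv⟩ := Module.Injective.out f hs.inj (a ∘ₗ i')
  obtain ⟨w, hw⟩ := hs.desc (b ∘ₗ v) (fun x => by simp [hv, hab.apply_apply])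
  obtain ⟨h, hh⟩ := (hU'' K hK) hs'' w
  obtain ⟨j, hj, hp⟩ := hab.pullback h
  set q : Pull b h →ₗ[Λ] L'' := LinearMap.snd Λ I L'' ∘ₗ (Pull b h).subtype with hqdef
  have hq : ∀ x, q x = x.1.2 := fun x => rfl
  let φ : V →ₗ[Λ] Pull b h := LinearMap.codRestrict _ (v.prod (i'' ∘ₗ g)) fun x =>
    mem_pull.2 (by simp [hh, hw])
  have hφ : ∀ x, (φ x).1 = (v x, i'' (g x)) := fun x => rfl
  have hφf : ∀ x, φ (f x) = j (i' x) := fun x => by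
    refine Subtype.ext ?_
    rw [hφ, hj, hv, hs.apply_apply, map_zero]
    rfl
  have hφi : Function.Injective φ := by
    rw [← LinearMap.ker_eq_bot, LinearMap.ker_eq_bot']
    intro x hx
    have h2 : i'' (g x) = 0 := congrArg (fun t => t.1.2) hx
    obtain ⟨y, rfl⟩ := (hs.exact _).1 (hs''.inj (h2.trans (map_zero i'').symm))
    have h1 : v (f y) = 0 := congrArg (fun t => t.1.1) hx
    rw [hv] at h1
    have h3 : y = 0 := hs'.inj (hab.inj (by simpa using h1))
    rw [h3, map_zero]
  obtain ⟨U, _, _, c, hc⟩ := exists_ses_of_injective φ hφi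
  refine ⟨Pull b h, U, _, _, _, _, φ, c, hc, hC.ext _ _ _ _ _ hp hCL' hCL'', hL'.ext hp hL'', ?_⟩
  obtain ⟨α, hα⟩ := hs'.desc (c ∘ₗ j) (fun x => by
    rw [LinearMap.comp_apply, ← hφf, hc.apply_apply])
  obtain ⟨β, hβ⟩ := hc.desc (c'' ∘ₗ q) (fun x => by
    rw [LinearMap.comp_apply, hq, hφ, hs''.apply_apply])
  have hab' : SES α β := by
    refine ⟨?_, ?_, fun u => ⟨fun hu => ?_, ?_⟩⟩
    · rw [← LinearMap.ker_eq_bot, LinearMap.ker_eq_bot']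
      intro x hx
      obtain ⟨l, rfl⟩ := hs'.surj x
      rw [hα] at hx
      obtain ⟨y, hy⟩ := (hc.exact _).1 hx
      have h2 : i'' (g y) = 0 := by
        have := congrArg (fun t => t.1.2) hy
        simpa [hφ, hj] using this
      obtain ⟨z, rfl⟩ := (hs.exact _).1 (hs''.inj (h2.trans (map_zero i'').symm))
      rw [hφf] at hy
      rw [← hp.inj hy, hs'.apply_apply]
    · intro x
      obtain ⟨l, rfl⟩ := hs''.surj x
      obtain ⟨y, rfl⟩ := hp.surj l
      exact ⟨c y, hβ y⟩
    · obtain ⟨y, rfl⟩ := hc.surj u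
      rw [hβ] at hu
      obtain ⟨z, hz⟩ := (hs''.exact _).1 hu
      obtain ⟨z, rfl⟩ := hs.surj z
      obtain ⟨l, hl⟩ := (hp.exact (y - φ z)).1 (by
        rw [map_sub, sub_eq_zero, ← hz]; rfl)
      refine ⟨c' l, ?_⟩
      rw [hα, LinearMap.comp_apply, hl, map_sub, hc.apply_apply, sub_zero]
    · rintro ⟨x, rfl⟩
      obtain ⟨l, rfl⟩ := hs'.surj x
      rw [hα, LinearMap.comp_apply, hβ, LinearMap.comp_apply, hp.apply_apply, map_zero]
  exact fun T _ _ hT => Ext1.ext_left hab' (hU' T hT) (hU'' T hT)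

/-- A module annihilated by the Jacobson radical is a summand of a sum of copies of `Λ / J`. -/
lemma retract_finsupp_quotient_jacobson {Λ : Type} [Ring Λ] [IsSemiprimaryRing Λ]
    (V : Type) [AddCommGroup V] [Module Λ V]
    (h : Module.IsTorsionBySet Λ V (Ring.jacobson Λ)) :
    ∃ J : Type, Retract Λ V (J →₀ (Λ ⧸ Ring.jacobson Λ)) := by
  have hss : IsSemisimpleModule Λ (Λ ⧸ Ring.jacobson Λ) := by
    have hT : Module.IsTorsionBySet Λ (Λ ⧸ Ring.jacobson Λ) (Ring.jacobson Λ : Set Λ) := by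
      rw [Module.isTorsionBySet_quotient_iff]
      intro x r hr
      exact Ideal.mul_mem_right _ _ hr
    let _ := hT.module
    exact (hT.semilinearMap.isSemisimpleModule_iff_of_bijective Function.bijective_id).2
      inferInstance
  let u : V → (Λ ⧸ Ring.jacobson Λ) →ₗ[Λ] V := fun v =>
    (Ring.jacobson Λ).liftQ (LinearMap.toSpanSingleton Λ V v) fun r hr => by
      simpa using h (x := v) (a := ⟨r, hr⟩)
  have hu : ∀ v, u v ((Ring.jacobson Λ).mkQ 1) = v := fun v => by
    simp only [u, Submodule.mkQ_apply, Submodule.liftQ_apply, LinearMap.toSpanSingleton_apply,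
      one_smul]
  let p : (V →₀ (Λ ⧸ Ring.jacobson Λ)) →ₗ[Λ] V := Finsupp.lsum ℕ u
  have hp : Function.Surjective p := fun v =>
    ⟨Finsupp.single v ((Ring.jacobson Λ).mkQ 1), by
      simp only [p, Finsupp.lsum_single, hu]⟩
  obtain ⟨i, hi⟩ := IsSemisimpleModule.lifting_property p hp LinearMap.id
  exact ⟨V, i, p, fun x => LinearMap.congr_fun hi x⟩

/-- Strong generation: a class closed under extensions and summands that contains all direct sums
of copies of the approximation of `Λ / J` contains all Gorenstein-injective modules. -/
lemma strong_generation [FiniteDimensional k Λ]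
    {E U : Type} [AddCommGroup E] [Module Λ E] [AddCommGroup U] [Module Λ U]
    {f : (Λ ⧸ Ring.jacobson Λ) →ₗ[Λ] E} {g : E →ₗ[Λ] U} (hs : SES f g) (hE : GI D E)
    (hU : PerpGI D U)
    {C : ∀ (L : Type) [AddCommGroup L] [Module Λ L], Prop} (hC : ExtClosed Λ C)
    (hCE : ∀ J : Type, C (J →₀ E)) (L : Type) [AddCommGroup L] [Module Λ L] (hL : GI D L) :
    C L := by
  have : IsArtinianRing Λ := IsArtinianRing.of_finite k Λ
  have key : ∀ (V : Type) [AddCommGroup V] [Module Λ V],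
      ∃ (V' : Type) (_ : AddCommGroup V') (_ : Module Λ V'), HasEnvelopeIn D C (V × V') := by
    intro V _ _
    refine IsSemiprimaryRing.induction Λ Λ V
      (P := fun V _ _ _ => ∃ (V' : Type) (_ : AddCommGroup V') (_ : Module Λ V'),
        HasEnvelopeIn D C (V × V')) ?_ ?_
    · intro V _ _ _ _ _ hV
      obtain ⟨J, hr⟩ := retract_finsupp_quotient_jacobson V hV
      obtain ⟨V', _, _, ⟨e⟩⟩ := hr.exists_equiv
      refine ⟨V', _, _, HasEnvelopeIn.congr (V := J →₀ Λ ⧸ Ring.jacobson Λ) ?_ e⟩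
      exact ⟨_, _, _, _, _, _, _, _, hs.finsupp J, hCE J, hE.finsupp J,
        fun T _ _ hT => (hU T hT).finsupp_left J⟩
    · intro V _ _ _ _ N
      rintro ⟨N', _, _, h1⟩ ⟨Q', _, _, h2⟩
      refine ⟨N' × Q', _, _, HasEnvelopeIn.ext hC
        (f := LinearMap.prodMap N.subtype (LinearMap.inl Λ N' Q'))
        (g := LinearMap.prodMap N.mkQ (LinearMap.snd Λ N' Q')) ?_ h1 h2⟩
      exact (ses_mkQ N).prodMap ses_prod
  obtain ⟨V', _, _, L', U', _, _, _, _, i, p, hs', hCL, hL', hU'⟩ := key L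
  obtain ⟨r, hr⟩ := (hU' L hL) hs' (LinearMap.fst Λ L V')
  exact hC.retract _ _ ⟨i ∘ₗ LinearMap.inl Λ L V', r, fun x => by simp [hr]⟩ hCL

variable (D) in
/-- The Gorenstein-injective modules are generated, under extensions and summands, by the sums of
copies of a finitely generated one together with the sums of copies of `W`. -/
def FGGen : Prop :=
  ∃ (L₀ : Type) (_ : AddCommGroup L₀) (_ : Module Λ L₀), Module.Finite Λ L₀ ∧ GI D L₀ ∧
    ∀ C : ∀ (L : Type) [AddCommGroup L] [Module Λ L], Prop, ExtClosed Λ C →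
      (∀ J : Type, C (J →₀ L₀)) → (∀ J : Type, C (J →₀ W k Λ)) →
      ∀ (L : Type) [AddCommGroup L] [Module Λ L], GI D L → C L

lemma ExtClosed.prod {C : ∀ (L : Type) [AddCommGroup L] [Module Λ L], Prop}
    (hC : ExtClosed Λ C) {X Y : Type} [AddCommGroup X] [Module Λ X] [AddCommGroup Y] [Module Λ Y]
    (hX : C X) (hY : C Y) : C (X × Y) := hC.ext _ _ _ _ _ ses_prod hX hY

/-- It suffices that the approximation of `Λ / J` is a summand of a finitely generated
Gorenstein-injective module plus an injective one. -/
lemma FGGen.of_retract [FiniteDimensional k Λ]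
    {E U : Type} [AddCommGroup E] [Module Λ E] [AddCommGroup U] [Module Λ U]
    {f : (Λ ⧸ Ring.jacobson Λ) →ₗ[Λ] E} {g : E →ₗ[Λ] U} (hs : SES f g) (hE : GI D E)
    (hU : PerpGI D U) {L₀ J₀ : Type} [AddCommGroup L₀] [Module Λ L₀] [Module.Finite Λ L₀]
    (hL₀ : GI D L₀) (hr : Retract Λ E (L₀ × (J₀ →₀ W k Λ))) : FGGen D := by
  refine ⟨L₀, _, _, inferInstance, hL₀, fun C hC h1 h2 L _ _ hL => ?_⟩
  refine strong_generation hs hE hU hC (fun J => ?_) L hL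
  refine hC.retract _ _ (hr.finsupp J) ?_
  refine hC.retract _ ((J →₀ L₀) × (J × J₀ →₀ W k Λ)) ?_ (hC.prod (h1 J) (h2 _))
  refine Retract.trans (Y := (J →₀ L₀) × (J →₀ (J₀ →₀ W k Λ))) ?_
    (.prod .refl (.of_equiv (Finsupp.curryLinearEquiv Λ).symm))
  refine ⟨(Finsupp.mapRange.linearMap (LinearMap.fst Λ _ _)).prod
    (Finsupp.mapRange.linearMap (LinearMap.snd Λ _ _)),
    (Finsupp.mapRange.linearMap (LinearMap.inl Λ _ _)).coprod
    (Finsupp.mapRange.linearMap (LinearMap.inr Λ _ _)), fun x => ?_⟩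
  ext j <;> simp

end StrongGeneration


/-! ## Products in the left orthogonal class force finite generation -/

section Socle

variable (Λ : Type) [Ring Λ]

/-- The submodule annihilated by the Jacobson radical. -/
def soc (X : Type) [AddCommGroup X] [Module Λ X] : Submodule Λ X where
  carrier := {x | ∀ r ∈ Ring.jacobson Λ, r • x = 0}
  add_mem' {x y} hx hy r hr := by rw [smul_add, hx r hr, hy r hr, add_zero]
  zero_mem' r _ := smul_zero r
  smul_mem' s x hx r hr := by rw [← mul_smul]; exact hx _ (Ideal.mul_mem_right _ _ hr)

variable {Λ} {X Y : Type} [AddCommGroup X] [Module Λ X] [AddCommGroup Y] [Module Λ Y]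

lemma mem_soc {x : X} : x ∈ soc Λ X ↔ ∀ r ∈ Ring.jacobson Λ, r • x = 0 := Iff.rfl

lemma map_mem_soc (f : X →ₗ[Λ] Y) {x : X} (hx : x ∈ soc Λ X) : f x ∈ soc Λ Y :=
  fun r hr => by rw [← map_smul, hx r hr, map_zero]

lemma isSemisimple_of_le_soc [IsSemiprimaryRing Λ] (h : ∀ x, x ∈ soc Λ X) :
    IsSemisimpleModule Λ X := by
  have hT : Module.IsTorsionBySet Λ X (Ring.jacobson Λ : Set Λ) := fun x r => h x r r.2
  let _ := hT.module
  exact (hT.semilinearMap.isSemisimpleModule_iff_of_bijective Function.bijective_id).2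
    inferInstance

instance [IsSemiprimaryRing Λ] : IsSemisimpleModule Λ (soc Λ X) :=
  isSemisimple_of_le_soc fun x r hr => Subtype.ext (x.2 r hr)

lemma mul_mem_jacobson_pow_succ {n : ℕ} {s r : Λ} (hs : s ∈ Ring.jacobson Λ)
    (hr : r ∈ Ring.jacobson Λ ^ n) : s * r ∈ Ring.jacobson Λ ^ (n + 1) := by
  rcases eq_or_ne n 0 with rfl | hn
  · rw [zero_add, Submodule.pow_one]
    exact Ideal.mul_mem_right _ _ hs
  · rw [Submodule.pow_succ' _ hn]
    exact Ideal.mul_mem_mul hs hr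

lemma one_mem_jacobson_pow_zero : (1 : Λ) ∈ Ring.jacobson Λ ^ 0 := by
  rw [Submodule.pow_zero, Ideal.one_eq_top]
  trivial

lemma exists_smul_mem_soc [IsSemiprimaryRing Λ] {x : X} (hx : x ≠ 0) :
    ∃ r : Λ, r • x ≠ 0 ∧ r • x ∈ soc Λ X := by
  obtain ⟨n, hn⟩ := IsSemiprimaryRing.isNilpotent (R := Λ)
  have key : ∀ n : ℕ, (∃ r ∈ Ring.jacobson Λ ^ n, r • x ≠ 0) ∨
      ∃ r : Λ, r • x ≠ 0 ∧ r • x ∈ soc Λ X := by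
    intro n
    induction n with
    | zero => exact .inl ⟨1, one_mem_jacobson_pow_zero, by simpa using hx⟩
    | succ n ih =>
      rcases ih with ⟨r, hr, hrx⟩ | h
      · by_cases hs : r • x ∈ soc Λ X
        · exact .inr ⟨r, hrx, hs⟩
        · rw [mem_soc] at hs
          push Not at hs
          obtain ⟨s, hs, hsx⟩ := hs
          exact .inl ⟨s * r, mul_mem_jacobson_pow_succ hs hr, by rwa [mul_smul]⟩
      · exact .inr h
  rcases key n with ⟨r, hr, hrx⟩ | h
  · rw [hn] at hr
    exact absurd (by rw [(Submodule.mem_bot Λ).1 hr, zero_smul]) hrx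
  · exact h

lemma injective_of_injective_on_soc [IsSemiprimaryRing Λ] (f : X →ₗ[Λ] Y)
    (h : ∀ x ∈ soc Λ X, f x = 0 → x = 0) : Function.Injective f := by
  rw [← LinearMap.ker_eq_bot, LinearMap.ker_eq_bot']
  intro x hx
  by_contra hx0
  obtain ⟨r, hr, hs⟩ := exists_smul_mem_soc (Λ := Λ) hx0
  exact hr (h _ hs (by rw [map_smul, hx, smul_zero]))

/-- Restriction of endomorphisms to the socle. -/
def socRestrict : Module.End Λ X →+* Module.End Λ (soc Λ X) where
  toFun f := f.restrict fun _ hx => map_mem_soc f hx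
  map_one' := rfl
  map_mul' _ _ := rfl
  map_zero' := rfl
  map_add' _ _ := rfl

lemma isNilpotent_of_socRestrict_eq_zero [IsSemiprimaryRing Λ] (h : Module.End Λ X)
    (hh : socRestrict h = 0) : IsNilpotent h := by
  have h0 : ∀ x ∈ soc Λ X, h x = 0 := fun x hx =>
    congrArg Subtype.val (LinearMap.congr_fun hh ⟨x, hx⟩)
  obtain ⟨n, hn⟩ := IsSemiprimaryRing.isNilpotent (R := Λ)
  have key : ∀ n : ℕ, ∀ x : X, (∀ r ∈ Ring.jacobson Λ ^ n, r • x = 0) → (h ^ n) x = 0 := by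
    intro n
    induction n with
    | zero => intro x hx; simpa using hx 1 one_mem_jacobson_pow_zero
    | succ n ih =>
      intro x hx
      rw [pow_succ, Module.End.mul_apply]
      refine ih _ fun r hr => ?_
      rw [← map_smul]
      refine h0 _ fun s hs => ?_
      rw [← mul_smul]
      exact hx _ (mul_mem_jacobson_pow_succ hs hr)
  refine ⟨n, LinearMap.ext fun x => key n x fun r hr => ?_⟩
  rw [hn] at hr
  rw [(Submodule.mem_bot Λ).1 hr, zero_smul]

/-- A quotient of an injective module splits off an injective summand containing the image of
the socle. -/
lemma exists_injective_summand [IsSemiprimaryRing Λ] [Module.Injective Λ X] (q : X →ₗ[Λ] Y) :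
    ∃ (I : Type) (_ : AddCommGroup I) (_ : Module Λ I) (j : I →ₗ[Λ] Y) (r : Y →ₗ[Λ] I),
      Retract Λ I X ∧ (∀ x, r (j x) = x) ∧ ∀ x ∈ soc Λ X, ∃ y, j y = q x := by
  let N : Submodule Λ (soc Λ X) := LinearMap.ker (q ∘ₗ (soc Λ X).subtype)
  obtain ⟨π, hπ⟩ := IsSemisimpleModule.extension_property N.subtype N.subtype_injective
    LinearMap.id
  have hπ' : ∀ x : N, π x = x := fun x => LinearMap.congr_fun hπ x
  let p : Module.End Λ (soc Λ X) := N.subtype ∘ₗ π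
  have hp : IsIdempotentElem p := LinearMap.ext fun x => by
    change N.subtype (π (N.subtype (π x))) = N.subtype (π x)
    exact congrArg N.subtype (hπ' (π x))
  have hpN : ∀ x ∈ N, p x = x := fun x hx => congrArg Subtype.val (hπ' ⟨x, hx⟩)
  have hqp : ∀ x, q (p x) = 0 := fun x => (π x).2
  have hsurj : Function.Surjective (socRestrict (Λ := Λ) (X := X)) := fun e => by
    obtain ⟨e', he'⟩ := Module.Injective.out (soc Λ X).subtype (soc Λ X).subtype_injective
      ((soc Λ X).subtype ∘ₗ e)
    exact ⟨e', LinearMap.ext fun x => Subtype.ext (he' x)⟩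
  obtain ⟨e, he, hep⟩ := exists_isIdempotentElem_eq_of_ker_isNilpotent
    (socRestrict (Λ := Λ) (X := X)) (fun x hx => isNilpotent_of_socRestrict_eq_zero x hx)
    (1 - p) (hsurj _) hp.one_sub
  have hes : ∀ x : soc Λ X, e x = x - p x := fun x =>
    congrArg Subtype.val (LinearMap.congr_fun hep x)
  have hee : ∀ x, e (e x) = e x := fun x => LinearMap.congr_fun he x
  let I := LinearMap.range e
  have hI : Retract Λ I X := ⟨I.subtype, e.rangeRestrict, by
    rintro ⟨_, x, rfl⟩
    exact Subtype.ext (hee x)⟩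
  have : Module.Injective Λ I := injective_of_retract hI
  let j : I →ₗ[Λ] Y := q ∘ₗ I.subtype
  have hj : Function.Injective j := by
    refine injective_of_injective_on_soc j ?_
    rintro ⟨_, x, rfl⟩ hx hjx
    have hx' : e x ∈ soc Λ X := map_mem_soc I.subtype hx
    have h1 := hes ⟨e x, hx'⟩
    rw [hpN ⟨e x, hx'⟩ hjx, sub_self, hee] at h1
    exact Subtype.ext h1
  obtain ⟨r, hr⟩ := Module.Injective.out j hj LinearMap.id
  refine ⟨I, _, _, j, r, hI, hr, fun x hx => ⟨⟨e x, x, rfl⟩, ?_⟩⟩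
  change q (e x) = q x
  rw [hes ⟨x, hx⟩, map_sub, hqp, sub_zero]

end Socle

section

variable {k Λ : Type} [Field k] [Ring Λ] [Algebra k Λ] [FiniteDimensional k Λ] {D : DomData k Λ}

/-- A module with finite-dimensional socle is finitely generated. -/
lemma finite_of_finite_soc (k : Type) [Field k] [Algebra k Λ] [FiniteDimensional k Λ]
    (X : Type) [AddCommGroup X] [Module Λ X]
    [Module.Finite Λ (soc Λ X)] : Module.Finite Λ X := by
  have : IsArtinianRing Λ := IsArtinianRing.of_finite k Λ
  have : IsNoetherianRing Λ := IsNoetherianRing.of_finite k Λ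
  obtain ⟨n, f, hf⟩ := exists_fin_W_embedding k (Λ := Λ) (soc Λ X)
  have : Module.Injective Λ (Fin n → W k Λ) :=
    injective_of_retract (.of_equiv (Finsupp.linearEquivFunOnFinite Λ (W k Λ) (Fin n)).symm)
  obtain ⟨g, hg⟩ := Module.Injective.out (soc Λ X).subtype (soc Λ X).subtype_injective f
  refine Module.Finite.of_injective g (injective_of_injective_on_soc g fun x hx h => ?_)
  have : f ⟨x, hx⟩ = 0 := (hg ⟨x, hx⟩).symm.trans h
  exact congrArg Subtype.val (hf (this.trans (map_zero f).symm))

lemma SES.pi {R X Y Z : Type} [Ring R] [AddCommGroup X] [Module R X] [AddCommGroup Y] [Module R Y]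
    [AddCommGroup Z] [Module R Z] {f : X →ₗ[R] Y} {g : Y →ₗ[R] Z} (h : SES f g) (J : Type) :
    SES (LinearMap.pi fun j => f ∘ₗ LinearMap.proj j : (J → X) →ₗ[R] (J → Y))
      (LinearMap.pi fun j => g ∘ₗ LinearMap.proj j) where
  inj x y hxy := funext fun j => h.inj (congrFun hxy j)
  surj z := by
    choose y hy using fun j => h.surj (z j)
    exact ⟨y, funext hy⟩
  exact y := by
    refine ⟨fun hy => ?_, ?_⟩
    · choose x hx using fun j => (h.exact (y j)).1 (congrFun hy j)
      exact ⟨x, funext hx⟩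
    · rintro ⟨x, rfl⟩
      exact funext fun j => h.apply_apply (x j)

/-- The socle of the approximation is finite-dimensional modulo the socle of an injective cover. -/
lemma exists_finite_soc_quotient
    {E U I E₁ : Type} [AddCommGroup E] [Module Λ E] [AddCommGroup U] [Module Λ U]
    [AddCommGroup I] [Module Λ I] [AddCommGroup E₁] [Module Λ E₁]
    {f : (Λ ⧸ Ring.jacobson Λ) →ₗ[Λ] E} {g : E →ₗ[Λ] U} (hs : SES f g) (hE : GI D E)
    (hU : ∀ J : Type, PerpGI D (J → U))
    {i : E₁ →ₗ[Λ] I} {q : I →ₗ[Λ] E} (hq : SES i q) (hE₁ : GI D E₁) :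
    ∃ F : Submodule Λ E, F.FG ∧ ∀ x ∈ soc Λ E, ∃ y ∈ F, ∃ z ∈ soc Λ I, x = y + q z := by
  obtain ⟨_, _⟩ := exists_tower k Λ E
  let J := soc Λ E
  let b := Module.Basis.ofVectorSpace k (J → k)
  set K := Module.Basis.ofVectorSpaceIndex k (J → k)
  have hses : SES (LinearMap.pi fun j => f ∘ₗ LinearMap.proj j : (J → _) →ₗ[Λ] (J → E))
      (LinearMap.pi fun j => g ∘ₗ LinearMap.proj j : (J → E) →ₗ[Λ] (J → U)) := hs.pi J
  have hqs : SES (LinearMap.pi fun j => i ∘ₗ LinearMap.proj j : (J → _) →ₗ[Λ] (J → I))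
      (LinearMap.pi fun j => q ∘ₗ LinearMap.proj j : (J → I) →ₗ[Λ] (J → E)) := hq.pi J
  obtain ⟨_, _⟩ := exists_tower k Λ (Λ ⧸ Ring.jacobson Λ)
  have := finite_tower k Λ (Λ ⧸ Ring.jacobson Λ)
  let e := LinearEquiv.ofBijective _ (coordMap_bijective (Λ := Λ) b (Λ ⧸ Ring.jacobson Λ))
  obtain ⟨ρ, hρ⟩ := hU J (K →₀ E) (hE.finsupp K) hses
    (Finsupp.mapRange.linearMap f ∘ₗ e.symm.toLinearMap)
  let σ := coordMap k Λ b E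
  obtain ⟨h, hh⟩ := hses.desc (σ ∘ₗ ρ - LinearMap.id) (fun x => by
    obtain ⟨x, rfl⟩ := e.surjective x
    rw [LinearMap.sub_apply, LinearMap.comp_apply, hρ, sub_eq_zero]
    ext j
    simp only [LinearMap.comp_apply, LinearEquiv.coe_coe, LinearEquiv.symm_apply_apply]
    exact coordMap_naturality b f x j)
  obtain ⟨h', hh'⟩ := (hU J _ (GI.pi fun _ => hE₁)).lift hqs h
  let x : J → E := fun j => j.1
  have hx : x ∈ soc Λ (J → E) := fun r hr => funext fun j => j.2 r hr
  let F : Submodule Λ E := Submodule.span Λ (Set.image (fun κ => (ρ x) κ) ((ρ x).support : Set K))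
  refine ⟨F, Submodule.fg_span ((Finset.finite_toSet _).image _), fun y hy => ?_⟩
  let z : J → I := h' (LinearMap.pi (fun j => g ∘ₗ LinearMap.proj j) x)
  have hz : z ∈ soc Λ (J → I) := map_mem_soc _ (map_mem_soc _ hx)
  have hxz : ∀ j, σ (ρ x) j - x j = q (z j) := fun j => by
    have h1 := hh x
    have h2 := hh' (LinearMap.pi (fun j => g ∘ₗ LinearMap.proj j) x)
    exact (congrFun (h2.trans h1) j).symm
  refine ⟨σ (ρ x) ⟨y, hy⟩, ?_, -z ⟨y, hy⟩, ?_, ?_⟩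
  · rw [coordMap_apply]
    refine Submodule.sum_mem _ fun κ hκ => ?_
    change b κ ⟨y, hy⟩ • (ρ x) κ ∈ F
    rw [← algebraMap_smul Λ]
    exact F.smul_mem _ (Submodule.subset_span ⟨κ, hκ, rfl⟩)
  · exact Submodule.neg_mem _ fun r hr => congrFun (hz r hr) _
  · rw [map_neg, ← hxz]
    simp [x]

/-- If the left orthogonal class is closed under products then the Gorenstein-injective modules
are generated by a finitely generated one. -/
lemma FGGen.of_pi (D : DomData k Λ)
    (hpi : ∀ (U : Type) [AddCommGroup U] [Module Λ U], PerpGI D U →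
      ∀ J : Type, PerpGI D (J → U)) : FGGen D := by
  have : IsArtinianRing Λ := IsArtinianRing.of_finite k Λ
  have : IsNoetherianRing Λ := IsNoetherianRing.of_finite k Λ
  obtain ⟨E, U, _, _, _, _, f, g, hs, hE, hU⟩ := exists_GI_preenvelope D (Λ ⧸ Ring.jacobson Λ)
  obtain ⟨J, E₁, _, _, i, q, hq, hE₁⟩ := hE.exists_cover
  obtain ⟨F, hF, hFs⟩ := exists_finite_soc_quotient hs hE (hpi U hU) hq hE₁
  obtain ⟨I, _, _, j, r, hI, hr, hsoc⟩ := exists_injective_summand q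
  obtain ⟨E₀, _, _, c, hc⟩ := exists_ses_of_surjective r fun x => ⟨j x, hr x⟩
  obtain ⟨t, ht⟩ := hc.lift (LinearMap.id - j ∘ₗ r) (fun x => by simp [hr])
  have htc : ∀ x, t (c x) = x := fun x => hc.inj (by simp [ht, hc.apply_apply])
  have hret : Retract Λ E₀ E := ⟨c, t, htc⟩
  have hfin : Module.Finite Λ (soc Λ E₀) := by
    have hle : soc Λ E₀ ≤ F.map t := fun x hx => by
      obtain ⟨y, hy, z, hz, hxy⟩ := hFs (c x) (map_mem_soc c hx)
      obtain ⟨y', hy'⟩ := hsoc z hz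
      refine ⟨y, hy, ?_⟩
      have h0 : t (j y') = 0 := hc.inj (by simp [ht, hr])
      rw [← htc x, hxy, map_add, ← hy', h0, add_zero]
    have : Module.Finite Λ (F.map t) := Module.Finite.iff_fg.2 (hF.map t)
    exact Module.Finite.of_injective (Submodule.inclusion hle) (Submodule.inclusion_injective hle)
  have := finite_of_finite_soc (Λ := Λ) k E₀
  refine FGGen.of_retract hs hE hU (L₀ := E₀) (J₀ := J) (hE.retract hret) ?_
  obtain ⟨a, b, hab⟩ := hI
  exact ⟨t.prod (a ∘ₗ r), c.coprod (j ∘ₗ b), fun x => by simp [ht, hab]⟩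

end


/-! ## Hom functors that are fully faithful on Gorenstein-injective modules -/

section HMod

variable {B Λ T : Type} [Ring B] [Ring Λ] [AddCommGroup T] [Module Λ T]

/-- `Hom_Λ(T, V)` as a module over a ring acting on `T` from the right. -/
def HMod (_ρ : B →+* (Module.End Λ T)ᵐᵒᵖ) (V : Type) [AddCommGroup V] [Module Λ V] : Type :=
  T →ₗ[Λ] V

variable (ρ : B →+* (Module.End Λ T)ᵐᵒᵖ)
variable {V V' V'' : Type} [AddCommGroup V] [Module Λ V] [AddCommGroup V'] [Module Λ V']
variable [AddCommGroup V''] [Module Λ V'']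

namespace HMod

instance : AddCommGroup (HMod ρ V) := inferInstanceAs (AddCommGroup (T →ₗ[Λ] V))

instance : FunLike (HMod ρ V) T V := inferInstanceAs (FunLike (T →ₗ[Λ] V) T V)

instance : LinearMapClass (HMod ρ V) Λ T V :=
  inferInstanceAs (LinearMapClass (T →ₗ[Λ] V) Λ T V)

instance : SMul B (HMod ρ V) := ⟨fun b ξ => (LinearMap.comp ξ (ρ b).unop : T →ₗ[Λ] V)⟩

variable {ρ}

@[ext] lemma ext {ξ η : HMod ρ V} (h : ∀ n, ξ n = η n) : ξ = η := DFunLike.ext _ _ h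

@[simp] lemma smul_apply (b : B) (ξ : HMod ρ V) (t : T) : (b • ξ) t = ξ ((ρ b).unop t) := rfl
@[simp] lemma add_apply (ξ η : HMod ρ V) (t : T) : (ξ + η) t = ξ t + η t := rfl
@[simp] lemma zero_apply (t : T) : (0 : HMod ρ V) t = 0 := rfl
@[simp] lemma sub_apply (ξ η : HMod ρ V) (t : T) : (ξ - η) t = ξ t - η t := rfl

variable (ρ) in
/-- View a linear map as an element of the Hom module. -/
def mk (ξ : T →ₗ[Λ] V) : HMod ρ V := ξ

@[simp] lemma mk_apply (ξ : T →ₗ[Λ] V) (t : T) : mk ρ ξ t = ξ t := rfl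

/-- The linear map underlying an element of the Hom module. -/
def hom (ξ : HMod ρ V) : T →ₗ[Λ] V := ξ

@[simp] lemma hom_apply (ξ : HMod ρ V) (t : T) : ξ.hom t = ξ t := rfl

instance : Module B (HMod ρ V) where
  one_smul ξ := by ext; simp
  mul_smul x y ξ := by ext; simp
  smul_zero x := by ext; simp
  smul_add x ξ η := by ext; simp
  add_smul x y ξ := by ext; simp
  zero_smul ξ := by ext; simp

variable (ρ) in
/-- Functoriality of the Hom module. -/
def map (g : V →ₗ[Λ] V') : HMod ρ V →ₗ[B] HMod ρ V' where
  toFun ξ := mk ρ (g ∘ₗ ξ.hom)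
  map_add' ξ η := by ext; simp
  map_smul' b ξ := by ext; simp

@[simp] lemma map_apply (g : V →ₗ[Λ] V') (ξ : HMod ρ V) (t : T) : map ρ g ξ t = g (ξ t) := rfl

lemma map_comp (g : V →ₗ[Λ] V') (g' : V' →ₗ[Λ] V'') : map ρ (g' ∘ₗ g) = map ρ g' ∘ₗ map ρ g := rfl

lemma map_id : map ρ (LinearMap.id : V →ₗ[Λ] V) = LinearMap.id := rfl

lemma map_add (g g' : V →ₗ[Λ] V') : map ρ (g + g') = map ρ g + map ρ g' := rfl

lemma map_sub (g g' : V →ₗ[Λ] V') : map ρ (g - g') = map ρ g - map ρ g' := rfl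

lemma map_zero : map ρ (0 : V →ₗ[Λ] V') = 0 := rfl

variable (ρ) in
/-- Functoriality of the Hom module on isomorphisms. -/
def mapEquiv (e : V ≃ₗ[Λ] V') : HMod ρ V ≃ₗ[B] HMod ρ V' :=
  { map ρ e.toLinearMap with
    invFun := map ρ e.symm.toLinearMap
    left_inv := fun ξ => by ext; simp
    right_inv := fun ξ => by ext; simp }

lemma retract (h : Retract Λ V V') : Retract B (HMod ρ V) (HMod ρ V') := by
  obtain ⟨i, p, hip⟩ := h
  exact ⟨map ρ i, map ρ p, fun ξ => by ext; simp [hip]⟩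

lemma injective_map {g : V →ₗ[Λ] V'} (hg : Function.Injective g) :
    Function.Injective (map ρ g) :=
  fun _ _ h => ext fun t => hg (DFunLike.congr_fun h t)

lemma ses_map {f : V →ₗ[Λ] V'} {g : V' →ₗ[Λ] V''} (h : SES f g) (hT : Ext1 Λ T V) :
    SES (map ρ f) (map ρ g) where
  inj := injective_map h.inj
  surj ξ := by
    obtain ⟨v, hv⟩ := hT.lift h ξ.hom
    exact ⟨mk ρ v, ext hv⟩
  exact ξ := by
    refine ⟨fun hξ => ?_, ?_⟩
    · obtain ⟨v, hv⟩ := h.lift ξ.hom fun t => DFunLike.congr_fun hξ t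
      exact ⟨mk ρ v, ext hv⟩
    · rintro ⟨η, rfl⟩
      exact ext fun t => h.apply_apply _

section Sums

variable (ρ) in
/-- The Hom module of a direct sum. -/
noncomputable def directSumMap {J : Type} [DecidableEq J] (V : J → Type)
    [∀ j, AddCommGroup (V j)] [∀ j, Module Λ (V j)] :
    DirectSum J (fun j => HMod ρ (V j)) →ₗ[B] HMod ρ (DirectSum J V) :=
  DirectSum.toModule B J _ fun j => map ρ (DirectSum.lof Λ J V j)

lemma directSumMap_lof {J : Type} [DecidableEq J] {V : J → Type}
    [∀ j, AddCommGroup (V j)] [∀ j, Module Λ (V j)] (j : J) (ξ : HMod ρ (V j)) :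
    directSumMap ρ V (DirectSum.lof B J _ j ξ) = map ρ (DirectSum.lof Λ J V j) ξ := by
  simp [directSumMap]

lemma directSumMap_apply {J : Type} [DecidableEq J] {V : J → Type}
    [∀ j, AddCommGroup (V j)] [∀ j, Module Λ (V j)] (ξ : DirectSum J (fun j => HMod ρ (V j)))
    (t : T) (j : J) : directSumMap ρ V ξ t j = ξ j t := by
  induction ξ using DirectSum.induction_on with
  | zero => simp
  | of i ξ =>
    have := DFunLike.congr_fun (directSumMap_lof (ρ := ρ) (V := V) i ξ) t
    refine (congrArg (fun x => x j) this).trans ?_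
    rw [map_apply]
    by_cases h : i = j
    · subst h
      rw [DirectSum.lof_apply, DirectSum.of_eq_same]
    · rw [DirectSum.lof_eq_of, DirectSum.of_eq_of_ne _ _ _ (Ne.symm h),
        DirectSum.of_eq_of_ne _ _ _ (Ne.symm h)]
      rfl
  | add x y hx hy => simp [hx, hy]

variable [Module.Finite Λ T]

lemma directSumMap_bijective {J : Type} [DecidableEq J] (V : J → Type)
    [∀ j, AddCommGroup (V j)] [∀ j, Module Λ (V j)] :
    Function.Bijective (directSumMap ρ V) := by
  constructor
  · intro ξ η h
    refine DFinsupp.ext fun j => ext fun t => ?_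
    rw [← directSumMap_apply, h, directSumMap_apply]
  · intro u
    obtain ⟨s, hs⟩ := exists_finset_component_eq_zero u.hom
    refine ⟨∑ j ∈ s, DirectSum.lof B J (fun j => HMod ρ (V j)) j
      (mk ρ (DirectSum.component Λ J V j ∘ₗ u.hom)), ext fun t => DFinsupp.ext fun j => ?_⟩
    refine (directSumMap_apply _ _ _).trans ?_
    by_cases hj : j ∈ s
    · have : (∑ j ∈ s, DirectSum.lof B J (fun j => HMod ρ (V j)) j
        (mk ρ (DirectSum.component Λ J V j ∘ₗ u.hom))) j =
          mk ρ (DirectSum.component Λ J V j ∘ₗ u.hom) := by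
        rw [DFinsupp.finsetSum_apply, Finset.sum_eq_single j]
        · rw [DirectSum.lof_apply]
        · intro i _ hi
          exact DirectSum.of_eq_of_ne _ _ _ hi.symm
        · intro h; exact absurd hj h
      rw [this]
      rfl
    · have : (∑ j ∈ s, DirectSum.lof B J (fun j => HMod ρ (V j)) j
        (mk ρ (DirectSum.component Λ J V j ∘ₗ u.hom))) j = 0 := by
        rw [DFinsupp.finsetSum_apply, Finset.sum_eq_zero]
        intro i hi
        refine DirectSum.of_eq_of_ne _ _ _ ?_
        rintro rfl
        exact hj hi
      rw [this]
      exact (hs t j hj).symm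

variable (ρ) in
/-- The Hom module of a direct sum of copies. -/
lemma exists_finsuppEquiv (V : Type) [AddCommGroup V] [Module Λ V] (J : Type) :
    ∃ e : (J →₀ HMod ρ V) ≃ₗ[B] HMod ρ (J →₀ V),
      ∀ j ξ, e (Finsupp.single j ξ) = map ρ (Finsupp.lsingle j) ξ := by
  classical
  let e := finsuppLEquivDirectSum B (HMod ρ V) J ≪≫ₗ
    LinearEquiv.ofBijective _ (directSumMap_bijective (ρ := ρ) (fun _ : J => V)) ≪≫ₗ
    mapEquiv ρ (finsuppLEquivDirectSum Λ V J).symm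
  refine ⟨e, fun j ξ => ?_⟩
  simp only [e, LinearEquiv.trans_apply, finsuppLEquivDirectSum_single,
    LinearEquiv.ofBijective_apply, directSumMap_lof]
  ext t : 1
  change (finsuppLEquivDirectSum Λ V J).symm (DirectSum.lof Λ J _ j (ξ t)) =
    Finsupp.single j (ξ t)
  rw [finsuppLEquivDirectSum_symm_lof]

end Sums

end HMod

end HMod

section Full

variable {k B Λ T : Type} [Field k] [Ring B] [Ring Λ] [Algebra k Λ]
  [AddCommGroup T] [Module Λ T]

/-- `Hom_Λ(T, -)` is fully faithful on maps out of the injective cogenerator. -/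
structure HFull (k : Type) {B Λ T : Type} [Field k] [Ring B] [Ring Λ] [Algebra k Λ]
    [AddCommGroup T] [Module Λ T]
    (ρ : B →+* (Module.End Λ T)ᵐᵒᵖ) : Prop where
  retract : ∃ n : ℕ, Retract Λ T (Fin n →₀ W k Λ)
  faithful : ∀ (V : Type) [AddCommGroup V] [Module Λ V] (g : W k Λ →ₗ[Λ] V),
    HMod.map ρ g = 0 → g = 0
  full : ∀ (V : Type) [AddCommGroup V] [Module Λ V] (f : HMod ρ (W k Λ) →ₗ[B] HMod ρ V),
    ∃ g : W k Λ →ₗ[Λ] V, HMod.map ρ g = f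

variable {ρ : B →+* (Module.End Λ T)ᵐᵒᵖ} {D : DomData k Λ}
variable {L V V' : Type} [AddCommGroup L] [Module Λ L] [AddCommGroup V] [Module Λ V]
  [AddCommGroup V'] [Module Λ V']

namespace HFull

lemma ext1_T (hρ : HFull k ρ) (hL : GI D L) : Ext1 Λ T L := by
  obtain ⟨n, hn⟩ := hρ.retract
  exact (hL.ext1_W.finsupp_left _).retract_left hn

lemma ses (hρ : HFull k ρ) (hL : GI D L) {f : L →ₗ[Λ] V} {g : V →ₗ[Λ] V'} (h : SES f g) :
    SES (HMod.map ρ f) (HMod.map ρ g) := HMod.ses_map h (hρ.ext1_T hL)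

lemma faithful_finsupp (hρ : HFull k ρ) {J : Type} (g : (J →₀ W k Λ) →ₗ[Λ] V)
    (hg : HMod.map ρ g = 0) : g = 0 := by
  refine Finsupp.lhom_ext' fun j => hρ.faithful V (g ∘ₗ Finsupp.lsingle j) ?_
  rw [HMod.map_comp, hg, LinearMap.zero_comp]

variable [FiniteDimensional k Λ]

lemma finite (hρ : HFull k ρ) : Module.Finite Λ T := by
  obtain ⟨n, i, p, hip⟩ := hρ.retract
  exact Module.Finite.of_surjective p fun x => ⟨i x, hip x⟩

lemma full_finsupp (hρ : HFull k ρ) {J : Type}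
    (f : HMod ρ (J →₀ W k Λ) →ₗ[B] HMod ρ V) :
    ∃ g : (J →₀ W k Λ) →ₗ[Λ] V, HMod.map ρ g = f := by
  have := hρ.finite
  obtain ⟨e, he⟩ := HMod.exists_finsuppEquiv ρ (W k Λ) J
  choose g hg using fun j => hρ.full V (f ∘ₗ HMod.map ρ (Finsupp.lsingle j))
  refine ⟨Finsupp.lsum ℕ g, ?_⟩
  have key : HMod.map ρ (Finsupp.lsum ℕ g) ∘ₗ e.toLinearMap = f ∘ₗ e.toLinearMap := by
    refine Finsupp.lhom_ext fun j ξ => ?_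
    have := LinearMap.congr_fun (hg j) ξ
    rw [LinearMap.comp_apply, LinearMap.comp_apply, LinearEquiv.coe_coe, he]
    refine Eq.trans ?_ this
    ext t
    simp
  ext ξ : 1
  obtain ⟨η, rfl⟩ := e.surjective ξ
  exact LinearMap.congr_fun key η

lemma faithful_GI (hρ : HFull k ρ) (hL : GI D L) (g : L →ₗ[Λ] V) (hg : HMod.map ρ g = 0) :
    g = 0 := by
  obtain ⟨J, K, _, _, i, q, hq, -⟩ := hL.exists_cover
  have h0 : g ∘ₗ q = 0 := hρ.faithful_finsupp _ (by rw [HMod.map_comp, hg, LinearMap.zero_comp])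
  ext x
  obtain ⟨y, rfl⟩ := hq.surj x
  exact LinearMap.congr_fun h0 y

lemma full_GI (hρ : HFull k ρ) (hL : GI D L) (f : HMod ρ L →ₗ[B] HMod ρ V) :
    ∃ g : L →ₗ[Λ] V, HMod.map ρ g = f := by
  obtain ⟨J, K, _, _, i, q, hq, hK⟩ := hL.exists_cover
  obtain ⟨γ, hγ⟩ := hρ.full_finsupp (f ∘ₗ HMod.map ρ q)
  have h0 : γ ∘ₗ i = 0 := hρ.faithful_GI hK _ (by
    rw [HMod.map_comp, hγ, LinearMap.comp_assoc, ← HMod.map_comp,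
      LinearMap.ext hq.apply_apply (g := 0) (f := q ∘ₗ i), HMod.map_zero, LinearMap.comp_zero])
  obtain ⟨g, hg⟩ := hq.desc γ fun x => LinearMap.congr_fun h0 x
  refine ⟨g, ?_⟩
  have hs := (hρ.ses hK hq).surj
  ext ξ : 1
  obtain ⟨η, rfl⟩ := hs ξ
  refine Eq.trans ?_ (LinearMap.congr_fun hγ η)
  ext t
  exact hg _

/-- A finitely generated Hom module comes from a finitely generated module. -/
lemma finite_of_finite (hρ : HFull k ρ) (hL : GI D L) [Module.Finite B (HMod ρ L)] :
    Module.Finite Λ L := by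
  have := hρ.finite
  obtain ⟨s, hs⟩ := (Module.Finite.fg_top : (⊤ : Submodule B (HMod ρ L)).FG)
  let F : Submodule Λ L := ⨆ ξ ∈ s, LinearMap.range ξ.hom
  have hF : F.FG := Submodule.fg_biSup _ _ fun ξ _ => by
    rw [LinearMap.range_eq_map]
    exact Module.Finite.fg_top.map _
  have hT : ∀ (ξ : HMod ρ L) t, ξ t ∈ F := fun ξ => by
    have hξ : ξ ∈ Submodule.span B (s : Set (HMod ρ L)) := hs ▸ Submodule.mem_top
    induction hξ using Submodule.span_induction with
    | mem ξ hξ => exact fun t => Submodule.mem_iSup_of_mem ξ (Submodule.mem_iSup_of_mem hξ ⟨t, rfl⟩)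
    | zero => exact fun t => F.zero_mem
    | add ξ η _ _ h1 h2 => exact fun t => F.add_mem (h1 t) (h2 t)
    | smul b ξ _ h => exact fun t => h _
  have hWF : ∀ (u : W k Λ →ₗ[Λ] L) w, u w ∈ F := fun u => by
    let f : HMod ρ L →ₗ[B] HMod ρ F :=
      { toFun := fun ξ => HMod.mk ρ (ξ.hom.codRestrict F (hT ξ))
        map_add' := fun _ _ => rfl
        map_smul' := fun _ _ => rfl }
    obtain ⟨v, hv⟩ := hρ.full _ (f ∘ₗ HMod.map ρ u)
    have : u - F.subtype ∘ₗ v = 0 := hρ.faithful _ _ (by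
      rw [HMod.map_sub, HMod.map_comp, hv, sub_eq_zero]; rfl)
    intro w
    have h := LinearMap.congr_fun this w
    rw [LinearMap.sub_apply, LinearMap.zero_apply, sub_eq_zero] at h
    rw [h]
    exact (v w).2
  obtain ⟨J, K, _, _, i, q, hq, -⟩ := hL.exists_cover
  have htop : F = ⊤ := by
    refine eq_top_iff.2 fun x _ => ?_
    obtain ⟨y, rfl⟩ := hq.surj x
    induction y using Finsupp.induction_linear with
    | zero => rw [map_zero]; exact F.zero_mem
    | add x y hx hy => rw [map_add]; exact F.add_mem (hx trivial) (hy trivial)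
    | single j w => exact hWF (q ∘ₗ Finsupp.lsingle j) w
  exact ⟨htop ▸ hF⟩

/-- `Ext¹(HW, HL)` vanishes for Gorenstein-injective `L`. -/
lemma ext1_left (hρ : HFull k ρ) (hL : GI D L)
    (hN : ∀ J : Type, Ext1 B (HMod ρ (W k Λ)) (J →₀ HMod ρ (W k Λ))) :
    Ext1 B (HMod ρ (W k Λ)) (HMod ρ L) := by
  have := hρ.finite
  obtain ⟨J, C, _, _, f, g, h⟩ := exists_finsupp_W_ses k (Λ := Λ) L
  obtain ⟨e, -⟩ := HMod.exists_finsuppEquiv ρ (W k Λ) J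
  refine .of_coresolution (hρ.ses hL h) ((hN J).congr_right e) fun u => ?_
  obtain ⟨u, rfl⟩ := hρ.full _ u
  obtain ⟨v, hv⟩ := hL.ext1_W.lift h u
  exact ⟨HMod.map ρ v, fun x => HMod.ext fun t => hv _⟩

/-- `Ext¹(HL, HW)` vanishes for Gorenstein-injective `L`. -/
lemma ext1_right (hρ : HFull k ρ) (hL : GI D L)
    (hN : Ext1 B (HMod ρ (W k Λ)) (HMod ρ (W k Λ))) :
    Ext1 B (HMod ρ L) (HMod ρ (W k Λ)) := by
  have := hρ.finite
  obtain ⟨J, K, _, _, f, g, h, hK⟩ := hL.exists_cover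
  obtain ⟨e, -⟩ := HMod.exists_finsuppEquiv ρ (W k Λ) J
  refine .of_resolution (hρ.ses hK h) ((hN.finsupp_left J).congr_left e) fun u => ?_
  obtain ⟨u, rfl⟩ := hρ.full_GI hK u
  obtain ⟨v, hv⟩ := Module.Injective.out f h.inj u
  exact ⟨HMod.map ρ v, fun x => HMod.ext fun t => hv _⟩

/-- A module sitting in a bi-infinite complex of copies of `HW` is of the form `HL`. -/
lemma exists_of_chain (hρ : HFull k ρ) (D : DomData k Λ) {X : ℤ → ModuleCat.{0} B} {J : ℤ → Type}
    (f : ∀ i, X i →ₗ[B] HMod ρ (J i →₀ W k Λ)) (g : ∀ i, HMod ρ (J i →₀ W k Λ) →ₗ[B] X (i + 1))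
    (h : ∀ i, SES (f i) (g i))
    (h1 : ∀ i, Ext1 B (HMod ρ (W k Λ)) (X i)) (h2 : ∀ i, Ext1 B (X i) (HMod ρ (W k Λ))) :
    ∃ (L : Type) (_ : AddCommGroup L) (_ : Module Λ L),
      GI D L ∧ Nonempty (X 0 ≃ₗ[B] HMod ρ L) := by
  choose δ hδ using fun i => hρ.full_finsupp (f (i + 1) ∘ₗ g i)
  have hδ' : ∀ i ξ, HMod.map ρ (δ i) ξ = f (i + 1) (g i ξ) :=
    fun i ξ => LinearMap.congr_fun (hδ i) ξ
  have hker : ∀ i ξ, HMod.map ρ (δ (i + 1)) ξ = 0 ↔ ∃ x, f (i + 1) x = ξ := fun i ξ => by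
    rw [hδ', ← (h (i + 1)).exact]
    exact ⟨fun h' => (h (i + 1 + 1)).inj (h'.trans (map_zero _).symm), fun h' => by
      rw [h', map_zero]⟩
  have hcomp : ∀ i x, δ (i + 1) (δ i x) = 0 := fun i x => by
    have : δ (i + 1) ∘ₗ δ i = 0 := hρ.faithful_finsupp _ (by
      ext ξ : 1
      rw [HMod.map_comp, LinearMap.comp_apply, hδ' i]
      exact (hker i _).2 ⟨_, rfl⟩)
    exact LinearMap.congr_fun this x
  have hexact : ∀ i, LinearMap.range (δ i) = LinearMap.ker (δ (i + 1)) := fun i => by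
    refine le_antisymm ?_ fun w hw => ?_
    · rintro _ ⟨x, rfl⟩
      exact hcomp i x
    · by_contra hw'
      obtain ⟨φ, hφ, hφw⟩ := exists_W_separating k (Λ := Λ) hw'
      obtain ⟨ψ, hψ⟩ := (h (i + 1)).desc (HMod.map ρ φ) (fun x => by
        obtain ⟨y, rfl⟩ := (h i).surj x
        rw [← hδ']
        ext t : 1
        exact hφ _ ⟨_, rfl⟩)
      obtain ⟨θ, hθ⟩ := h2 _ (h (i + 1 + 1)) ψ
      obtain ⟨θ, rfl⟩ := hρ.full_finsupp θ
      have : φ - θ ∘ₗ δ (i + 1) = 0 := hρ.faithful_finsupp _ (by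
        rw [HMod.map_sub, sub_eq_zero]
        ext ξ : 1
        rw [HMod.map_comp, LinearMap.comp_apply, hδ', hθ, hψ])
      have := LinearMap.congr_fun this w
      rw [LinearMap.sub_apply, LinearMap.comp_apply, LinearMap.mem_ker.1 hw, map_zero,
        sub_zero] at this
      exact hφw this
  refine ⟨LinearMap.ker (δ 0), inferInstance, inferInstance,
    GI.of_chain (L := fun i => LinearMap.ker (δ i)) (I := fun i => J i →₀ W k Λ) _ _
      (fun i => ses_of_exact (hexact i)) (fun i u => ?_) 0, ?_⟩
  · let u' := (LinearMap.ker (δ (i + 1))).subtype ∘ₗ u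
    obtain ⟨ψ, hψ⟩ := (h (i + 1)).lift (HMod.map ρ u') (fun ξ => by
      rw [(h (i + 1)).exact, ← hker]
      ext t : 1
      exact (u (ξ t)).2)
    obtain ⟨θ, hθ⟩ := (h1 i).lift (h i) ψ
    obtain ⟨θ, rfl⟩ := hρ.full _ θ
    have : δ i ∘ₗ θ - u' = 0 := hρ.faithful _ _ (by
      rw [HMod.map_sub, sub_eq_zero]
      ext ξ : 1
      rw [HMod.map_comp, LinearMap.comp_apply, hδ', hθ, hψ])
    exact ⟨θ, fun x => Subtype.ext (sub_eq_zero.1 (LinearMap.congr_fun this x))⟩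
  · have hf0 : ∀ x, HMod.map ρ (δ 0) (f 0 x) = 0 := fun x => by
      rw [hδ', (h 0).apply_apply, map_zero]
    let F : X 0 →ₗ[B] HMod ρ (LinearMap.ker (δ 0)) :=
      { toFun := fun x => HMod.mk ρ ((f 0 x).hom.codRestrict _ fun t =>
          DFunLike.congr_fun (hf0 x) t)
        map_add' := fun x y => by ext t : 2; simp; rfl
        map_smul' := fun b x => by ext t : 2; simp; rfl }
    refine ⟨LinearEquiv.ofBijective F ⟨fun x y hxy => (h 0).inj ?_, fun ξ => ?_⟩⟩
    · ext t : 1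
      exact congrArg Subtype.val (DFunLike.congr_fun hxy t)
    · have : HMod.map ρ (δ 0) (HMod.map ρ (LinearMap.ker (δ 0)).subtype ξ) = 0 :=
        HMod.ext fun t => (ξ t).2
      rw [hδ'] at this
      obtain ⟨x, hx⟩ := ((h 0).exact _).1 ((h (0 + 1)).inj (this.trans (map_zero _).symm))
      exact ⟨x, HMod.ext fun t => Subtype.ext (DFunLike.congr_fun hx t)⟩

/-- Essential surjectivity for a class of modules with two-sided approximations by copies of
`HW`. -/
lemma exists_equiv (hρ : HFull k ρ) (D : DomData k Λ) {N : Type} [AddCommGroup N] [Module B N]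
    (e : N ≃ₗ[B] HMod ρ (W k Λ)) (C : ModuleCat.{0} B → Prop)
    (h1 : ∀ X, C X → Ext1 B N X) (h2 : ∀ X, C X → Ext1 B X N)
    (hup : ∀ X, C X → ∃ (X' : ModuleCat.{0} B) (J : Type) (f : X →ₗ[B] (J →₀ N))
      (g : (J →₀ N) →ₗ[B] X'), SES f g ∧ C X')
    (hdn : ∀ X', C X' → ∃ (X : ModuleCat.{0} B) (J : Type) (f : X →ₗ[B] (J →₀ N))
      (g : (J →₀ N) →ₗ[B] X'), SES f g ∧ C X) (X : ModuleCat.{0} B) (hX : C X) :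
    ∃ (L : Type) (_ : AddCommGroup L) (_ : Module Λ L),
      GI D L ∧ Nonempty (X ≃ₗ[B] HMod ρ L) := by
  have := hρ.finite
  let s : {X : ModuleCat.{0} B // C X} → {X : ModuleCat.{0} B // C X} → Prop :=
    fun X X' => ∃ (J : Type) (f : X.1 →ₗ[B] (J →₀ N)) (g : (J →₀ N) →ₗ[B] X'.1), SES f g
  obtain ⟨c, h0, hc⟩ := exists_int_chain s
    (fun X => by
      obtain ⟨X', J, f, g, h, hX'⟩ := hup X.1 X.2
      exact ⟨⟨X', hX'⟩, J, f, g, h⟩)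
    (fun X' => by
      obtain ⟨X, J, f, g, h, hX⟩ := hdn X'.1 X'.2
      exact ⟨⟨X, hX⟩, J, f, g, h⟩) ⟨X, hX⟩
  choose J f g h using hc
  choose ε hε using fun i => HMod.exists_finsuppEquiv ρ (W k Λ) (J i)
  let η := fun i => Finsupp.mapRange.linearEquiv (α := J i) e ≪≫ₗ ε i
  obtain ⟨L, _, _, hL, ⟨e'⟩⟩ := hρ.exists_of_chain D (X := fun i => (c i).1) (J := J)
    (fun i => (η i).toLinearMap ∘ₗ f i) (fun i => g i ∘ₗ (η i).symm.toLinearMap)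
    (fun i => ⟨(η i).injective.comp (h i).inj, (h i).surj.comp (η i).symm.surjective, fun y => by
      rw [LinearMap.comp_apply, (h i).exact]
      exact exists_congr fun x => (η i).eq_symm_apply⟩)
    (fun i => (h1 _ (c i).2).congr_left e) (fun i => (h2 _ (c i).2).congr_right e)
  rw [h0] at e'
  exact ⟨L, _, _, hL, ⟨e'⟩⟩

end HFull

end Full


/-! ## The inverse Nakayama functor -/

section Nakayama

variable (k Λ : Type) [Field k] [Ring Λ] [Algebra k Λ]

/-- The right action of `Λ` on its dual. -/
def rightAct : Λ →+* (Module.End Λ (W k Λ))ᵐᵒᵖ where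
  toFun x := MulOpposite.op
    { toFun := fun φ => DualMod.mk _ ((φ : Λ →ₗ[k] k) ∘ₗ LinearMap.mulLeft k x)
      map_add' := fun _ _ => DualMod.ext fun _ => rfl
      map_smul' := fun y φ => DualMod.ext fun z => congrArg φ (mul_assoc x z y) }
  map_one' := MulOpposite.unop_injective (LinearMap.ext fun φ => DualMod.ext fun y =>
    congrArg φ (one_mul y))
  map_mul' x y := MulOpposite.unop_injective (LinearMap.ext fun φ => DualMod.ext fun z =>
    congrArg φ (mul_assoc x y z))
  map_zero' := MulOpposite.unop_injective (LinearMap.ext fun φ => DualMod.ext fun y =>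
    (congrArg φ (zero_mul y)).trans (map_zero φ))
  map_add' x y := MulOpposite.unop_injective (LinearMap.ext fun φ => DualMod.ext fun z =>
    (congrArg φ (add_mul x y z)).trans (map_add φ _ _))

variable {k Λ}

lemma rightAct_apply (x : Λ) (φ : W k Λ) (y : Λ) : (rightAct k Λ x).unop φ y = φ (x * y) := rfl

/-- The inverse Nakayama functor. -/
abbrev Nak (k Λ : Type) [Field k] [Ring Λ] [Algebra k Λ] (V : Type) [AddCommGroup V]
    [Module Λ V] : Type := HMod (rightAct k Λ) V

/-- The free generator of `Hom(W, W)`. -/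
def nakOne (k Λ : Type) [Field k] [Ring Λ] [Algebra k Λ] : Nak k Λ (W k Λ) :=
  HMod.mk _ LinearMap.id

lemma smul_nakOne_apply (x : Λ) (φ : W k Λ) (y : Λ) : (x • nakOne k Λ) φ y = φ (x * y) := rfl

variable [FiniteDimensional k Λ]

lemma exists_eq_smul_nakOne (ξ : Nak k Λ (W k Λ)) : ∃ x : Λ, ξ = x • nakOne k Λ := by
  obtain ⟨x, hx⟩ := (Module.evalEquiv k Λ).surjective (ofW (k := k) (V := W k Λ) ξ.hom)
  have hx' : ∀ φ : W k Λ, φ x = ξ φ 1 := fun φ => LinearMap.congr_fun hx φ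
  refine ⟨x, HMod.ext fun φ => DualMod.ext fun y => ?_⟩
  have h1 := hx' (y • φ)
  rw [map_smul, W.smul_apply', W.smul_apply', one_mul] at h1
  rw [smul_nakOne_apply, h1]

variable (k Λ) in
/-- `Hom(W, W)` is free of rank one. -/
noncomputable def nakEquiv : Λ ≃ₗ[Λ] Nak k Λ (W k Λ) :=
  LinearEquiv.ofBijective (LinearMap.toSpanSingleton Λ _ (nakOne k Λ)) ⟨by
    rw [← LinearMap.ker_eq_bot, LinearMap.ker_eq_bot']
    intro x hx
    refine (Module.forall_dual_apply_eq_zero_iff k x).1 fun φ => ?_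
    have := DFunLike.congr_fun (DFunLike.congr_fun hx (DualMod.mk _ φ : W k Λ)) (1 : Λ)
    exact (congrArg φ (mul_one x)).symm.trans this, fun ξ => by
    obtain ⟨x, rfl⟩ := exists_eq_smul_nakOne ξ
    exact ⟨x, rfl⟩⟩

variable (k Λ) in
lemma hFull_rightAct : HFull k (rightAct k Λ) where
  retract := ⟨1, Finsupp.lsingle 0, Finsupp.lapply 0, fun x => by simp⟩
  faithful V _ _ g hg := LinearMap.ext fun φ =>
    DFunLike.congr_fun (LinearMap.congr_fun hg (nakOne k Λ)) φ
  full V _ _ f := by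
    refine ⟨(f (nakOne k Λ)).hom, LinearMap.ext fun ξ => ?_⟩
    obtain ⟨x, rfl⟩ := exists_eq_smul_nakOne ξ
    rw [map_smul, map_smul]
    rfl

/-- The Nakayama functor on free injectives. -/
lemma exists_nak_basis (n : ℕ) : ∃ b : Module.Basis (Fin n) Λ (Nak k Λ (Fin n →₀ W k Λ)),
    ∀ j, b j = HMod.mk _ (Finsupp.lsingle j) := by
  obtain ⟨e, he⟩ := HMod.exists_finsuppEquiv (rightAct k Λ) (W k Λ) (Fin n)
  refine ⟨.ofRepr (Finsupp.mapRange.linearEquiv (nakEquiv k Λ) ≪≫ₗ e).symm, fun j => ?_⟩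
  rw [Module.Basis.coe_ofRepr]
  simp only [LinearEquiv.symm_symm, LinearEquiv.trans_apply, Finsupp.mapRange.linearEquiv_apply,
    Finsupp.mapRange_single, he]
  ext φ : 1
  simp [nakEquiv, nakOne]

instance nak_projective (J : Type) : Module.Projective Λ (Nak k Λ (J →₀ W k Λ)) := by
  obtain ⟨e, -⟩ := HMod.exists_finsuppEquiv (rightAct k Λ) (W k Λ) J
  exact Module.Projective.of_equiv (Finsupp.mapRange.linearEquiv (nakEquiv k Λ) ≪≫ₗ e)

instance nak_finite (L : Type) [AddCommGroup L] [Module Λ L] [Module.Finite Λ L] :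
    Module.Finite Λ (Nak k Λ L) := by
  have : IsNoetherianRing Λ := IsNoetherianRing.of_finite k Λ
  obtain ⟨n, f, hf⟩ := exists_fin_W_embedding k (Λ := Λ) L
  let f' := (Finsupp.linearEquivFunOnFinite Λ (W k Λ) (Fin n)).symm.toLinearMap ∘ₗ f
  obtain ⟨b, -⟩ := exists_nak_basis (k := k) (Λ := Λ) n
  have := Module.Finite.of_basis b
  exact Module.Finite.of_injective (HMod.map _ f') (HMod.injective_map
    ((Finsupp.linearEquivFunOnFinite Λ (W k Λ) (Fin n)).symm.injective.comp hf))

end Nakayama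

/-! ## Finite approximations of finitely generated Gorenstein-injective modules -/

section FiniteApprox

variable {k Λ : Type} [Field k] [Ring Λ] [Algebra k Λ] [FiniteDimensional k Λ] {D : DomData k Λ}
variable {L V : Type} [AddCommGroup L] [Module Λ L] [AddCommGroup V] [Module Λ V]

lemma GI.exists_finite_coker (hL : GI D L) [Module.Finite Λ L] :
    ∃ (n : ℕ) (C : Type) (_ : AddCommGroup C) (_ : Module Λ C) (f : L →ₗ[Λ] (Fin n →₀ W k Λ))
      (g : (Fin n →₀ W k Λ) →ₗ[Λ] C), SES f g ∧ GI D C ∧ Module.Finite Λ C := by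
  obtain ⟨n, f, hf⟩ := exists_fin_W_embedding k (Λ := Λ) L
  let f' := (Finsupp.linearEquivFunOnFinite Λ (W k Λ) (Fin n)).symm.toLinearMap ∘ₗ f
  obtain ⟨C, _, _, g, h⟩ := exists_ses_of_injective f'
    ((Finsupp.linearEquivFunOnFinite Λ (W k Λ) (Fin n)).symm.injective.comp hf)
  exact ⟨n, C, _, _, f', g, h, hL.coker h, Module.Finite.of_surjective g h.surj⟩

lemma GI.exists_finite_ker (hL : GI D L) [Module.Finite Λ L] :
    ∃ (n : ℕ) (K : Type) (_ : AddCommGroup K) (_ : Module Λ K) (f : K →ₗ[Λ] (Fin n →₀ W k Λ))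
      (g : (Fin n →₀ W k Λ) →ₗ[Λ] L), SES f g ∧ GI D K ∧ Module.Finite Λ K := by
  have : IsNoetherianRing Λ := IsNoetherianRing.of_finite k Λ
  obtain ⟨n, ξ, hξ⟩ := Module.Finite.exists_fin (R := Λ) (M := Nak k Λ L)
  let q : (Fin n →₀ W k Λ) →ₗ[Λ] L := Finsupp.lsum ℕ fun i => (ξ i).hom
  have hq : ∀ u : W k Λ →ₗ[Λ] L, ∃ v : W k Λ →ₗ[Λ] (Fin n →₀ W k Λ), ∀ x, q (v x) = u x := by
    intro u
    have hu : HMod.mk (rightAct k Λ) u ∈ Submodule.span Λ (Set.range ξ) := hξ ▸ Submodule.mem_top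
    obtain ⟨c, hc⟩ := (Submodule.mem_span_range_iff_exists_fun Λ).1 hu
    refine ⟨∑ i, Finsupp.lsingle i ∘ₗ (rightAct k Λ (c i)).unop, fun x => ?_⟩
    have hsum : ∀ (s : Finset (Fin n)) x, (∑ i ∈ s, c i • ξ i) x =
        ∑ i ∈ s, ξ i ((rightAct k Λ (c i)).unop x) := fun s x => by
      induction s using Finset.cons_induction with
      | empty => simp
      | cons a s ha ih => rw [Finset.sum_cons, Finset.sum_cons, HMod.add_apply, ih]; rfl
    have h1 := DFunLike.congr_fun hc x
    rw [HMod.mk_apply, hsum] at h1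
    rw [← h1, LinearMap.sum_apply, map_sum]
    simp [q]
  obtain ⟨J, _, _, _, _, p, hp, -⟩ := hL.exists_cover
  have hqs : Function.Surjective q := by
    rw [← LinearMap.range_eq_top, eq_top_iff]
    rintro x -
    obtain ⟨y, rfl⟩ := hp.surj x
    induction y using Finsupp.induction_linear with
    | zero => rw [map_zero]; exact Submodule.zero_mem _
    | add x y hx hy => rw [map_add]; exact Submodule.add_mem _ hx hy
    | single j w =>
      obtain ⟨v, hv⟩ := hq (p ∘ₗ Finsupp.lsingle j)
      exact ⟨v w, hv w⟩
  obtain ⟨K, _, _, f, hf⟩ := exists_ses_of_surjective q hqs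
  exact ⟨n, K, _, _, f, q, hf, hL.ker hf hq, Module.Finite.of_injective f hf.inj⟩

end FiniteApprox

/-! ## Duality between the two orthogonality conditions -/

section Duality

variable {k Λ : Type} [Field k] [Ring Λ] [Algebra k Λ] [FiniteDimensional k Λ] {D : DomData k Λ}
variable {V : Type} [AddCommGroup V] [Module Λ V] [Module k V] [IsScalarTower k Λ V]

/-- The functional on `Vⁿ` attached to a homomorphism `V → Wⁿ`. -/
noncomputable def pairing {n : ℕ} (u : V →ₗ[Λ] (Fin n →₀ W k Λ)) : (Fin n → V) →ₗ[k] k :=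
  ∑ j, ofW (k := k) (Finsupp.lapply j ∘ₗ u) ∘ₗ LinearMap.proj j

lemma pairing_apply {n : ℕ} (u : V →ₗ[Λ] (Fin n →₀ W k Λ)) (v : Fin n → V) :
    pairing u v = ∑ j, u (v j) j 1 := by
  simp [pairing, ofW_apply]

lemma pairing_injective {n : ℕ} :
    Function.Injective (pairing : (V →ₗ[Λ] (Fin n →₀ W k Λ)) → ((Fin n → V) →ₗ[k] k)) := by
  classical
  intro u u' h
  refine LinearMap.ext fun v => Finsupp.ext fun j => DualMod.ext fun x => ?_
  have key : ∀ u : V →ₗ[Λ] (Fin n →₀ W k Λ), pairing u (Pi.single j (x • v)) = u v j x := by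
    intro u
    rw [pairing_apply, Finset.sum_eq_single j]
    · rw [Pi.single_eq_same, map_smul, Finsupp.smul_apply, W.smul_apply', one_mul]
    · intro i _ hi
      rw [Pi.single_eq_of_ne hi]
      simp
    · simp
  rw [← key, h, key]

lemma pairing_surjective {n : ℕ} :
    Function.Surjective (pairing : (V →ₗ[Λ] (Fin n →₀ W k Λ)) → ((Fin n → V) →ₗ[k] k)) := by
  classical
  intro ξ
  refine ⟨∑ j, Finsupp.lsingle j ∘ₗ toW (ξ ∘ₗ LinearMap.single k (fun _ => V) j),
    LinearMap.ext fun v => ?_⟩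
  rw [pairing_apply]
  have : ∀ j, (∑ i, Finsupp.lsingle i ∘ₗ toW (Λ := Λ) (ξ ∘ₗ LinearMap.single k (fun _ => V) i))
      (v j) j = toW (Λ := Λ) (ξ ∘ₗ LinearMap.single k (fun _ => V) j) (v j) := fun j => by
    rw [LinearMap.sum_apply, Finsupp.finsetSum_apply, Finset.sum_eq_single j]
    · simp
    · intro i _ hi
      simp [hi]
    · simp
  simp only [this, toW_apply, one_smul, LinearMap.comp_apply]
  rw [← map_sum]
  exact congrArg ξ (Finset.univ_sum_single v)

/-- The transpose of a map between free injectives, acting on powers of `V`. -/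
noncomputable def transpose {a b : ℕ} (α : (Fin a →₀ W k Λ) →ₗ[Λ] (Fin b →₀ W k Λ)) (V : Type)
    [AddCommGroup V] [Module Λ V] [Module k V] [IsScalarTower k Λ V] :
    (Fin b → V) →ₗ[k] (Fin a → V) :=
  LinearMap.pi fun i => ∑ j,
    (Module.toModuleEnd k (S := Λ) V (exists_eq_smul_nakOne
      (HMod.mk _ (Finsupp.lapply j ∘ₗ α ∘ₗ Finsupp.lsingle i))).choose) ∘ₗ LinearMap.proj j

lemma exists_transpose {a b : ℕ} (α : (Fin a →₀ W k Λ) →ₗ[Λ] (Fin b →₀ W k Λ)) :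
    ∃ r : Fin b → Fin a → Λ, (∀ j i φ x, α (Finsupp.single i φ) j x = φ (r j i * x)) ∧
      ∀ v i, transpose α V v i = ∑ j, r j i • v j := by
  refine ⟨fun j i => (exists_eq_smul_nakOne
      (HMod.mk _ (Finsupp.lapply j ∘ₗ α ∘ₗ Finsupp.lsingle i))).choose, fun j i φ x => ?_,
      fun v i => ?_⟩
  · have := (exists_eq_smul_nakOne
      (HMod.mk _ (Finsupp.lapply j ∘ₗ α ∘ₗ Finsupp.lsingle i))).choose_spec
    exact DFunLike.congr_fun (DFunLike.congr_fun this φ) x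
  · simp [transpose]

lemma pairing_comp {a b : ℕ} (α : (Fin a →₀ W k Λ) →ₗ[Λ] (Fin b →₀ W k Λ))
    (u : V →ₗ[Λ] (Fin a →₀ W k Λ)) : pairing (α ∘ₗ u) = pairing u ∘ₗ transpose α V := by
  obtain ⟨r, hr, hr'⟩ := exists_transpose (V := V) α
  refine LinearMap.ext fun v => ?_
  rw [LinearMap.comp_apply, pairing_apply, pairing_apply]
  have h1 : ∀ (w : Fin a →₀ W k Λ) j, α w j 1 = ∑ i, w i (r j i) := fun w j => by
    induction w using Finsupp.induction_linear with
    | zero => simp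
    | add x y hx hy =>
      rw [map_add, Finsupp.add_apply, DualMod.add_apply, hx, hy, ← Finset.sum_add_distrib]
      rfl
    | single i φ =>
      rw [hr, Finset.sum_eq_single i]
      · simp
      · intro i' _ hi'
        rw [Finsupp.single_eq_of_ne hi']; rfl
      · simp
  simp only [LinearMap.comp_apply, h1, hr', map_sum, Finsupp.finsetSum_apply, DualMod.sum_apply,
    map_smul, Finsupp.smul_apply, W.smul_apply', one_mul]
  exact Finset.sum_comm

/-- Evaluation at the standard basis of `Hom(W, Wⁿ)`. -/
lemma eval_comp_map {a b : ℕ} (α : (Fin a →₀ W k Λ) →ₗ[Λ] (Fin b →₀ W k Λ))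
    (t : Nak k Λ (Fin b →₀ W k Λ) →ₗ[Λ] V) (i : Fin a) :
    t (HMod.map _ α (HMod.mk _ (Finsupp.lsingle i))) =
      transpose α V (fun j => t (HMod.mk _ (Finsupp.lsingle j))) i := by
  obtain ⟨r, hr, hr'⟩ := exists_transpose (V := V) α
  rw [hr']
  simp only [← map_smul, ← map_sum]
  congr 1
  refine HMod.ext fun φ => Finsupp.ext fun j => DualMod.ext fun x => ?_
  have hsum : ∀ (s : Finset (Fin b)), (∑ j ∈ s, r j i •
      (HMod.mk (rightAct k Λ) (Finsupp.lsingle j) : Nak k Λ (Fin b →₀ W k Λ))) φ =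
        ∑ j ∈ s, Finsupp.single j ((rightAct k Λ (r j i)).unop φ) := fun s => by
    induction s using Finset.cons_induction with
    | empty => simp
    | cons a s ha ih => rw [Finset.sum_cons, Finset.sum_cons, HMod.add_apply, ih]; rfl
  rw [hsum, Finsupp.finsetSum_apply, Finset.sum_eq_single j]
  · rw [Finsupp.single_eq_same, rightAct_apply]
    exact hr j i φ x
  · intro j' _ hj'
    exact Finsupp.single_eq_of_ne (Ne.symm hj')
  · simp

lemma exists_functional_iff {X Y Z : Type} [AddCommGroup X] [AddCommGroup Y] [AddCommGroup Z]
    [Module k X] [Module k Y] [Module k Z] (f : X →ₗ[k] Y) (g : Y →ₗ[k] Z)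
    (hgf : g ∘ₗ f = 0) :
    (∀ η : Y →ₗ[k] k, η ∘ₗ f = 0 → ∃ ξ : Z →ₗ[k] k, ξ ∘ₗ g = η) ↔
      ∀ y, g y = 0 → ∃ x, f x = y := by
  have h1 : LinearMap.range f ≤ LinearMap.ker g := by
    rintro _ ⟨x, rfl⟩
    exact LinearMap.congr_fun hgf x
  constructor
  · intro h y hy
    by_contra hn
    obtain ⟨η, hη, hη'⟩ := Submodule.exists_le_ker_of_notMem (p := LinearMap.range f) (v := y) hn
    obtain ⟨ξ, rfl⟩ := h η (LinearMap.ext fun x => hη' ⟨x, rfl⟩)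
    exact hη (by rw [LinearMap.comp_apply, hy, map_zero])
  · intro h η hη
    have : η ∈ LinearMap.range g.dualMap := by
      rw [LinearMap.range_dualMap_eq_dualAnnihilator_ker, Submodule.mem_dualAnnihilator]
      intro y hy
      obtain ⟨x, rfl⟩ := h y hy
      exact LinearMap.congr_fun hη x
    obtain ⟨ξ, hξ⟩ := this
    exact ⟨ξ, hξ⟩

end Duality

section DualExt

variable {k Λ : Type} [Field k] [Ring Λ] [Algebra k Λ] [FiniteDimensional k Λ] {D : DomData k Λ}
variable {V : Type} [AddCommGroup V] [Module Λ V]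
variable {L₀ L₁ L₂ L₃ : Type} [AddCommGroup L₀] [Module Λ L₀] [AddCommGroup L₁] [Module Λ L₁]
  [AddCommGroup L₂] [Module Λ L₂] [AddCommGroup L₃] [Module Λ L₃]

/-- Extensions of `V` by `L₀` are dual to extensions of `ν⁻ L₃` by `V`, for finitely generated
Gorenstein-injective modules. -/
lemma ext1_iff_ext1_nak {a b c : ℕ}
    {f₀ : L₀ →ₗ[Λ] (Fin a →₀ W k Λ)} {g₀ : (Fin a →₀ W k Λ) →ₗ[Λ] L₁}
    {f₁ : L₁ →ₗ[Λ] (Fin b →₀ W k Λ)} {g₁ : (Fin b →₀ W k Λ) →ₗ[Λ] L₂}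
    {f₂ : L₂ →ₗ[Λ] (Fin c →₀ W k Λ)} {g₂ : (Fin c →₀ W k Λ) →ₗ[Λ] L₃}
    (h₀ : SES f₀ g₀) (h₁ : SES f₁ g₁) (h₂ : SES f₂ g₂)
    (hL₀ : GI D L₀) (hL₁ : GI D L₁) (hL₂ : GI D L₂) :
    Ext1 Λ V L₀ ↔ Ext1 Λ (Nak k Λ L₃) V := by
  obtain ⟨_, _⟩ := exists_tower k Λ V
  let α := f₁ ∘ₗ g₀
  let β := f₂ ∘ₗ g₁
  have hρ := hFull_rightAct k Λ
  have n₀ := hρ.ses hL₀ h₀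
  have n₁ := hρ.ses hL₁ h₁
  have n₂ := hρ.ses hL₂ h₂
  obtain ⟨ba, hba⟩ := exists_nak_basis (k := k) (Λ := Λ) a
  obtain ⟨bb, hbb⟩ := exists_nak_basis (k := k) (Λ := Λ) b
  obtain ⟨bc, hbc⟩ := exists_nak_basis (k := k) (Λ := Λ) c
  have hcomp : transpose α V ∘ₗ transpose β V = 0 := by
    refine LinearMap.ext fun v => funext fun i => ?_
    let t := bc.constr ℕ v
    have ht : (fun j => t (HMod.mk _ (Finsupp.lsingle j))) = v := funext fun j => by
      rw [← hbc]; simp [t]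
    have e1 : transpose β V v = fun j => (t ∘ₗ HMod.map _ β) (HMod.mk _ (Finsupp.lsingle j)) :=
      funext fun j => by rw [LinearMap.comp_apply, eval_comp_map, ht]
    rw [LinearMap.comp_apply, e1, ← eval_comp_map, LinearMap.comp_apply]
    have : HMod.map (rightAct k Λ) β (HMod.map _ α (HMod.mk _ (Finsupp.lsingle i))) = 0 :=
      HMod.ext fun φ => by simp [α, β, h₁.apply_apply]
    rw [this, map_zero]
    rfl
  have key := exists_functional_iff (transpose β V) (transpose α V) hcomp
  have hleft : Ext1 Λ V L₀ ↔ ∀ η : (Fin b → V) →ₗ[k] k, η ∘ₗ transpose β V = 0 →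
      ∃ ξ : (Fin a → V) →ₗ[k] k, ξ ∘ₗ transpose α V = η := by
    constructor
    · intro h η hη
      obtain ⟨u, rfl⟩ := pairing_surjective (Λ := Λ) η
      rw [← pairing_comp] at hη
      have hu : β ∘ₗ u = 0 := pairing_injective (hη.trans (by ext; simp [pairing_apply]))
      obtain ⟨u', hu'⟩ := h₁.lift u fun x =>
        h₂.inj ((LinearMap.congr_fun hu x).trans (map_zero _).symm)
      obtain ⟨w, hw⟩ := h.lift h₀ u'
      refine ⟨pairing w, ?_⟩
      rw [← pairing_comp]
      congr 1
      ext x : 1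
      simp [α, hw, hu']
    · intro h
      refine .of_coresolution h₀ .of_injective fun u => ?_
      obtain ⟨ξ, hξ⟩ := h (pairing (f₁ ∘ₗ u)) (by
        rw [← pairing_comp]
        ext
        simp [pairing_apply, β, h₁.apply_apply])
      obtain ⟨w, rfl⟩ := pairing_surjective (Λ := Λ) ξ
      rw [← pairing_comp] at hξ
      exact ⟨w, fun x => h₁.inj (LinearMap.congr_fun (pairing_injective hξ) x)⟩
  have hright : Ext1 Λ (Nak k Λ L₃) V ↔ ∀ y, transpose α V y = 0 → ∃ x, transpose β V x = y := by
    constructor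
    · intro h y hy
      let t := bb.constr ℕ y
      have ht : (fun j => t (HMod.mk _ (Finsupp.lsingle j))) = y := funext fun j => by
        rw [← hbb]; simp [t]
      have h0 : t ∘ₗ HMod.map _ α = 0 := ba.ext fun i => by
        rw [LinearMap.comp_apply, hba, eval_comp_map, ht, hy]; rfl
      obtain ⟨s, hs⟩ := n₁.desc t (fun ξ => by
        obtain ⟨η, rfl⟩ := n₀.surj ξ
        exact LinearMap.congr_fun h0 η)
      obtain ⟨w, hw⟩ := h n₂ s
      refine ⟨fun j => w (HMod.mk _ (Finsupp.lsingle j)), funext fun j => ?_⟩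
      rw [← eval_comp_map, ← ht]
      exact (hw _).trans (hs _)
    · intro h
      refine .of_resolution n₂ .of_projective fun u => ?_
      let t := u ∘ₗ HMod.map _ g₁
      obtain ⟨x, hx⟩ := h (fun j => t (HMod.mk _ (Finsupp.lsingle j))) (funext fun i => by
        rw [← eval_comp_map]
        have : HMod.map (rightAct k Λ) g₁ (HMod.map _ α (HMod.mk _ (Finsupp.lsingle i))) = 0 :=
          HMod.ext fun φ => by simp [α, h₁.apply_apply]
        rw [LinearMap.comp_apply, this, map_zero]
        rfl)
      let w := bc.constr ℕ x
      have hw : (fun j => w (HMod.mk _ (Finsupp.lsingle j))) = x := funext fun j => by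
        rw [← hbc]; simp [w]
      have h0 : w ∘ₗ HMod.map _ β = t := bb.ext fun i => by
        rw [LinearMap.comp_apply, hbb, eval_comp_map, hw, hx]
      refine ⟨w, fun ξ => ?_⟩
      obtain ⟨η, rfl⟩ := n₁.surj ξ
      exact LinearMap.congr_fun h0 η
  rw [hleft, key, hright]

/-- Finite generation of the Gorenstein-injective modules forces the two orthogonal classes to
agree. -/
lemma FGGen.perp_iff (hD : FGGen D) (V : Type) [AddCommGroup V] [Module Λ V] :
    (∀ (L : Type) [AddCommGroup L] [Module Λ L], GI D L → Ext1 Λ (Nak k Λ L) V) ↔ PerpGI D V := by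
  obtain ⟨L₀, _, _, _, hL₀, hgen⟩ := hD
  constructor
  · intro h
    obtain ⟨a, L₁, _, _, f₀, g₀, h₀, hL₁, _⟩ := hL₀.exists_finite_coker
    obtain ⟨b, L₂, _, _, f₁, g₁, h₁, hL₂, _⟩ := hL₁.exists_finite_coker
    obtain ⟨c, L₃, _, _, f₂, g₂, h₂, hL₃, _⟩ := hL₂.exists_finite_coker
    have hV : Ext1 Λ V L₀ := (ext1_iff_ext1_nak h₀ h₁ h₂ hL₀ hL₁ hL₂).2 (h L₃ hL₃)
    intro L _ _ hL
    refine hgen (fun L _ _ => Ext1 Λ V L) ⟨fun X Y _ _ _ _ hr hY => hY.retract_right hr,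
      fun X Y Z _ _ _ _ _ _ f g hs hX hZ => .ext_right hs hX hZ⟩ ?_ ?_ L hL
    · exact fun J => (Ext1.pi_right fun _ => hV).retract_right (finsupp_retract_pi k Λ L₀ J)
    · exact fun J => .of_injective
  · intro hV L _ _ hL
    have hρ := hFull_rightAct k Λ
    obtain ⟨c, L₁, _, _, f₂, g₂, h₂, hL₁, _⟩ := hL₀.exists_finite_ker
    obtain ⟨b, L₂, _, _, f₁, g₁, h₁, hL₂, _⟩ := hL₁.exists_finite_ker
    obtain ⟨a, L₃, _, _, f₀, g₀, h₀, hL₃, _⟩ := hL₂.exists_finite_ker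
    have hV' : Ext1 Λ (Nak k Λ L₀) V :=
      (ext1_iff_ext1_nak h₀ h₁ h₂ hL₃ hL₂ hL₁).1 (hV L₃ hL₃)
    refine (hgen (fun L _ _ => GI D L ∧ Ext1 Λ (Nak k Λ L) V)
      ⟨fun X Y _ _ _ _ hr hY => ⟨hY.1.retract hr, hY.2.retract_left (HMod.retract hr)⟩,
        fun X Y Z _ _ _ _ _ _ f g hs hX hZ =>
          ⟨.ext hs hX.1 hZ.1, .ext_left (hρ.ses hX.1 hs) hX.2 hZ.2⟩⟩ ?_ ?_ L hL).2
    · intro J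
      obtain ⟨e, -⟩ := HMod.exists_finsuppEquiv (rightAct k Λ) L₀ J
      exact ⟨hL₀.finsupp J, (hV'.finsupp_left J).congr_left e⟩
    · exact fun J => ⟨.of_injective, .of_projective⟩

end DualExt


/-! ## The functor `Hom(DM, -)` attached to a generator -/

section Psi

variable (k A M : Type) [Field k] [Ring A] [Algebra k A] [AddCommGroup M] [Module A M]
  [Module k M] [IsScalarTower k A M]

/-- The opposite of the endomorphism ring of `M`. -/
abbrev EndOp (A M : Type) [Ring A] [AddCommGroup M] [Module A M] : Type := (Module.End A M)ᵐᵒᵖ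

instance endOp_finite [FiniteDimensional k A] [Module.Finite A M] :
    FiniteDimensional k (EndOp A M) := by
  have := finite_tower k A M
  have : Module.Finite k (Module.End A M) :=
    Module.Finite.of_injective (LinearMap.restrictScalarsₗ k A M M k)
      (LinearMap.restrictScalars_injective k)
  exact Module.Finite.equiv (MulOpposite.opLinearEquiv k)

/-- The right action of `EndOp A M` on the underlying vector space of `M`. -/
def dualAct : EndOp A M →+* (Module.End k M)ᵐᵒᵖ where
  toFun f := MulOpposite.op (f.unop.restrictScalars k)
  map_one' := rfl
  map_mul' _ _ := rfl
  map_zero' := rfl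
  map_add' _ _ := rfl

/-- The dual of `M`, as a module over its endomorphism ring. -/
abbrev DM : Type := DualMod (dualAct k A M)

variable {k A M} in
lemma DM.smul_apply (f : EndOp A M) (ξ : DM k A M) (m : M) : (f • ξ) m = ξ (f.unop m) := rfl

/-- The right action of `A` on the dual of `M`. -/
def psiAct : A →+* (Module.End (EndOp A M) (DM k A M))ᵐᵒᵖ where
  toFun a := MulOpposite.op
    { toFun := fun ξ => DualMod.mk _ ((ξ : M →ₗ[k] k) ∘ₗ Module.toModuleEnd k (S := A) M a)
      map_add' := fun _ _ => DualMod.ext fun _ => rfl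
      map_smul' := fun f ξ => DualMod.ext fun m => congrArg ξ (f.unop.map_smul a m) }
  map_one' := MulOpposite.unop_injective (LinearMap.ext fun ξ => DualMod.ext fun m =>
    congrArg ξ (one_smul A m))
  map_mul' x y := MulOpposite.unop_injective (LinearMap.ext fun ξ => DualMod.ext fun m =>
    congrArg ξ (mul_smul x y m))
  map_zero' := MulOpposite.unop_injective (LinearMap.ext fun ξ => DualMod.ext fun m =>
    (congrArg ξ (zero_smul A m)).trans (map_zero ξ))
  map_add' x y := MulOpposite.unop_injective (LinearMap.ext fun ξ => DualMod.ext fun m =>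
    (congrArg ξ (add_smul x y m)).trans (map_add ξ _ _))

variable {k A M} in
lemma psiAct_apply (a : A) (ξ : DM k A M) (m : M) : (psiAct k A M a).unop ξ m = ξ (a • m) := rfl

/-- The functor `Hom(DM, -)`. -/
abbrev Psi (V : Type) [AddCommGroup V] [Module (EndOp A M) V] : Type := HMod (psiAct k A M) V

variable {k A M} in
/-- Evaluation at an element of `M`. -/
def evalM (m : M) : DM k A M →ₗ[EndOp A M] W k (EndOp A M) where
  toFun ξ := DualMod.mk _ ((ξ : M →ₗ[k] k) ∘ₗ
    { toFun := fun f => f.unop m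
      map_add' := fun _ _ => rfl
      map_smul' := fun _ _ => rfl })
  map_add' _ _ := DualMod.ext fun _ => rfl
  map_smul' _ _ := DualMod.ext fun _ => rfl

variable {k A M} in
lemma evalM_apply (m : M) (ξ : DM k A M) (f : EndOp A M) : evalM m ξ f = ξ (f.unop m) := rfl

/-- The canonical map `M → Hom(DM, W)`. -/
def evalHom : M →ₗ[A] Psi k A M (W k (EndOp A M)) where
  toFun m := HMod.mk _ (evalM m)
  map_add' m n := HMod.ext fun ξ => DualMod.ext fun f => by
    rw [HMod.add_apply, DualMod.add_apply]
    simp only [HMod.mk_apply, evalM_apply, map_add]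
  map_smul' a m := HMod.ext fun ξ => DualMod.ext fun f => by
    rw [HMod.mk_apply, evalM_apply, map_smul]
    rfl

variable {k A M} in
lemma evalHom_apply (m : M) (ξ : DM k A M) : evalHom k A M m ξ = evalM m ξ := rfl

/-- Rank one endomorphisms of a generator. -/
def rankOne (b : M →ₗ[A] A) (m : M) : EndOp A M := MulOpposite.op (LinearMap.smulRight b m)

/-- The map `W → DM` attached to a linear form on `M`. -/
def coevalM (b : M →ₗ[A] A) : W k (EndOp A M) →ₗ[EndOp A M] DM k A M where
  toFun φ := DualMod.mk _ ((φ : EndOp A M →ₗ[k] k) ∘ₗ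
    { toFun := fun m => rankOne A M b m
      map_add' := fun m n => MulOpposite.unop_injective (LinearMap.ext fun x => by
        simp [rankOne])
      map_smul' := fun c m => MulOpposite.unop_injective (LinearMap.ext fun x => by
        exact smul_comm (b x) c m) })
  map_add' _ _ := DualMod.ext fun _ => rfl
  map_smul' f φ := DualMod.ext fun m => congrArg φ (MulOpposite.unop_injective
    (LinearMap.ext fun x => f.unop.map_smul (b x) m))

lemma coevalM_apply (b : M →ₗ[A] A) (φ : W k (EndOp A M)) (m : M) :
    coevalM k A M b φ m = φ (rankOne A M b m) := rfl

variable [FiniteDimensional k A] [Module.Finite A M]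

/-- `M` is the value of `Psi` at the injective cogenerator. -/
noncomputable def evalEquiv : M ≃ₗ[A] Psi k A M (W k (EndOp A M)) :=
  LinearEquiv.ofBijective (evalHom k A M) ⟨by
    rw [← LinearMap.ker_eq_bot, LinearMap.ker_eq_bot']
    intro m hm
    refine (Module.forall_dual_apply_eq_zero_iff k m).1 fun ξ => ?_
    exact DFunLike.congr_fun (DFunLike.congr_fun hm (DualMod.mk _ ξ : DM k A M)) (1 : EndOp A M),
    fun η => by
    have := finite_tower k A M
    let ζ : Module.Dual k (Module.Dual k M) :=
      { toFun := fun ξ => η (DualMod.mk (dualAct k A M) ξ) 1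
        map_add' := fun ξ ξ' => by
          change η (DualMod.mk (dualAct k A M) ξ + DualMod.mk (dualAct k A M) ξ') 1 = _
          rw [map_add, DualMod.add_apply]
        map_smul' := fun c ξ => by
          have h : DualMod.mk (dualAct k A M) (c • ξ) =
              algebraMap k (EndOp A M) c • DualMod.mk (dualAct k A M) ξ :=
            DualMod.ext fun m => by
              rw [DM.smul_apply]
              simp [Algebra.algebraMap_eq_smul_one]
          rw [h, map_smul, W.smul_apply', one_mul, Algebra.algebraMap_eq_smul_one, map_smul]
          rfl }
    obtain ⟨m, hm⟩ := (Module.evalEquiv k M).surjective ζ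
    have hm' : ∀ ξ : DM k A M, ξ m = η ξ 1 := fun ξ => LinearMap.congr_fun hm ξ
    refine ⟨m, HMod.ext fun ξ => DualMod.ext fun f => ?_⟩
    rw [evalHom_apply, evalM_apply, ← DM.smul_apply, hm', map_smul, W.smul_apply', one_mul]⟩

variable {A M} in
lemma exists_sum_evalM {n : ℕ} (m : Fin n → M) (hm : Submodule.span A (Set.range m) = ⊤)
    (w : W k (EndOp A M)) : ∃ ξ : Fin n → DM k A M, ∑ j, evalM (m j) (ξ j) = w := by
  classical
  let ι : EndOp A M →ₗ[k] (Fin n → M) :=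
    { toFun := fun f j => f.unop (m j)
      map_add' := fun _ _ => rfl
      map_smul' := fun _ _ => rfl }
  have hι : Function.Injective ι := fun f g h => MulOpposite.unop_injective
    (LinearMap.ext_on_range hm fun j => congrFun h j)
  obtain ⟨ζ, hζ⟩ := LinearMap.dualMap_surjective_of_injective hι w
  refine ⟨fun j => DualMod.mk _ (ζ ∘ₗ LinearMap.single k (fun _ => M) j), DualMod.ext fun f => ?_⟩
  rw [DualMod.sum_apply, ← hζ]
  simp only [evalM_apply, DualMod.mk_apply, LinearMap.comp_apply]
  rw [← map_sum]
  exact congrArg ζ (Finset.univ_sum_single fun j => f.unop (m j))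

variable {k A M} in
lemma sum_eq_zero_of_sum_evalM {n : ℕ} (m : Fin n → M)
    (hm : Submodule.span A (Set.range m) = ⊤) (ξ : Fin n → DM k A M)
    (hξ : ∑ j, evalM (m j) (ξ j) = 0) {V : Type} [AddCommGroup V] [Module (EndOp A M) V]
    (f : M →ₗ[A] Psi k A M V) : ∑ j, f (m j) (ξ j) = 0 := by
  classical
  have : IsNoetherianRing A := IsNoetherianRing.of_finite k A
  let π : (Fin n → A) →ₗ[A] M := Fintype.linearCombination A m
  have hπ : Function.Surjective π := by
    rw [← LinearMap.range_eq_top, Fintype.range_linearCombination, hm]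
  obtain ⟨p, r, hr⟩ := Submodule.fg_iff_exists_fin_generating_family.1
    (IsNoetherian.noetherian (LinearMap.ker π))
  have hr0 : ∀ l, ∑ j, r l j • m j = 0 := fun l => by
    have : r l ∈ LinearMap.ker π := hr ▸ Submodule.subset_span ⟨l, rfl⟩
    simpa [π, Fintype.linearCombination_apply] using this
  let T : (Fin n → M) →ₗ[k] (Fin p → M) :=
    LinearMap.pi fun l => ∑ j, Module.toModuleEnd k (S := A) M (r l j) ∘ₗ LinearMap.proj j
  have hT : ∀ x l, T x l = ∑ j, r l j • x j := fun x l => by simp [T]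
  let ζ : (Fin n → M) →ₗ[k] k := ∑ j, (ξ j : M →ₗ[k] k) ∘ₗ LinearMap.proj j
  have hζ : ∀ x, ζ x = ∑ j, ξ j (x j) := fun x => by
    simp only [ζ, LinearMap.sum_apply]
    rfl
  have hmem : ζ ∈ LinearMap.range T.dualMap := by
    rw [LinearMap.range_dualMap_eq_dualAnnihilator_ker, Submodule.mem_dualAnnihilator]
    intro x hx
    let q : (Fin n → A) →ₗ[A] M := Fintype.linearCombination A x
    obtain ⟨K, _, _, i, hi⟩ := exists_ses_of_surjective π hπ
    obtain ⟨φ, hφ⟩ := hi.desc q (fun y => by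
        have hy : i y ∈ LinearMap.ker π := hi.apply_apply y
        rw [← hr] at hy
        refine Submodule.span_induction (p := fun z _ => q z = 0) ?_ ?_ ?_ ?_ hy
        · rintro _ ⟨l, rfl⟩
          have := congrFun (LinearMap.mem_ker.1 hx) l
          rw [hT] at this
          simpa [q, Fintype.linearCombination_apply] using this
        · simp
        · intro a b _ _ ha hb; rw [map_add, ha, hb, add_zero]
        · intro a b _ hb; rw [map_smul, hb, smul_zero])
    have hφ' : ∀ j, φ (m j) = x j := fun j => by
      simpa [π, q, Fintype.linearCombination_apply_single] using hφ (Pi.single j 1)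
    have := DFunLike.congr_fun hξ (MulOpposite.op φ)
    rw [DualMod.sum_apply] at this
    simpa only [hζ, evalM_apply, MulOpposite.unop_op, hφ', DualMod.zero_apply] using this
  obtain ⟨η, hη⟩ := hmem
  let η' : Fin p → DM k A M := fun l => DualMod.mk _ (η ∘ₗ LinearMap.single k (fun _ => M) l)
  have hη' : ∀ y, η y = ∑ l, η' l (y l) := fun y => by
    simp only [η', DualMod.mk_apply, LinearMap.comp_apply]
    rw [← map_sum]
    exact congrArg η (Finset.univ_sum_single y).symm
  have hξη : ∀ j, ξ j = ∑ l, (psiAct k A M (r l j)).unop (η' l) := fun j => DualMod.ext fun x => by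
    have h1 : ζ (Pi.single j x) = ξ j x := by
      rw [hζ, Finset.sum_eq_single j]
      · simp
      · intro i _ hi; simp [Pi.single_eq_of_ne hi]
      · simp
    rw [← h1, ← hη, LinearMap.dualMap_apply, hη', DualMod.sum_apply]
    refine Finset.sum_congr rfl fun l _ => ?_
    rw [psiAct_apply, hT, Finset.sum_eq_single j]
    · simp
    · intro i _ hi; simp [Pi.single_eq_of_ne hi]
    · simp
  simp only [hξη, map_sum]
  rw [Finset.sum_comm]
  refine Finset.sum_eq_zero fun l _ => ?_
  have h1 : ∑ j, r l j • f (m j) = 0 := by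
    simp only [← map_smul, ← map_sum, hr0, map_zero]
  have h2 : ∀ s : Finset (Fin n), (∑ j ∈ s, r l j • f (m j)) (η' l) =
      ∑ j ∈ s, f (m j) ((psiAct k A M (r l j)).unop (η' l)) := fun s => by
    induction s using Finset.cons_induction with
    | empty => simp
    | cons a s ha ih => rw [Finset.sum_cons, Finset.sum_cons, HMod.add_apply, ih]; rfl
  rw [← h2, h1]
  rfl

/-- `Hom(DM, -)` is fully faithful on maps out of the injective cogenerator. -/
lemma hFull_psiAct {n : ℕ} (hgen : Retract A A (Fin n → M)) : HFull k (psiAct k A M) where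
  retract := by
    classical
    obtain ⟨i, p, hip⟩ := hgen
    let b : Fin n → M →ₗ[A] A := fun j => p ∘ₗ LinearMap.single A (fun _ => M) j
    have hb : ∀ x : Fin n → M, p x = ∑ j, b j (x j) := fun x => by
      simp only [b, LinearMap.comp_apply]
      rw [← map_sum]
      exact congrArg p (Finset.univ_sum_single x).symm
    refine ⟨n, (Finsupp.linearEquivFunOnFinite _ _ (Fin n)).symm.toLinearMap ∘ₗ
      LinearMap.pi fun j => evalM (i 1 j), Finsupp.lsum ℕ fun j => coevalM k A M (b j),
      fun ξ => DualMod.ext fun x => ?_⟩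
    rw [Finsupp.lsum_apply, Finsupp.sum_fintype _ _ (fun _ => map_zero _), DualMod.sum_apply]
    simp only [coevalM_apply]
    change ∑ j, ξ (b j (i 1 j) • x) = ξ x
    rw [← map_sum, ← Finset.sum_smul, ← hb, hip, one_smul]
  faithful V _ _ g hg := by
    obtain ⟨n, m, hm⟩ := Module.Finite.exists_fin (R := A) (M := M)
    refine LinearMap.ext fun w => ?_
    obtain ⟨ξ, rfl⟩ := exists_sum_evalM k m hm w
    rw [map_sum]
    exact Finset.sum_eq_zero fun j _ =>
      DFunLike.congr_fun (LinearMap.congr_fun hg (HMod.mk _ (evalM (m j)))) (ξ j)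
  full V _ _ f := by
    obtain ⟨n, m, hm⟩ := Module.Finite.exists_fin (R := A) (M := M)
    let q : (Fin n → DM k A M) →ₗ[EndOp A M] W k (EndOp A M) :=
      ∑ j, evalM (m j) ∘ₗ LinearMap.proj j
    have hq : ∀ ξ, q ξ = ∑ j, evalM (m j) (ξ j) := fun ξ => by simp [q]
    have hqs : Function.Surjective q := fun w => by
      obtain ⟨ξ, hξ⟩ := exists_sum_evalM k m hm w
      exact ⟨ξ, (hq ξ).trans hξ⟩
    let F := f ∘ₗ evalHom k A M
    let t : (Fin n → DM k A M) →ₗ[EndOp A M] V := ∑ j, (F (m j)).hom ∘ₗ LinearMap.proj j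
    have ht : ∀ ξ, t ξ = ∑ j, F (m j) (ξ j) := fun ξ => by simp [t]
    obtain ⟨K, _, _, i, hi⟩ := exists_ses_of_surjective q hqs
    obtain ⟨g, hg⟩ := hi.desc t fun y => by
      rw [ht]
      exact sum_eq_zero_of_sum_evalM m hm _ ((hq _).symm.trans (hi.apply_apply y)) F
    refine ⟨g, ?_⟩
    have key : HMod.map (psiAct k A M) g ∘ₗ evalHom k A M = F := by
      classical
      refine LinearMap.ext_on_range hm fun j => HMod.ext fun ξ => ?_
      have h1 : q (Pi.single j ξ) = evalM (m j) ξ := by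
        rw [hq, Finset.sum_eq_single j]
        · simp
        · intro i _ hi; simp [Pi.single_eq_of_ne hi]
        · simp
      have h2 : t (Pi.single j ξ) = F (m j) ξ := by
        rw [ht, Finset.sum_eq_single j]
        · simp
        · intro i _ hi; simp [Pi.single_eq_of_ne hi]
        · simp
      rw [← h2, ← hg, h1]
      rfl
    refine LinearMap.ext fun η => ?_
    obtain ⟨x, rfl⟩ := (evalEquiv k A M).surjective η
    exact LinearMap.congr_fun key x

end Psi


/-! ## Retracts of finite powers -/

section FinRetract

variable (R : Type) [Ring R]
variable (X Y Z : Type) [AddCommGroup X] [Module R X] [AddCommGroup Y] [Module R Y]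
  [AddCommGroup Z] [Module R Z]

/-- `X` is a direct summand of a finite direct sum of copies of `Y`. -/
def FinRetract : Prop := ∃ (ι : Type) (_ : Finite ι), Retract R X (ι →₀ Y)

variable {R X Y Z}

lemma Retract.finRetract (h : Retract R X Y) : FinRetract R X Y :=
  ⟨Unit, inferInstance, h.trans (.of_equiv (Finsupp.uniqueLinearEquiv R Y ()).symm)⟩

lemma FinRetract.refl : FinRetract R X X := Retract.refl.finRetract

lemma FinRetract.trans (h : FinRetract R X Y) (h' : FinRetract R Y Z) : FinRetract R X Z := by
  obtain ⟨ι, _, h⟩ := h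
  obtain ⟨κ, _, h'⟩ := h'
  exact ⟨ι × κ, inferInstance, h.trans ((h'.finsupp ι).trans
    (.of_equiv (Finsupp.curryLinearEquiv R).symm))⟩

lemma FinRetract.exists_fin (h : FinRetract R X Y) : ∃ n : ℕ, Retract R X (Fin n →₀ Y) := by
  obtain ⟨ι, _, h⟩ := h
  obtain ⟨n, ⟨e⟩⟩ := Finite.exists_equiv_fin ι
  exact ⟨n, h.trans (.of_equiv (Finsupp.domLCongr e))⟩

lemma FinRetract.of_pi {n : ℕ} (h : Retract R X (Fin n → Y)) : FinRetract R X Y :=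
  ⟨Fin n, inferInstance, h.trans
    (.of_equiv (Finsupp.linearEquivFunOnFinite R Y (Fin n)).symm)⟩

lemma FinRetract.exists_fin_pi (h : FinRetract R X Y) : ∃ n : ℕ, Retract R X (Fin n → Y) := by
  obtain ⟨n, h⟩ := h.exists_fin
  exact ⟨n, h.trans (.of_equiv (Finsupp.linearEquivFunOnFinite R Y (Fin n)))⟩

lemma Retract.finRetract_of_finite [Module.Finite R X] {J : Type} (h : Retract R X (J →₀ Y)) :
    FinRetract R X Y := by
  classical
  obtain ⟨u, p, hup⟩ := h
  obtain ⟨t, ht⟩ := (Module.Finite.fg_top : (⊤ : Submodule R X).FG)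
  let s : Finset J := t.biUnion fun x => (u x).support
  have hu : ∀ x, u x ∈ Finsupp.supported Y R (s : Set J) := fun x => by
    have hx : x ∈ Submodule.span R (t : Set X) := ht ▸ Submodule.mem_top
    have : Submodule.span R (t : Set X) ≤ (Finsupp.supported Y R (s : Set J)).comap u :=
      Submodule.span_le.2 fun x hx => (Finsupp.mem_supported R _).2 fun j hj =>
        Finset.mem_biUnion.2 ⟨x, hx, hj⟩
    exact this hx
  refine ⟨(s : Set J), inferInstance, (Finsupp.supportedEquivFinsupp (s : Set J)).toLinearMap ∘ₗ
    u.codRestrict _ hu, p ∘ₗ (Finsupp.supported Y R (s : Set J)).subtype ∘ₗ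
    (Finsupp.supportedEquivFinsupp (s : Set J)).symm.toLinearMap, fun x => ?_⟩
  simp [hup]

lemma FinRetract.projective [Module.Projective R Y] (h : FinRetract R X Y) :
    Module.Projective R X := by
  classical
  obtain ⟨ι, _, i, p, hip⟩ := h
  have : Module.Projective R (ι →₀ Y) := .of_equiv (finsuppLEquivDirectSum R Y ι).symm
  exact Module.Projective.of_split i p (LinearMap.ext hip)

lemma FinRetract.finite [Module.Finite R Y] (h : FinRetract R X Y) : Module.Finite R X := by
  obtain ⟨ι, _, i, p, hip⟩ := h
  exact Module.Finite.of_surjective p fun x => ⟨i x, hip x⟩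

lemma FinRetract.injective [Module.Injective R Y] (h : FinRetract R X Y) :
    Module.Injective R X := by
  obtain ⟨n, h⟩ := h.exists_fin_pi
  have : Module.Injective R (Fin n → Y) := by infer_instance
  exact injective_of_retract h

lemma FinRetract.hmod {B T : Type} [Ring B] [AddCommGroup T] [Module R T] [Module.Finite R T]
    {ρ : B →+* (Module.End R T)ᵐᵒᵖ} (h : FinRetract R X Y) :
    FinRetract B (HMod ρ X) (HMod ρ Y) := by
  obtain ⟨ι, _, h⟩ := h
  obtain ⟨e, -⟩ := HMod.exists_finsuppEquiv ρ Y ι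
  exact ⟨ι, inferInstance, (HMod.retract h).trans (.of_equiv e.symm)⟩

end FinRetract

/-! ## Self-injective algebras have projective injective cogenerators -/

section QF

variable {k A : Type} [Field k] [Ring A] [Algebra k A] [FiniteDimensional k A]
variable {X Y : Type} [AddCommGroup X] [Module A X] [AddCommGroup Y] [Module A Y]

lemma exists_nak_map_eq (hX : FinRetract A X (W k A)) (f : Nak k A X →ₗ[A] Nak k A Y) :
    ∃ g : X →ₗ[A] Y, HMod.map (rightAct k A) g = f := by
  obtain ⟨ι, _, i, p, hip⟩ := hX
  obtain ⟨g, hg⟩ := (hFull_rightAct k A).full_finsupp (f ∘ₗ HMod.map _ p)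
  refine ⟨g ∘ₗ i, ?_⟩
  rw [HMod.map_comp, hg]
  refine LinearMap.ext fun ξ => congrArg f (HMod.ext fun t => hip _)

lemma eq_zero_of_nak_map_eq_zero (hX : FinRetract A X (W k A)) (g : X →ₗ[A] Y)
    (hg : HMod.map (rightAct k A) g = 0) : g = 0 := by
  obtain ⟨ι, _, i, p, hip⟩ := hX
  have h0 := (hFull_rightAct k A).faithful_finsupp (g ∘ₗ p)
    (by rw [HMod.map_comp, hg, LinearMap.zero_comp])
  refine LinearMap.ext fun x => ?_
  rw [← hip x]
  exact LinearMap.congr_fun h0 (i x)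

lemma FinRetract.of_nak (hX : FinRetract A X (W k A)) (hY : FinRetract A Y (W k A))
    (h : FinRetract A (Nak k A X) (Nak k A Y)) : FinRetract A X Y := by
  obtain ⟨ι, _, i, p, hip⟩ := h
  have hY' : FinRetract A (ι →₀ Y) (W k A) := FinRetract.trans ⟨ι, inferInstance, .refl⟩ hY
  obtain ⟨e, -⟩ := HMod.exists_finsuppEquiv (rightAct k A) Y ι
  obtain ⟨i', hi'⟩ := exists_nak_map_eq hX (e.toLinearMap ∘ₗ i)
  obtain ⟨p', hp'⟩ := exists_nak_map_eq hY' (p ∘ₗ e.symm.toLinearMap)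
  refine ⟨ι, inferInstance, i', p', fun x => ?_⟩
  have : p' ∘ₗ i' - LinearMap.id = 0 := by
    refine eq_zero_of_nak_map_eq_zero hX _ ?_
    rw [HMod.map_sub, HMod.map_comp, hi', hp', HMod.map_id]
    refine LinearMap.ext fun ξ => ?_
    simp [hip]
  exact sub_eq_zero.1 (LinearMap.congr_fun this x)

/-- The trace ideal of a module. -/
def traceIdeal (A X : Type) [Ring A] [AddCommGroup X] [Module A X] : Submodule A A :=
  ⨆ f : X →ₗ[A] A, LinearMap.range f

lemma traceIdeal_mono (h : FinRetract A X Y) : traceIdeal A X ≤ traceIdeal A Y := by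
  obtain ⟨ι, _, i, p, hip⟩ := h
  refine iSup_le fun f => ?_
  rintro _ ⟨x, rfl⟩
  rw [← hip x]
  induction i x using Finsupp.induction_linear with
  | zero => simp
  | add a b ha hb => rw [map_add, map_add]; exact Submodule.add_mem _ ha hb
  | single j y => exact Submodule.mem_iSup_of_mem (f ∘ₗ p ∘ₗ Finsupp.lsingle j) ⟨y, rfl⟩

lemma FinRetract.of_traceIdeal_le (hX : FinRetract A X A)
    (h : traceIdeal A X ≤ traceIdeal A Y) : FinRetract A X Y := by
  have := hX.projective
  have := hX.finite
  obtain ⟨ι, _, i, p, hip⟩ := hX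
  let q : ((Y →ₗ[A] X) →₀ Y) →ₗ[A] X := Finsupp.lsum ℕ fun f => f
  have hq : Function.Surjective q := by
    rw [← LinearMap.range_eq_top, eq_top_iff]
    rintro x -
    have hmem : ∀ (z : X) (a : A), a ∈ traceIdeal A Y → a • z ∈ LinearMap.range q :=
        fun z a ha => by
      have : traceIdeal A Y ≤ (LinearMap.range q).comap (LinearMap.toSpanSingleton A X z) := by
        refine iSup_le fun f => ?_
        rintro _ ⟨y, rfl⟩
        exact ⟨Finsupp.single (LinearMap.toSpanSingleton A X z ∘ₗ f) y, by simp [q]⟩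
      exact this ha
    rw [← hip x, ← Finsupp.sum_single (i x), map_finsuppSum]
    refine Submodule.sum_mem _ fun j _ => ?_
    have h1 : Finsupp.single j (i x j) = i x j • Finsupp.single j (1 : A) := by simp
    beta_reduce
    rw [h1, map_smul]
    exact hmem _ _ (h (Submodule.mem_iSup_of_mem (Finsupp.lapply j ∘ₗ i) ⟨x, rfl⟩))
  obtain ⟨s, hs⟩ := Module.projective_lifting_property q LinearMap.id hq
  exact Retract.finRetract_of_finite ⟨s, q, fun x => LinearMap.congr_fun hs x⟩

/-- The injective cogenerator of a self-injective algebra is projective. -/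
lemma finRetract_W (k A : Type) [Field k] [Ring A] [Algebra k A] [FiniteDimensional k A]
    [Module.Injective A A] : FinRetract A (W k A) A := by
  have : IsArtinianRing A := IsArtinianRing.of_finite k A
  have hAW : FinRetract A A (W k A) := by
    obtain ⟨n, f, hf⟩ := exists_fin_W_embedding k (Λ := A) A
    exact .of_pi (retract_of_injective f hf)
  let S : Set (Submodule A A) := {t | ∃ X : ModuleCat.{0} A, traceIdeal A X = t ∧
    FinRetract A X A ∧ FinRetract A (Nak k A X) X ∧
      (FinRetract A X (Nak k A X) → FinRetract A (W k A) A)}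
  have hS : S.Nonempty := by
    refine ⟨_, ModuleCat.of A A, rfl, .refl, ?_, fun h => ?_⟩
    · exact hAW.hmod.trans (Retract.of_equiv (nakEquiv k A).symm).finRetract
    · exact .of_nak .refl hAW ((Retract.of_equiv (nakEquiv k A).symm).finRetract.trans h)
  obtain ⟨_, ⟨X, rfl, hX, hHX, himp⟩, hmin⟩ :=
    (wellFounded_lt : WellFounded ((· < ·) : Submodule A A → Submodule A A → Prop)).has_min S hS
  have hHXA := hHX.trans hX
  have hmem : traceIdeal A (Nak k A X) ∈ S :=
    ⟨ModuleCat.of A (Nak k A X), rfl, hHXA, hHX.hmod, fun h =>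
      himp (.of_nak (hX.trans hAW) (hHXA.trans hAW) h)⟩
  refine himp (hX.of_traceIdeal_le ?_)
  by_contra hle
  exact hmin _ hmem (lt_of_le_not_ge (traceIdeal_mono hHX) hle)

end QF


/-! ## Finitely generated resolutions and coresolutions -/

section Resolutions

lemma exists_nat_chain {α : Type*} (s : α → α → Prop) (h : ∀ x, ∃ y, s x y) (x₀ : α) :
    ∃ c : ℕ → α, c 0 = x₀ ∧ ∀ n, s (c n) (c (n + 1)) := by
  choose f hf using h
  exact ⟨fun n => Nat.rec x₀ (fun _ x => f x) n, rfl, fun n => hf _⟩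

lemma exists_fg_resolution (R : Type) [Ring R] [IsNoetherianRing R] (X : Type) [AddCommGroup X]
    [Module R X] [Module.Finite R X] :
    ∃ (Ω P : ℕ → ModuleCat.{0} R) (a : ∀ n, Ω (n + 1) →ₗ[R] P n) (b : ∀ n, P n →ₗ[R] Ω n),
      (∀ n, SES (a n) (b n)) ∧ Nonempty (Ω 0 ≃ₗ[R] X) ∧ (∀ n, Module.Finite R (Ω n)) ∧
      (∀ n, Module.Finite R (P n)) ∧ ∀ n, Module.Projective R (P n) := by
  obtain ⟨c, h0, hc⟩ := exists_nat_chain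
    (fun x y : {X : ModuleCat.{0} R // Module.Finite R X} => ∃ (P : ModuleCat.{0} R)
      (a : y.1 →ₗ[R] P) (b : P →ₗ[R] x.1), SES a b ∧ Module.Finite R P ∧ Module.Projective R P)
    (by
      rintro ⟨X, _⟩
      obtain ⟨n, q, hq⟩ := Module.Finite.exists_fin' R X
      obtain ⟨K, _, _, f, hf⟩ := exists_ses_of_surjective q hq
      exact ⟨⟨ModuleCat.of R K, Module.Finite.of_injective f hf.inj⟩,
        ModuleCat.of R (Fin n → R), f, q, hf, inferInstanceAs (Module.Finite R (Fin n → R)),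
        inferInstanceAs (Module.Projective R (Fin n → R))⟩)
    ⟨ModuleCat.of R X, inferInstanceAs (Module.Finite R X)⟩
  choose P a b h hP hP' using hc
  exact ⟨fun n => (c n).1, P, a, b, h, ⟨by beta_reduce; rw [h0]⟩, fun n => (c n).2, hP, hP'⟩

lemma exists_fg_coresolution (k R : Type) [Field k] [Ring R] [Algebra k R]
    [FiniteDimensional k R] (X : Type) [AddCommGroup X] [Module R X] [Module.Finite R X] :
    ∃ (N : ℕ → ModuleCat.{0} R) (m : ℕ → ℕ) (c : ∀ n, N n →ₗ[R] (Fin (m n) → W k R))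
      (d : ∀ n, (Fin (m n) → W k R) →ₗ[R] N (n + 1)),
      (∀ n, SES (c n) (d n)) ∧ Nonempty (N 0 ≃ₗ[R] X) ∧ ∀ n, Module.Finite R (N n) := by
  obtain ⟨c, h0, hc⟩ := exists_nat_chain
    (fun x y : {X : ModuleCat.{0} R // Module.Finite R X} => ∃ (m : ℕ)
      (a : x.1 →ₗ[R] (Fin m → W k R)) (b : (Fin m → W k R) →ₗ[R] y.1), SES a b)
    (by
      rintro ⟨X, _⟩
      obtain ⟨n, f, hf⟩ := exists_fin_W_embedding k (Λ := R) X
      obtain ⟨C, _, _, g, h⟩ := exists_ses_of_injective f hf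
      exact ⟨⟨ModuleCat.of R C, Module.Finite.of_surjective g h.surj⟩, n, f, g, h⟩)
    ⟨ModuleCat.of R X, inferInstanceAs (Module.Finite R X)⟩
  choose m a b h using hc
  exact ⟨fun n => (c n).1, m, a, b, h, ⟨by beta_reduce; rw [h0]⟩, fun n => (c n).2⟩

end Resolutions

/-- A resolution and a coresolution of a self-orthogonal module. -/
structure OrthData (k A M : Type) [Field k] [Ring A] [Algebra k A] [AddCommGroup M]
    [Module A M] where
  (Ω P N : ℕ → ModuleCat.{0} A)
  a : ∀ n, Ω (n + 1) →ₗ[A] P n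
  b : ∀ n, P n →ₗ[A] Ω n
  sesΩ : ∀ n, SES (a n) (b n)
  zeroΩ : Ω 0 ≃ₗ[A] M
  finΩ : ∀ n, Module.Finite A (Ω n)
  finP : ∀ n, Module.Finite A (P n)
  projP : ∀ n, Module.Projective A (P n)
  m : ℕ → ℕ
  c : ∀ n, N n →ₗ[A] (Fin (m n) → W k A)
  d : ∀ n, (Fin (m n) → W k A) →ₗ[A] N (n + 1)
  sesN : ∀ n, SES (c n) (d n)
  zeroN : N 0 ≃ₗ[A] M
  finN : ∀ n, Module.Finite A (N n)
  orthΩ : ∀ n, Ext1 A (Ω n) M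
  orthN : ∀ n, Ext1 A M (N n)

attribute [instance] OrthData.finΩ OrthData.finP OrthData.projP OrthData.finN

section DomData

variable {k A M : Type} [Field k] [Ring A] [Algebra k A] [AddCommGroup M] [Module A M]
  [Module k M] [IsScalarTower k A M]

variable (A M) in
/-- The regular module as a Hom module. -/
def regularEquiv : HMod (RingHom.id (EndOp A M)) M ≃ₗ[EndOp A M] EndOp A M where
  toFun f := MulOpposite.op f.hom
  map_add' _ _ := rfl
  map_smul' _ _ := rfl
  invFun f := HMod.mk _ f.unop
  left_inv _ := rfl
  right_inv _ := rfl

variable (k A M) in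
/-- The dual of `M` as a Hom module. -/
def dualEquiv : HMod (RingHom.id (EndOp A M)) (W k A) ≃ₗ[EndOp A M] DM k A M where
  toFun η := DualMod.mk _ (ofW η.hom)
  map_add' _ _ := rfl
  map_smul' _ _ := rfl
  invFun ξ := HMod.mk _ (toW (k := k) (V := M) ξ)
  left_inv η := toW_ofW η.hom
  right_inv ξ := ofW_toW (V := M) (Λ := A) (ξ : M →ₗ[k] k)

variable [FiniteDimensional k A] [Module.Finite A M]

lemma exists_domData [Module.Injective A A] (hgen : FinRetract A A M) (S : OrthData k A M) :
    Nonempty (DomData k (EndOp A M)) := by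
  have : IsNoetherianRing (EndOp A M) := IsNoetherianRing.of_finite k (EndOp A M)
  obtain ⟨Ω, P, a, b, h, ⟨e⟩, h1, h2, h3⟩ := exists_fg_resolution (EndOp A M) (W k (EndOp A M))
  have hI : ∀ n, FinRetract A (Fin n → W k A) (W k A) := fun n => .of_pi .refl
  have hI' : ∀ n, FinRetract A (Fin n → W k A) M := fun n =>
    (hI n).trans ((finRetract_W k A).trans hgen)
  have hZ : ∀ n, FinRetract (EndOp A M) (HMod (RingHom.id (EndOp A M)) (Fin n → W k A))
      (EndOp A M) := fun n => (hI' n).hmod.trans (Retract.of_equiv (regularEquiv A M)).finRetract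
  have hZ' : ∀ n, FinRetract (EndOp A M) (HMod (RingHom.id (EndOp A M)) (Fin n → W k A))
      (W k (EndOp A M)) := fun n => by
    obtain ⟨l, hl⟩ := hgen.exists_fin_pi
    obtain ⟨r, hr⟩ := (hFull_psiAct k A M hl).retract
    exact (hI n).hmod.trans ((Retract.of_equiv (dualEquiv k A M)).trans hr |>.finRetract.trans
      ⟨Fin r, inferInstance, .refl⟩)
  have hfin := fun n => (hZ n).finite
  exact ⟨{
    Ω := Ω, P := P, a := a, b := b, sesΩ := h, zeroΩ := e, finΩ := h1, finP := h2, projP := h3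
    Z := fun n => ModuleCat.of _ (HMod (RingHom.id (EndOp A M)) (S.N n))
    I := fun n => ModuleCat.of _ (HMod (RingHom.id (EndOp A M)) (Fin (S.m n) → W k A))
    c := fun n => HMod.map _ (S.c n)
    d := fun n => HMod.map _ (S.d n)
    sesZ := fun n => HMod.ses_map (S.sesN n) (S.orthN n)
    zeroZ := (HMod.mapEquiv _ S.zeroN).trans (regularEquiv A M)
    finZ := fun n => have := hfin (S.m n)
      Module.Finite.of_injective (HMod.map (RingHom.id (EndOp A M)) (S.c n))
        (HMod.injective_map (S.sesN n).inj)
    finI := fun n => hfin (S.m n)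
    projI := fun n => (hZ (S.m n)).projective
    injI := fun n => (hZ' (S.m n)).injective }⟩

end DomData

/-! ## The class `𝒢` -/

section Gm

variable {k A M : Type} [Field k] [Ring A] [Algebra k A] [AddCommGroup M] [Module A M]
variable (S : OrthData k A M)
variable {X Y Z : Type} [AddCommGroup X] [Module A X] [AddCommGroup Y] [Module A Y]
  [AddCommGroup Z] [Module A Z]

/-- Orthogonality to `M` on both sides in all degrees. -/
def Gm (X : Type) [AddCommGroup X] [Module A X] : Prop :=
  ∀ n, Ext1 A (S.Ω n) X ∧ Ext1 A X (S.N n)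

variable {S}

lemma Gm.ext1_left (h : Gm S X) : Ext1 A M X := (h 0).1.congr_left S.zeroΩ

lemma Gm.ext1_right (h : Gm S X) : Ext1 A X M := (h 0).2.congr_right S.zeroN

lemma Gm.retract (h : Gm S Y) (hr : Retract A X Y) : Gm S X := fun n =>
  ⟨(h n).1.retract_right hr, (h n).2.retract_left hr⟩

lemma Gm.congr (h : Gm S Y) (e : X ≃ₗ[A] Y) : Gm S X := h.retract (.of_equiv e)

lemma Gm.ext {f : X →ₗ[A] Y} {g : Y →ₗ[A] Z} (h : SES f g) (hX : Gm S X) (hZ : Gm S Z) :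
    Gm S Y := fun n =>
  ⟨.ext_right h (hX n).1 (hZ n).1, .ext_left h (hX n).2 (hZ n).2⟩

lemma Gm.prod (hX : Gm S X) (hZ : Gm S Z) : Gm S (X × Z) := .ext ses_prod hX hZ

lemma Gm.finsupp (hX : Gm S X) (J : Type) : Gm S (J →₀ X) := fun n =>
  ⟨.finsupp_right (S.sesΩ n) (hX n).1, (hX n).2.finsupp_left J⟩

variable (S) in
lemma gm_self : Gm S M := fun n => ⟨S.orthΩ n, S.orthN n⟩

lemma Gm.coker {J : Type} {f : X →ₗ[A] (J →₀ M)} {g : (J →₀ M) →ₗ[A] Z} (h : SES f g)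
    (hX : Gm S X) (hf : ∀ u : X →ₗ[A] M, ∃ v : (J →₀ M) →ₗ[A] M, ∀ x, v (f x) = u x)
    [FiniteDimensional k A] : Gm S Z := by
  have hM := (gm_self S).finsupp J
  intro n
  constructor
  · refine .of_resolution (S.sesΩ n) .of_projective fun u => ?_
    obtain ⟨v, hv⟩ := (hX (n + 1)).1.lift h u
    obtain ⟨w, hw⟩ := (hM n).1 (S.sesΩ n) v
    exact ⟨g ∘ₗ w, fun x => by rw [LinearMap.comp_apply, hw, hv]⟩
  · cases n with
    | zero => exact (Ext1.of_resolution h hM.ext1_right hf).congr_right S.zeroN.symm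
    | succ n => exact .shift_right h (S.sesN n) (hM (n + 1)).2 (hX n).2

lemma Gm.ker {J : Type} {f : X →ₗ[A] (J →₀ M)} {g : (J →₀ M) →ₗ[A] Z} (h : SES f g)
    (hZ : Gm S Z) (hg : ∀ u : M →ₗ[A] Z, ∃ v : M →ₗ[A] (J →₀ M), ∀ x, g (v x) = u x)
    [FiniteDimensional k A] : Gm S X := by
  have hM := (gm_self S).finsupp J
  intro n
  constructor
  · cases n with
    | zero => exact (Ext1.of_coresolution h hM.ext1_left hg).congr_left S.zeroΩ.symm
    | succ n => exact .shift_left (S.sesΩ n) h (hM (n + 1)).1 .of_projective (hZ n).1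
  · exact .shift_left h (S.sesN n) .of_injective (hM n).2 (hZ (n + 1)).2

variable [FiniteDimensional k A] [Module.Finite A M]

/-- Modules in `𝒢` are cogenerated by `M`. -/
lemma Gm.exists_coker [Module.Injective A A] (hgen : FinRetract A A M) (hX : Gm S X) :
    ∃ (J C : Type) (_ : AddCommGroup C) (_ : Module A C) (f : X →ₗ[A] (J →₀ M))
      (g : (J →₀ M) →ₗ[A] C), SES f g ∧ Gm S C := by
  obtain ⟨K, ⟨e⟩, -⟩ := exists_pi_equiv_finsupp k A M (X →ₗ[A] M)
  let f : X →ₗ[A] ((X →ₗ[A] M) → M) := LinearMap.pi fun u => u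
  have hf : Function.Injective f := by
    rw [← LinearMap.ker_eq_bot, LinearMap.ker_eq_bot']
    intro x hx
    by_contra hne
    obtain ⟨w, hw⟩ := exists_W_ne_zero k (Λ := A) hne
    obtain ⟨ι, _, i, p, hip⟩ := (finRetract_W k A).trans hgen
    apply hw
    have : i (w x) = 0 := Finsupp.ext fun j => congrFun hx (Finsupp.lapply j ∘ₗ i ∘ₗ w)
    rw [← hip (w x), this, map_zero]
  obtain ⟨C, _, _, g, h⟩ := exists_ses_of_injective (e.toLinearMap ∘ₗ f) (e.injective.comp hf)
  refine ⟨K, C, _, _, _, g, h, hX.coker h fun u => ⟨LinearMap.proj u ∘ₗ e.symm.toLinearMap,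
    fun x => by simp [f]⟩⟩

/-- Modules in `𝒢` are generated by `M`. -/
lemma Gm.exists_ker (hgen : FinRetract A A M) (hX : Gm S X) :
    ∃ (J K : Type) (_ : AddCommGroup K) (_ : Module A K) (f : K →ₗ[A] (J →₀ M))
      (g : (J →₀ M) →ₗ[A] X), SES f g ∧ Gm S K := by
  let q : ((M →ₗ[A] X) →₀ M) →ₗ[A] X := Finsupp.lsum ℕ fun u => u
  have hq : Function.Surjective q := by
    rw [← LinearMap.range_eq_top, eq_top_iff]
    rintro x -
    obtain ⟨ι, _, i, p, hip⟩ := hgen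
    have hx : x = (LinearMap.toSpanSingleton A X x ∘ₗ p) (i 1) := by simp [hip]
    rw [hx]
    induction i 1 using Finsupp.induction_linear with
    | zero => rw [map_zero]; exact Submodule.zero_mem _
    | add a b ha hb => rw [map_add]; exact Submodule.add_mem _ ha hb
    | single j y =>
      exact ⟨Finsupp.single (LinearMap.toSpanSingleton A X x ∘ₗ p ∘ₗ Finsupp.lsingle j) y,
        by simp [q]⟩
  obtain ⟨K, _, _, f, h⟩ := exists_ses_of_surjective q hq
  exact ⟨_, K, _, _, f, q, h, hX.ker h fun u => ⟨Finsupp.lsingle u, fun x => by simp [q]⟩⟩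

variable [Module k M] [IsScalarTower k A M] {D : DomData k (EndOp A M)}

lemma Gm.exists_psi [Module.Injective A A] (hgen : FinRetract A A M) (hX : Gm S X)
    (D : DomData k (EndOp A M)) :
    ∃ (L : Type) (_ : AddCommGroup L) (_ : Module (EndOp A M) L),
      GI D L ∧ Nonempty (X ≃ₗ[A] Psi k A M L) := by
  obtain ⟨n, hn⟩ := hgen.exists_fin_pi
  refine (hFull_psiAct k A M hn).exists_equiv D (evalEquiv k A M) (fun X => Gm S X)
    (fun X h => h.ext1_left) (fun X h => h.ext1_right) (fun X h => ?_) (fun X h => ?_)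
    (ModuleCat.of A X) hX
  · obtain ⟨J, C, _, _, f, g, hs, hC⟩ := h.exists_coker hgen
    exact ⟨ModuleCat.of A C, J, f, g, hs, hC⟩
  · obtain ⟨J, K, _, _, f, g, hs, hK⟩ := h.exists_ker hgen
    exact ⟨ModuleCat.of A K, J, f, g, hs, hK⟩

variable (k A M) in
lemma exists_finsupp_evalEquiv (hgen : FinRetract A A M) (J : Type) :
    Nonempty ((J →₀ M) ≃ₗ[A] Psi k A M (J →₀ W k (EndOp A M))) := by
  obtain ⟨r, hr⟩ := hgen.exists_fin_pi
  have : Module.Finite (EndOp A M) (DM k A M) := (hFull_psiAct k A M hr).finite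
  obtain ⟨e, -⟩ := HMod.exists_finsuppEquiv (psiAct k A M) (W k (EndOp A M)) J
  exact ⟨Finsupp.mapRange.linearEquiv (evalEquiv k A M) ≪≫ₗ e⟩

lemma GI.gm_psi (hgen : FinRetract A A M) (S : OrthData k A M) {L : Type} [AddCommGroup L]
    [Module (EndOp A M) L] (hL : GI D L) : Gm S (Psi k A M L) := by
  obtain ⟨r, hr⟩ := hgen.exists_fin_pi
  have hρ := hFull_psiAct k A M hr
  have hM := gm_self S
  have e := evalEquiv k A M
  intro n
  constructor
  · induction n generalizing L with
    | zero =>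
      have h1 := hρ.ext1_left hL fun J => by
        exact ((hM.finsupp J).ext1_left.congr_left e).congr_right
          (Finsupp.mapRange.linearEquiv e)
      exact (h1.congr_left e.symm).congr_left S.zeroΩ.symm
    | succ n ih =>
      obtain ⟨J, C, _, _, f, g, h⟩ := exists_finsupp_W_ses k (Λ := EndOp A M) L
      obtain ⟨e'⟩ := exists_finsupp_evalEquiv k A M hgen J
      exact .shift_left (S.sesΩ n) (hρ.ses hL h)
        (((hM.finsupp J) (n + 1)).1.congr_right e') .of_projective (ih (hL.coker h))
  · induction n generalizing L with
    | zero =>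
      have h1 := hρ.ext1_right hL ((hM.ext1_left.congr_left e).congr_right e)
      exact (h1.congr_right e.symm).congr_right S.zeroN.symm
    | succ n ih =>
      obtain ⟨J, K, _, _, f, g, h, hK⟩ := hL.exists_cover
      obtain ⟨e'⟩ := exists_finsupp_evalEquiv k A M hgen J
      exact .shift_right (hρ.ses hK h) (S.sesN n)
        (((hM.finsupp J) (n + 1)).2.congr_left e') (ih hK)

end Gm


/-! ## Maps factoring through sums of copies of `M` -/

section Null

variable {A : Type} [Ring A] (M : Type) [AddCommGroup M] [Module A M]
variable {X Y Z T : Type} [AddCommGroup X] [Module A X] [AddCommGroup Y] [Module A Y]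
  [AddCommGroup Z] [Module A Z] [AddCommGroup T] [Module A T]

/-- The map factors through a direct sum of copies of `M`. -/
def Null (f : X →ₗ[A] Y) : Prop :=
  ∃ (J : Type) (u : X →ₗ[A] (J →₀ M)) (v : (J →₀ M) →ₗ[A] Y), f = v ∘ₗ u

variable {M}

lemma Null.zero : Null M (0 : X →ₗ[A] Y) := ⟨Unit, 0, 0, rfl⟩

lemma Null.comp_left {f : X →ₗ[A] Y} (h : Null M f) (g : Y →ₗ[A] Z) : Null M (g ∘ₗ f) := by
  obtain ⟨J, u, v, rfl⟩ := h
  exact ⟨J, u, g ∘ₗ v, rfl⟩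

lemma Null.comp_right {f : X →ₗ[A] Y} (h : Null M f) (g : T →ₗ[A] X) : Null M (f ∘ₗ g) := by
  obtain ⟨J, u, v, rfl⟩ := h
  exact ⟨J, u ∘ₗ g, v, rfl⟩

lemma Null.add {f g : X →ₗ[A] Y} (hf : Null M f) (hg : Null M g) : Null M (f + g) := by
  obtain ⟨J, u, v, rfl⟩ := hf
  obtain ⟨K, u', v', rfl⟩ := hg
  let e := (Finsupp.sumFinsuppLEquivProdFinsupp A (M := M) (α := J) (β := K))
  refine ⟨J ⊕ K, e.symm.toLinearMap ∘ₗ u.prod u', v.coprod v' ∘ₗ e.toLinearMap, ?_⟩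
  ext x
  simp

lemma Null.neg {f : X →ₗ[A] Y} (hf : Null M f) : Null M (-f) := by
  obtain ⟨J, u, v, rfl⟩ := hf
  exact ⟨J, -u, v, by ext; simp⟩

lemma Null.of_retract {J : Type} (h : Retract A Z (J →₀ M)) (f : X →ₗ[A] Z) (g : Z →ₗ[A] Y) :
    Null M (g ∘ₗ f) := by
  obtain ⟨i, p, hip⟩ := h
  exact ⟨J, i ∘ₗ f, g ∘ₗ p, by ext x; simp [hip]⟩

/-- A map from a finitely generated module into a direct sum of copies of `M` lands in a finite
direct sum. -/
lemma exists_fin_factor [Module.Finite A X] {J : Type} (u : X →ₗ[A] (J →₀ M)) :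
    ∃ (n : ℕ) (u' : X →ₗ[A] (Fin n →₀ M)) (v : (Fin n →₀ M) →ₗ[A] (J →₀ M)),
      Function.Injective v ∧ u = v ∘ₗ u' := by
  classical
  obtain ⟨s, hs⟩ := exists_finset_component_eq_zero
    ((finsuppLEquivDirectSum A M J).toLinearMap ∘ₗ u)
  have hu : ∀ x, u x ∈ Finsupp.supported M A (s : Set J) := fun x => by
    rw [Finsupp.mem_supported']
    intro j hj
    exact hs x j (by simpa using hj)
  obtain ⟨n, ⟨e⟩⟩ := Finite.exists_equiv_fin (s : Set J)
  let ε : Finsupp.supported M A (s : Set J) ≃ₗ[A] (Fin n →₀ M) :=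
    Finsupp.supportedEquivFinsupp (s : Set J) ≪≫ₗ Finsupp.domLCongr e
  refine ⟨n, ε.toLinearMap ∘ₗ u.codRestrict _ hu,
    (Finsupp.supported M A (s : Set J)).subtype ∘ₗ ε.symm.toLinearMap,
    Subtype.val_injective.comp ε.symm.injective, ?_⟩
  ext1 x
  simp

/-- The pushout of a short exact sequence. -/
lemma SES.exists_pushout {f : X →ₗ[A] Y} {g : Y →ₗ[A] Z} (h : SES f g) (a : X →ₗ[A] T) :
    ∃ (Q : Type) (_ : AddCommGroup Q) (_ : Module A Q) (j : T →ₗ[A] Q) (q : Q →ₗ[A] Z)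
      (e : Y →ₗ[A] Q), SES j q ∧ q ∘ₗ e = g ∧
      ∀ (V : Type) [AddCommGroup V] [Module A V] (α : T →ₗ[A] V) (β : Y →ₗ[A] V),
        (∀ x, α (a x) = β (f x)) → ∃ γ : Q →ₗ[A] V, γ ∘ₗ e = β := by
  let φ : X →ₗ[A] (T × Y) := a.prod (-f)
  have hφ : Function.Injective φ := fun x y hxy => h.inj (by
    have := congrArg Prod.snd hxy
    simpa [φ] using this)
  obtain ⟨Q, _, _, π, hπ⟩ := exists_ses_of_injective φ hφ
  obtain ⟨q, hq⟩ := hπ.desc (g ∘ₗ LinearMap.snd A T Y) (fun x => by simp [φ, h.apply_apply])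
  refine ⟨Q, _, _, π ∘ₗ LinearMap.inl A T Y, q, π ∘ₗ LinearMap.inr A T Y, ⟨?_, ?_, ?_⟩, ?_, ?_⟩
  · rw [← LinearMap.ker_eq_bot, LinearMap.ker_eq_bot']
    intro t ht
    obtain ⟨x, hx⟩ := (hπ.exact _).1 ht
    have h2 : -f x = 0 := congrArg Prod.snd hx
    have h0 : x = 0 := h.inj (by rw [map_zero]; exact neg_eq_zero.1 h2)
    have h1 : a x = t := congrArg Prod.fst hx
    rw [← h1, h0, map_zero]
  · intro z
    obtain ⟨y, hy⟩ := h.surj z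
    exact ⟨π (0, y), by rw [hq]; simpa using hy⟩
  · intro y
    constructor
    · intro hy
      obtain ⟨⟨t, y⟩, rfl⟩ := hπ.surj y
      rw [hq] at hy
      obtain ⟨x, rfl⟩ := (h.exact y).1 hy
      refine ⟨t + a x, ?_⟩
      have := hπ.apply_apply x
      have h3 : (t, f x) = ((t + a x, 0) : T × Y) - φ x := by simp [φ]
      rw [h3, map_sub, this, sub_zero]
      rfl
    · rintro ⟨t, rfl⟩
      simp [hq]
  · ext y
    simp [hq]
  · intro V _ _ α β hαβ
    obtain ⟨γ, hγ⟩ := hπ.desc (α.coprod β) (fun x => by simp [φ, hαβ])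
    exact ⟨γ, by ext y; simp [hγ]⟩

lemma SES.finite_middle [IsNoetherianRing A] [Module.Finite A X] [Module.Finite A Z]
    {f : X →ₗ[A] Y} {g : Y →ₗ[A] Z} (h : SES f g) : Module.Finite A Y := by
  have : IsNoetherian A Y := isNoetherian_of_range_eq_ker f g (by
    ext y
    simp [h.exact])
  infer_instance

end Null

/-! ## Approximation by finitely generated modules of `𝒢` -/

section Approx

variable {k A M : Type} [Field k] [Ring A] [Algebra k A] [AddCommGroup M] [Module A M]
variable (S : OrthData k A M)
variable {X Y Z : Type} [AddCommGroup X] [Module A X] [AddCommGroup Y] [Module A Y]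
  [AddCommGroup Z] [Module A Z]

/-- Up to maps factoring through sums of copies of `M`, every map into a direct sum of modules of
`𝒢` lands in a finite subsum. -/
def Small (Y : Type) [AddCommGroup Y] [Module A Y] : Prop :=
  ∀ (J : Type) (X : J → ModuleCat.{0} A), (∀ j, Gm S (X j)) →
    ∀ f : Y →ₗ[A] DirectSum J (fun j => X j), ∃ (s : Finset J)
      (g : Y →ₗ[A] DirectSum J (fun j => X j)), (∀ y, ∀ j ∉ s, g y j = 0) ∧ Null M (f - g)

/-- Up to maps factoring through sums of copies of `M`, every map from a small module factors
through a finitely generated module of `𝒢`. -/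
def Approx (X : Type) [AddCommGroup X] [Module A X] : Prop :=
  ∀ Y : ModuleCat.{0} A, Small S Y → ∀ f : Y →ₗ[A] X, ∃ (Z : ModuleCat.{0} A)
    (a : Y →ₗ[A] Z) (b : Z →ₗ[A] X), Module.Finite A Z ∧ Gm S Z ∧ Null M (f - b ∘ₗ a)

variable {S}

lemma small_of_finite [Module.Finite A Y] : Small S Y := fun J X _ f => by
  obtain ⟨s, hs⟩ := exists_finset_component_eq_zero f
  exact ⟨s, f, hs, by rw [sub_self]; exact .zero⟩

lemma Small.prod (hX : Small S X) (hY : Small S Y) : Small S (X × Y) := fun J V hV f => by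
  classical
  obtain ⟨s, g, hg, hn⟩ := hX J V hV (f ∘ₗ LinearMap.inl A X Y)
  obtain ⟨t, g', hg', hn'⟩ := hY J V hV (f ∘ₗ LinearMap.inr A X Y)
  refine ⟨s ∪ t, g.coprod g', fun y j hj => ?_, ?_⟩
  · rw [Finset.mem_union, not_or] at hj
    change (g y.1 + g' y.2) j = 0
    rw [DirectSum.add_apply, hg _ _ hj.1, hg' _ _ hj.2, add_zero]
  · convert (hn.comp_right (LinearMap.fst A X Y)).add (hn'.comp_right (LinearMap.snd A X Y)) using 1
    refine LinearMap.ext fun x => ?_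
    have : f x = f (x.1, 0) + f (0, x.2) := by rw [← map_add]; simp
    simp only [LinearMap.sub_apply, LinearMap.add_apply, LinearMap.comp_apply, LinearMap.fst_apply,
      LinearMap.snd_apply, LinearMap.inl_apply, LinearMap.inr_apply, LinearMap.coprod_apply, this]
    abel

variable [FiniteDimensional k A]

lemma exists_fg_ses (k : Type) {A : Type} [Field k] [Ring A] [Algebra k A] [FiniteDimensional k A]
    (Z : Type) [AddCommGroup Z] [Module A Z] [Module.Finite A Z] :
    ∃ (K P : ModuleCat.{0} A) (a : K →ₗ[A] P) (b : P →ₗ[A] Z), SES a b ∧ Module.Finite A K ∧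
      Module.Projective A P := by
  have : IsNoetherianRing A := IsNoetherianRing.of_finite k A
  obtain ⟨Ω, P, a, b, h, ⟨e⟩, h1, -, h3⟩ := exists_fg_resolution A Z
  exact ⟨Ω 1, P 0, a 0, e.toLinearMap ∘ₗ b 0, (h 0).congr_right e, h1 1, h3 0⟩

lemma Small.ker {K : Type} [AddCommGroup K] [Module A K] {i : K →ₗ[A] Y} {p : Y →ₗ[A] Z}
    (h : SES i p) (hY : Small S Y) [Module.Finite A Z] : Small S K := fun J V hV f => by
  classical
  obtain ⟨N, P, a, b, hab, _, _⟩ := exists_fg_ses k (A := A) Z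
  obtain ⟨l, hl⟩ := Module.projective_lifting_property p b h.surj
  replace hl : ∀ x, p (l x) = b x := fun x => DFunLike.congr_fun hl x
  obtain ⟨l', hl'⟩ := h.lift (l ∘ₗ a) (fun x => by simp [hl, hab.apply_apply])
  obtain ⟨s, hs⟩ := exists_finset_component_eq_zero (f ∘ₗ l')
  let π : ∀ s : Finset J, DirectSum J (fun j => V j) →ₗ[A] DirectSum J (fun j => V j) :=
    fun s => DFinsupp.filterLinearMap A (fun j => V j) (· ∈ s)
  have hπ : ∀ (s : Finset J) x j, π s x j = if j ∈ s then x j else 0 := fun s x j =>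
    DFinsupp.filter_apply _ j x
  let g := f - π s ∘ₗ f
  have hg : ∀ x, g (l' x) = 0 := fun x => by
    ext j
    have := hs x j
    simp only [g, LinearMap.sub_apply, DirectSum.sub_apply, LinearMap.comp_apply, hπ] at this ⊢
    split_ifs with hj
    · simp
    · simp [this hj]
  obtain ⟨K', _, _, c, hc⟩ := exists_ses_of_surjective (i.coprod l) (fun y => by
    obtain ⟨z, hz⟩ := hab.surj (p y)
    obtain ⟨x, hx⟩ := (h.exact (y - l z)).1 (by rw [map_sub, hl, hz, sub_self])
    exact ⟨(x, z), by simp [hx]⟩)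
  obtain ⟨G, hG⟩ := hc.desc (g ∘ₗ LinearMap.fst A K P) (fun x => by
    have h0 := hc.apply_apply x
    simp only [LinearMap.coprod_apply] at h0
    obtain ⟨z, hz⟩ := (hab.exact (c x).2).1 (by
      have := congrArg p h0
      rwa [map_add, h.apply_apply, zero_add, hl, map_zero] at this)
    have : (c x).1 = -l' z := h.inj (by
      rw [map_neg, hl', LinearMap.comp_apply, hz]
      exact eq_neg_of_add_eq_zero_left h0)
    simp [this, hg])
  replace hG : ∀ x, G (i x) = g x := fun x => by simpa using hG (x, 0)
  obtain ⟨t, G', hG', hn⟩ := hY J V hV G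
  refine ⟨s ∪ t, π s ∘ₗ f + G' ∘ₗ i, fun y j hj => ?_, ?_⟩
  · rw [Finset.mem_union, not_or] at hj
    rw [LinearMap.add_apply, DirectSum.add_apply, LinearMap.comp_apply, LinearMap.comp_apply,
      hG' _ _ hj.2, hπ, if_neg hj.1, add_zero]
  · convert hn.comp_right i using 1
    ext1 x
    simp only [LinearMap.sub_apply, LinearMap.comp_apply, LinearMap.add_apply, hG, g]
    abel

lemma Approx.retract (hY : Approx S Y) (h : Retract A X Y) : Approx S X := fun T hT f => by
  obtain ⟨i, p, hip⟩ := h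
  obtain ⟨Z, a, b, h1, h2, h3⟩ := hY T hT (i ∘ₗ f)
  refine ⟨Z, a, p ∘ₗ b, h1, h2, ?_⟩
  convert h3.comp_left p using 1
  ext x
  simp [hip]

lemma FinRetract.exists_surjective [Module.Finite A X] (hgen : FinRetract A A M) :
    ∃ (n : ℕ) (q : (Fin n →₀ M) →ₗ[A] X), Function.Surjective q := by
  obtain ⟨m, f, hf⟩ := Module.Finite.exists_fin' A X
  have h1 : FinRetract A (Fin m → A) A := .of_pi .refl
  obtain ⟨n, i, p, hip⟩ := (h1.trans hgen).exists_fin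
  exact ⟨n, f ∘ₗ p, hf.comp fun x => ⟨i x, hip x⟩⟩

lemma Approx.ext [Module.Finite A M] (hgen : FinRetract A A M) {i : X →ₗ[A] Y} {π : Y →ₗ[A] Z}
    (h : SES i π) (hX : Gm S X) (hX' : Approx S X) (hZ' : Approx S Z) : Approx S Y :=
  fun T hT f => by
  have : IsNoetherianRing A := IsNoetherianRing.of_finite k A
  have hMX : ∀ J : Type, Ext1 A (J →₀ M) X := fun J => hX.ext1_left.finsupp_left J
  obtain ⟨V, g, b, _, hV, J, u, v, huv⟩ := hZ' T hT (π ∘ₗ f)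
  obtain ⟨v', hv'⟩ := (hMX J).lift h v
  obtain ⟨n, m, hm⟩ := FinRetract.exists_surjective (X := V) hgen
  obtain ⟨m', hm'⟩ := (hMX (Fin n)).lift h (b ∘ₗ m)
  let F : (T × (Fin n →₀ M)) →ₗ[A] Y := (f - v' ∘ₗ u).coprod m'
  let p : (T × (Fin n →₀ M)) →ₗ[A] V := g.coprod m
  have hF : ∀ x, π (F x) = b (p x) := fun x => by
    have h1 := DFunLike.congr_fun huv x.1
    simp only [LinearMap.sub_apply, LinearMap.comp_apply] at h1
    simp only [F, p, LinearMap.coprod_apply, map_add, LinearMap.sub_apply, map_sub,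
      LinearMap.comp_apply, hm', hv', ← h1]
    abel
  obtain ⟨K, _, _, c, hc⟩ := exists_ses_of_surjective p fun x => by
    obtain ⟨y, rfl⟩ := hm x
    exact ⟨(0, y), by simp [p]⟩
  have hK : Small S K := Small.ker hc (hT.prod small_of_finite)
  obtain ⟨F', hF'⟩ := h.lift (F ∘ₗ c) (fun x => by simp [hF, hc.apply_apply])
  obtain ⟨V', a', b', _, hV', J', u', w', huw⟩ := hX' (ModuleCat.of A K) hK F'
  obtain ⟨N, P, α, β, hαβ, _, _⟩ := exists_fg_ses k (A := A) V
  obtain ⟨U, hU⟩ := (Ext1.finsupp_right (J := J') hαβ hV.ext1_right) hc u'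
  obtain ⟨Q, _, _, j, q, e, hjq, hqe, huniv⟩ := hc.exists_pushout a'
  have : Module.Finite A Q := hjq.finite_middle
  obtain ⟨γ, hγ⟩ := huniv Y (i ∘ₗ b') (F - i ∘ₗ w' ∘ₗ U) (fun x => by
    have h1 := DFunLike.congr_fun huw x
    simp only [LinearMap.sub_apply, LinearMap.comp_apply] at h1
    have h2 := hF' x
    simp only [LinearMap.comp_apply] at h2
    simp only [LinearMap.sub_apply, LinearMap.comp_apply, hU, ← h1, map_sub, h2]
    abel)
  refine ⟨ModuleCat.of A Q, e ∘ₗ LinearMap.inl A _ _, γ, this, .ext hjq hV' hV, ?_⟩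
  have h3 : f - γ ∘ₗ e ∘ₗ LinearMap.inl A _ _ =
      v' ∘ₗ u + (i ∘ₗ w') ∘ₗ (U ∘ₗ LinearMap.inl A _ _) := by
    rw [← LinearMap.comp_assoc, hγ]
    ext x
    simp only [F, LinearMap.sub_apply, LinearMap.add_apply, LinearMap.comp_apply,
      LinearMap.inl_apply, LinearMap.coprod_apply, map_zero]
    abel
  rw [h3]
  exact .add ⟨_, _, _, rfl⟩ ⟨_, _, _, rfl⟩

lemma approx_finsupp_self [Module.Finite A M] (J : Type) : Approx S (J →₀ M) := fun T _ f =>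
  ⟨ModuleCat.of A M, 0, 0, ‹_›, gm_self S, by
    rw [LinearMap.comp_zero, sub_zero]; exact ⟨J, f, LinearMap.id, rfl⟩⟩

lemma Gm.approx_finsupp [Module.Finite A Z] (hZ : Gm S Z) (J : Type) : Approx S (J →₀ Z) :=
  fun T hT f => by
  classical
  let e := finsuppLEquivDirectSum A Z J
  obtain ⟨s, g, hg, hn⟩ := hT J (fun _ => ModuleCat.of A Z) (fun _ => hZ) (e.toLinearMap ∘ₗ f)
  have hu : ∀ x, (e.symm.toLinearMap ∘ₗ g) x ∈ Finsupp.supported Z A (s : Set J) := fun x => by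
    rw [Finsupp.mem_supported']
    intro j hj
    exact hg x j (by simpa using hj)
  refine ⟨ModuleCat.of A (Finsupp.supported Z A (s : Set J)),
    (e.symm.toLinearMap ∘ₗ g).codRestrict _ hu, Submodule.subtype _, ?_, ?_, ?_⟩
  · exact Module.Finite.equiv (Finsupp.supportedEquivFinsupp (s : Set J)).symm
  · exact (hZ.finsupp (s : Set J)).congr (Finsupp.supportedEquivFinsupp (s : Set J))
  · convert hn.comp_left e.symm.toLinearMap using 1
    ext1 x
    simp

end Approx


/-! ## Fitting decomposition for stable retracts -/

section Fitting

variable {A : Type} [Ring A] (M : Type) [AddCommGroup M] [Module A M]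
variable {X Y Z T : Type} [AddCommGroup X] [Module A X] [AddCommGroup Y] [Module A Y]
  [AddCommGroup Z] [Module A Z] [AddCommGroup T] [Module A T]

/-- Two maps agree up to a map factoring through a direct sum of copies of `M`. -/
def StEq (f g : X →ₗ[A] Y) : Prop := Null M (f - g)

variable {M}

lemma StEq.refl (f : X →ₗ[A] Y) : StEq M f f := by rw [StEq, sub_self]; exact .zero

lemma StEq.symm {f g : X →ₗ[A] Y} (h : StEq M f g) : StEq M g f := by
  rw [StEq, ← neg_sub]; exact h.neg

lemma StEq.trans {f g h : X →ₗ[A] Y} (h1 : StEq M f g) (h2 : StEq M g h) : StEq M f h := by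
  rw [StEq, ← sub_add_sub_cancel]; exact h1.add h2

lemma StEq.comp {f f' : X →ₗ[A] Y} {g g' : Y →ₗ[A] Z} (hg : StEq M g g') (hf : StEq M f f') :
    StEq M (g ∘ₗ f) (g' ∘ₗ f') := by
  have h : g ∘ₗ f - g' ∘ₗ f' = (g - g') ∘ₗ f + g' ∘ₗ (f - f') := by
    rw [LinearMap.sub_comp, LinearMap.comp_sub, sub_add_sub_cancel]
  rw [StEq, h]
  exact (hg.comp_right f).add (hf.comp_left g')

lemma StEq.comp_left {f f' : X →ₗ[A] Y} (h : StEq M f f') (g : Y →ₗ[A] Z) :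
    StEq M (g ∘ₗ f) (g ∘ₗ f') := .comp (.refl g) h

lemma StEq.comp_right {f f' : X →ₗ[A] Y} (h : StEq M f f') (g : T →ₗ[A] X) :
    StEq M (f ∘ₗ g) (f' ∘ₗ g) := .comp h (.refl g)

lemma StEq.exists_stable_equiv {a : X →ₗ[A] Z} {b : Z →ₗ[A] X}
    (h1 : StEq M (b ∘ₗ a) LinearMap.id) (h2 : StEq M (a ∘ₗ b) LinearMap.id) :
    ∃ (C J J' : Type) (_ : AddCommGroup C) (_ : Module A C), Retract A C (J →₀ M) ∧
      Nonempty ((X × C) ≃ₗ[A] (Z × (J' →₀ M))) := by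
  obtain ⟨J, u, v, huv⟩ := h1
  let φ : X →ₗ[A] (Z × (J →₀ M)) := a.prod (-u)
  let ψ : (Z × (J →₀ M)) →ₗ[A] X := b.coprod v
  have hψφ : ∀ x, ψ (φ x) = x := fun x => by
    have := DFunLike.congr_fun huv x
    simp only [LinearMap.sub_apply, LinearMap.comp_apply, LinearMap.id_apply] at this
    simp [φ, ψ, ← this]
  have hn : Null M (φ ∘ₗ ψ - LinearMap.id) := by
    have e : φ ∘ₗ ψ - LinearMap.id =
        LinearMap.inl A Z (J →₀ M) ∘ₗ (a ∘ₗ b - LinearMap.id) ∘ₗ LinearMap.fst A Z (J →₀ M) +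
        ((LinearMap.inl A Z (J →₀ M) ∘ₗ a ∘ₗ v) ∘ₗ LinearMap.snd A Z (J →₀ M) +
        (LinearMap.inr A Z (J →₀ M) ∘ₗ (-(u ∘ₗ ψ) - LinearMap.snd A Z (J →₀ M)))) := by
      refine LinearMap.ext fun x => ?_
      ext1 <;> simp [φ, ψ]
      abel
    rw [e]
    exact (Null.comp_left (Null.comp_right h2 _) _).add (.add ⟨J, _, _, rfl⟩ ⟨J, _, _, rfl⟩)
  obtain ⟨J', u', v', huv'⟩ := hn
  have huv'' : ∀ y, φ (ψ y) - y = v' (u' y) := fun y => DFunLike.congr_fun huv' y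
  refine ⟨LinearMap.ker ψ, J', J, inferInstance, inferInstance,
    ⟨-(u' ∘ₗ (LinearMap.ker ψ).subtype), ((LinearMap.id - φ ∘ₗ ψ) ∘ₗ v').codRestrict _
      (fun x => by simp [hψφ]), fun c => Subtype.ext ?_⟩, nonempty_prod_ker_equiv hψφ⟩
  have hc : ψ c = 0 := c.2
  have h3 := huv'' c
  rw [hc, map_zero, zero_sub] at h3
  simp [← h3, hc]

/-- A stable retract of a module of finite length is stably isomorphic to one. -/
lemma StEq.exists_fitting [IsNoetherian A Z] [IsArtinian A Z] {a : X →ₗ[A] Z} {b : Z →ₗ[A] X}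
    (h : StEq M (b ∘ₗ a) LinearMap.id) :
    ∃ (N : Submodule A Z) (C J J' : Type) (_ : AddCommGroup C) (_ : Module A C),
      Retract A C (J →₀ M) ∧ Nonempty ((X × C) ≃ₗ[A] (N × (J' →₀ M))) := by
  let r : Module.End A Z := a ∘ₗ b
  have hr2 : StEq M (r ∘ₗ r) r := (h.comp_left a).comp_right b
  have hrn : ∀ n : ℕ, StEq M (r ^ (n + 1)) r := fun n => by
    induction n with
    | zero => simpa using .refl r
    | succ n ih =>
      rw [pow_succ]
      exact (StEq.comp_right ih r).trans hr2
  obtain ⟨n, hn, hn1⟩ := (r.eventually_isCompl_ker_pow_range_pow.and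
    (Filter.eventually_ge_atTop 1)).exists
  obtain ⟨n, rfl⟩ := Nat.exists_eq_add_of_le' hn1
  let s : Z →ₗ[A] Z := r ^ (n + 1)
  have hs : StEq M s r := hrn n
  have hc : IsCompl (LinearMap.ker s) (LinearMap.range s) := hn
  have hs2 : StEq M (s ∘ₗ s) s := (StEq.comp hs hs).trans (hr2.trans hs.symm)
  let N := LinearMap.range s
  let ι : N →ₗ[A] Z := N.subtype
  let s₀ : Z →ₗ[A] N := s.rangeRestrict
  let σ : N →ₗ[A] N := s₀ ∘ₗ ι
  have hσ : Function.Bijective σ := by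
    constructor
    · rw [← LinearMap.ker_eq_bot, LinearMap.ker_eq_bot']
      intro x hx
      have h1 : s x = 0 := congrArg Subtype.val hx
      exact Subtype.ext ((Submodule.disjoint_def.1 hc.disjoint) _ h1 x.2)
    · rintro ⟨_, z, rfl⟩
      obtain ⟨y, hy, w, hw, rfl⟩ := Submodule.mem_sup.1
        (hc.sup_eq_top ▸ Submodule.mem_top : z ∈ LinearMap.ker s ⊔ LinearMap.range s)
      refine ⟨⟨w, hw⟩, Subtype.ext ?_⟩
      have hy' : s y = 0 := hy
      simp [σ, s₀, ι, hy']
  let τ := (LinearEquiv.ofBijective σ hσ).symm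
  have hτ : τ.toLinearMap ∘ₗ σ = LinearMap.id := by
    ext1 x
    exact (LinearEquiv.ofBijective σ hσ).symm_apply_apply x
  have h3 : StEq M ((s₀ ∘ₗ s) ∘ₗ s ∘ₗ ι) (s₀ ∘ₗ s ∘ₗ ι) := (hs2.comp_left s₀).comp_right ι
  have hσ1 : StEq M (s₀ ∘ₗ s ∘ₗ ι) LinearMap.id := by
    have e1 : (s₀ ∘ₗ s) ∘ₗ s ∘ₗ ι = σ ∘ₗ σ ∘ₗ σ := rfl
    have e2 : s₀ ∘ₗ s ∘ₗ ι = σ ∘ₗ σ := rfl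
    rw [e1, e2] at h3
    have e3 : ∀ f : N →ₗ[A] N, τ.toLinearMap ∘ₗ σ ∘ₗ f = f := fun f => by
      rw [← LinearMap.comp_assoc, hτ, LinearMap.id_comp]
    have h4 : StEq M (σ ∘ₗ σ) σ := by simpa only [e3] using h3.comp_left τ.toLinearMap
    have h5 : StEq M σ LinearMap.id := by
      have := h4.comp_left τ.toLinearMap
      rwa [e3, hτ] at this
    rw [e2]
    exact h4.trans h5
  obtain ⟨C, J, J', i1, i2, h6, h7⟩ := StEq.exists_stable_equiv (M := M) (a := s₀ ∘ₗ a)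
    (b := b ∘ₗ ι)
    (((hs.comp_left b).comp_right a).trans (StEq.comp h h)) (by
      refine StEq.trans ?_ hσ1
      exact (hs.symm.comp_left s₀).comp_right ι)
  exact ⟨N, C, J, J', i1, i2, h6, h7⟩

end Fitting


/-! ## Finite generation of the Gorenstein-injective modules in terms of `𝒢` -/

section Generation

variable {k A M : Type} [Field k] [Ring A] [Algebra k A] [AddCommGroup M] [Module A M]
variable [FiniteDimensional k A] [Module.Finite A M] [Module k M] [IsScalarTower k A M]
variable {S : OrthData k A M} {D : DomData k (EndOp A M)}
variable {X Y Z L L' : Type} [AddCommGroup X] [Module A X] [AddCommGroup Y] [Module A Y]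
  [AddCommGroup Z] [Module A Z] [AddCommGroup L] [Module (EndOp A M) L]
  [AddCommGroup L'] [Module (EndOp A M) L']

lemma psi_finite (hgen : FinRetract A A M) [Module.Finite (EndOp A M) L] :
    Module.Finite A (Psi k A M L) := by
  have : IsNoetherianRing A := IsNoetherianRing.of_finite k A
  obtain ⟨n, f, hf⟩ := exists_fin_W_embedding k (Λ := EndOp A M) L
  obtain ⟨e⟩ := exists_finsupp_evalEquiv k A M hgen (Fin n)
  let ε := Finsupp.linearEquivFunOnFinite (EndOp A M) (W k (EndOp A M)) (Fin n)
  have : Module.Finite A (Psi k A M (Fin n →₀ W k (EndOp A M))) := .equiv e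
  exact Module.Finite.of_injective (HMod.map (psiAct k A M) (ε.symm.toLinearMap ∘ₗ f))
    (HMod.injective_map (ε.symm.injective.comp hf))

lemma FGGen.approx [Module.Injective A A] (hgen : FinRetract A A M) (hD : FGGen D)
    (hX : Gm S X) : Approx S X := by
  obtain ⟨r, hr⟩ := hgen.exists_fin_pi
  have hρ := hFull_psiAct k A M hr
  have := hρ.finite
  obtain ⟨L₀, _, _, _, hL₀, huniv⟩ := hD
  obtain ⟨L, _, _, hL, ⟨e⟩⟩ := hX.exists_psi hgen D
  have key := huniv (fun L _ _ => GI D L ∧ Approx S (Psi k A M L)) ?_ ?_ ?_ L hL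
  · exact key.2.retract (.of_equiv e)
  · constructor
    · intro X Y _ _ _ _ h hY
      exact ⟨hY.1.retract h, hY.2.retract (HMod.retract h)⟩
    · intro X Y Z _ _ _ _ _ _ f g h hX hZ
      exact ⟨.ext h hX.1 hZ.1, .ext hgen (hρ.ses hX.1 h) (hX.1.gm_psi hgen S) hX.2 hZ.2⟩
  · intro J
    obtain ⟨e, -⟩ := HMod.exists_finsuppEquiv (psiAct k A M) L₀ J
    have := psi_finite (k := k) (L := L₀) hgen
    exact ⟨hL₀.finsupp J, ((hL₀.gm_psi hgen S).approx_finsupp J).retract (.of_equiv e.symm)⟩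
  · intro J
    obtain ⟨e⟩ := exists_finsupp_evalEquiv k A M hgen J
    exact ⟨.of_injective, (approx_finsupp_self J).retract (.of_equiv e.symm)⟩

lemma null_psi (hgen : FinRetract A A M) {J : Type} (f : L →ₗ[EndOp A M] (J →₀ W k (EndOp A M)))
    (g : (J →₀ W k (EndOp A M)) →ₗ[EndOp A M] L') :
    Null M (HMod.map (psiAct k A M) (g ∘ₗ f)) := by
  obtain ⟨e⟩ := exists_finsupp_evalEquiv k A M hgen J
  exact Null.of_retract (.of_equiv e.symm) (HMod.map (psiAct k A M) f) (HMod.map (psiAct k A M) g)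

/-- Maps vanishing on the kernel of an epimorphism onto a module in the left orthogonal class
factor through sums of copies of `W`. -/
lemma PerpGI.exists_factor {N E U : Type} [AddCommGroup N] [Module (EndOp A M) N]
    [AddCommGroup E] [Module (EndOp A M) E] [AddCommGroup U] [Module (EndOp A M) U]
    {f : N →ₗ[EndOp A M] E} {g : E →ₗ[EndOp A M] U} (hs : SES f g) (hU : PerpGI D U)
    (hL : GI D L) (w : E →ₗ[EndOp A M] L) (hw : ∀ x, w (f x) = 0) :
    ∃ (J : Type) (a : E →ₗ[EndOp A M] (J →₀ W k (EndOp A M)))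
      (b : (J →₀ W k (EndOp A M)) →ₗ[EndOp A M] L), w = b ∘ₗ a := by
  obtain ⟨w', hw'⟩ := hs.desc w hw
  obtain ⟨J, K, _, _, i, q, hq, hK⟩ := hL.exists_cover
  obtain ⟨v, hv⟩ := (hU K hK).lift hq w'
  exact ⟨J, v ∘ₗ g, q, by ext x; simp [hv, hw']⟩

lemma small_psi [Module.Injective A A] (hgen : FinRetract A A M)
    {N E U : Type} [AddCommGroup N] [Module (EndOp A M) N] [Module.Finite (EndOp A M) N]
    [AddCommGroup E] [Module (EndOp A M) E] [AddCommGroup U] [Module (EndOp A M) U]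
    {f : N →ₗ[EndOp A M] E} {g : E →ₗ[EndOp A M] U} (hs : SES f g) (hE : GI D E)
    (hU : PerpGI D U) : Small S (Psi k A M E) := fun J V hV φ => by
  classical
  obtain ⟨r, hr⟩ := hgen.exists_fin_pi
  have hρ := hFull_psiAct k A M hr
  have := hρ.finite
  choose L i1 i2 hL e using fun j => (hV j).exists_psi hgen D
  have e := fun j => (e j).some
  let ε₁ : DirectSum J (fun j => V j) ≃ₗ[A] DirectSum J (fun j => Psi k A M (L j)) :=
    DFinsupp.mapRange.linearEquiv e
  let ε₂ : DirectSum J (fun j => Psi k A M (L j)) ≃ₗ[A] Psi k A M (DirectSum J L) :=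
    .ofBijective _ (HMod.directSumMap_bijective (ρ := psiAct k A M) L)
  let ε := ε₁ ≪≫ₗ ε₂
  obtain ⟨w, hw⟩ := hρ.full_GI hE (ε.toLinearMap ∘ₗ φ)
  obtain ⟨s, hs'⟩ := exists_finset_component_eq_zero (w ∘ₗ f)
  let π : DirectSum J L →ₗ[EndOp A M] DirectSum J L :=
    DFinsupp.filterLinearMap (EndOp A M) L (· ∈ s)
  have hπ : ∀ x j, π x j = if j ∈ s then x j else 0 := fun x j => DFinsupp.filter_apply _ j x
  obtain ⟨J', a, b, hab⟩ := hU.exists_factor hs (GI.directSum hL) (w - π ∘ₗ w) (fun x => by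
    ext j
    have := hs' x j
    simp only [LinearMap.sub_apply, DirectSum.sub_apply, LinearMap.comp_apply, hπ] at this ⊢
    split_ifs with hj
    · simp
    · simp [this hj])
  refine ⟨s, ε.symm.toLinearMap ∘ₗ HMod.map (psiAct k A M) (π ∘ₗ w), fun y j hj => ?_, ?_⟩
  · have h1 : ∀ z : Psi k A M (DirectSum J L), (∀ t, z t j = 0) → ε.symm z j = 0 := by
      intro z hz
      obtain ⟨z, rfl⟩ := ε₂.surjective z
      have h2 : z j = 0 := HMod.ext fun t => by
        have := hz t
        rwa [show ε₂ z = HMod.directSumMap (psiAct k A M) L z from rfl,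
          HMod.directSumMap_apply] at this
      have h3 : ε.symm (ε₂ z) = ε₁.symm z := by simp [ε]
      rw [h3]
      change (e j).symm (z j) = 0
      rw [h2, map_zero]
    refine h1 _ fun t => ?_
    simp [hπ, hj]
  · have h4 := (null_psi hgen a b).comp_left ε.symm.toLinearMap
    rw [← hab, HMod.map_sub, hw] at h4
    convert h4 using 1
    ext1 x
    simp

lemma GI.retract_of_sum (hgen : FinRetract A A M) (hL : GI D L) (hL' : GI D L') {J : Type}
    (h : Retract A (Psi k A M L) (Psi k A M L' × (J →₀ M))) :
    Retract (EndOp A M) L (L' × (J →₀ W k (EndOp A M))) := by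
  obtain ⟨r, hr⟩ := hgen.exists_fin_pi
  have hρ := hFull_psiAct k A M hr
  obtain ⟨e⟩ := exists_finsupp_evalEquiv k A M hgen J
  obtain ⟨i, p, hip⟩ := h.trans (.prod .refl (.of_equiv e))
  obtain ⟨i₁, hi₁⟩ := hρ.full_GI hL (LinearMap.fst A _ _ ∘ₗ i)
  obtain ⟨i₂, hi₂⟩ := hρ.full_GI hL (LinearMap.snd A _ _ ∘ₗ i)
  obtain ⟨p₁, hp₁⟩ := hρ.full_GI hL' (p ∘ₗ LinearMap.inl A _ _)
  obtain ⟨p₂, hp₂⟩ := hρ.full_GI (GI.of_injective (D := D)) (p ∘ₗ LinearMap.inr A _ _)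
  have h0 := hρ.faithful_GI hL (p₁ ∘ₗ i₁ + p₂ ∘ₗ i₂ - LinearMap.id) (by
    rw [HMod.map_sub, HMod.map_add, HMod.map_comp, HMod.map_comp, hi₁, hi₂, hp₁, hp₂, HMod.map_id,
      sub_eq_zero]
    refine LinearMap.ext fun x => ?_
    simp only [LinearMap.add_apply, LinearMap.comp_apply, LinearMap.id_apply, ← map_add]
    conv_rhs => rw [← hip x]
    simp)
  exact ⟨i₁.prod i₂, p₁.coprod p₂, fun x => by
    simpa [sub_eq_zero] using DFunLike.congr_fun h0 x⟩

lemma FGGen.of_stable_equiv [Module.Injective A A] (hgen : FinRetract A A M)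
    (h : ∀ X : ModuleCat.{0} A, Gm S X → Small S X → ∃ (Z M₁ M₂ : ModuleCat.{0} A) (J₁ J₂ : Type),
      Module.Finite A Z ∧ Retract A M₁ (J₁ →₀ M) ∧ Retract A M₂ (J₂ →₀ M) ∧
      Nonempty ((X × M₁) ≃ₗ[A] (Z × M₂))) : FGGen D := by
  obtain ⟨r, hr⟩ := hgen.exists_fin_pi
  have hρ := hFull_psiAct k A M hr
  obtain ⟨E, U, _, _, _, _, f, g, hs, hE, hU⟩ :=
    exists_GI_preenvelope D (EndOp A M ⧸ Ring.jacobson (EndOp A M))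
  have hG := hE.gm_psi hgen S
  obtain ⟨Z, M₁, M₂, J₁, J₂, _, h1, h2, ⟨e⟩⟩ :=
    h (ModuleCat.of A (Psi k A M E)) hG (small_psi hgen hs hE hU)
  have hZ : Gm S Z := (hG.prod (((gm_self S).finsupp J₁).retract h1)).retract
    (Retract.trans ⟨LinearMap.inl A _ _, LinearMap.fst A _ _, fun _ => rfl⟩ (.of_equiv e.symm))
  obtain ⟨L, _, _, hL, ⟨e'⟩⟩ := hZ.exists_psi hgen D
  have : Module.Finite A (HMod (psiAct k A M) L) := .equiv e'
  have := hρ.finite_of_finite hL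
  refine FGGen.of_retract hs hE hU hL (hE.retract_of_sum (J := J₂) hgen hL ?_)
  exact (Retract.trans ⟨LinearMap.inl A _ _, LinearMap.fst A _ _, fun _ => rfl⟩
    (.of_equiv e)).trans (.prod (.of_equiv e') h2)

lemma FGGen.of_factor [Module.Injective A A] (hgen : FinRetract A A M)
    (h : ∀ X : ModuleCat.{0} A, Gm S X → ∀ Y : ModuleCat.{0} A, Module.Finite A Y →
      ∀ f : Y →ₗ[A] X, ∃ (Z : ModuleCat.{0} A) (a : Y →ₗ[A] Z) (b : Z →ₗ[A] X),
        Module.Finite A Z ∧ Gm S Z ∧ f = b ∘ₗ a) : FGGen D := by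
  obtain ⟨r, hr⟩ := hgen.exists_fin_pi
  have hρ := hFull_psiAct k A M hr
  obtain ⟨E, U, _, _, _, _, f, g, hs, hE, hU⟩ :=
    exists_GI_preenvelope D (EndOp A M ⧸ Ring.jacobson (EndOp A M))
  obtain ⟨J, K, _, _, i, q, hq, hK⟩ := hE.exists_cover
  obtain ⟨J', K', _, _, i', q', hq', -⟩ := hK.exists_cover
  have : IsNoetherianRing (EndOp A M) := IsNoetherianRing.of_finite k (EndOp A M)
  obtain ⟨Ω, P, a, b, hab, ⟨e⟩, -, hPf, hPp⟩ :=
    exists_fg_resolution (EndOp A M) (EndOp A M ⧸ Ring.jacobson (EndOp A M))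
  have := hPf 0
  have := hPf 1
  have := hPp 0
  have := hPp 1
  obtain ⟨l, hl⟩ := Module.projective_lifting_property q (f ∘ₗ e.toLinearMap ∘ₗ b 0) hq.surj
  replace hl : ∀ x, q (l x) = f (e (b 0 x)) := fun x => DFunLike.congr_fun hl x
  obtain ⟨t, ht⟩ := hq.lift (l ∘ₗ a 0) (fun x => by
    simp [hl, (hab 0).apply_apply])
  obtain ⟨l', hl'⟩ := Module.projective_lifting_property q' (t ∘ₗ b 1) hq'.surj
  replace hl' : ∀ x, q' (l' x) = t (b 1 x) := fun x => DFunLike.congr_fun hl' x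
  obtain ⟨n₁, l₁, v₁, -, rfl⟩ := exists_fin_factor l
  obtain ⟨n₂, l₂, v₂, -, rfl⟩ := exists_fin_factor l'
  obtain ⟨n₃, c, v₃, hv₃, hc⟩ := exists_fin_factor (v₁.coprod (i ∘ₗ q' ∘ₗ v₂))
  have hc₁ : ∀ x, v₁ x = v₃ (c (x, 0)) := fun x => by
    simpa using DFunLike.congr_fun hc (x, 0)
  have hc₂ : ∀ x, i (q' (v₂ x)) = v₃ (c (0, x)) := fun x => by
    simpa using DFunLike.congr_fun hc (0, x)
  let φ := HMod.map (psiAct k A M) (q ∘ₗ v₃)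
  have : Module.Finite A (Psi k A M (Fin n₃ →₀ W k (EndOp A M))) := psi_finite hgen
  have hfin : Module.Finite A (LinearMap.range φ) := .range φ
  obtain ⟨Z, y, y', _, hZ, hy⟩ := h (ModuleCat.of A (Psi k A M E)) (hE.gm_psi hgen S)
    (ModuleCat.of A (LinearMap.range φ)) hfin (LinearMap.range φ).subtype
  obtain ⟨L, _, _, hL, ⟨ε⟩⟩ := hZ.exists_psi hgen D
  have : Module.Finite A (HMod (psiAct k A M) L) := .equiv ε
  have := hρ.finite_of_finite hL
  let y₁ : LinearMap.range φ →ₗ[A] Z := y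
  let y₂ : Z →ₗ[A] Psi k A M E := y'
  have hy₁₂ : ∀ x, y₂ (y₁ x) = x.1 := fun x => (DFunLike.congr_fun hy x).symm
  obtain ⟨γ, hγ⟩ := hρ.full_finsupp (ε.toLinearMap ∘ₗ y₁ ∘ₗ φ.rangeRestrict)
  obtain ⟨z, hz⟩ := hρ.full_GI hL (y₂ ∘ₗ ε.symm.toLinearMap)
  have hzγ : ∀ x, z (γ x) = q (v₃ x) := fun x => by
    have h0 := hρ.faithful_finsupp (z ∘ₗ γ - q ∘ₗ v₃) (by
      rw [HMod.map_sub, HMod.map_comp, hγ, hz, sub_eq_zero]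
      refine LinearMap.ext fun x => ?_
      simp [hy₁₂, φ])
    simpa [sub_eq_zero] using DFunLike.congr_fun h0 x
  have hβ : ∀ x, γ (c (0, x)) = 0 := fun x => by
    have h0 := hρ.faithful_finsupp (γ ∘ₗ c ∘ₗ LinearMap.inr _ _ _) (by
      rw [HMod.map_comp, hγ]
      refine LinearMap.ext fun x => ?_
      have h1 : φ (HMod.map (psiAct k A M) (c ∘ₗ LinearMap.inr _ _ _) x) = 0 :=
        HMod.ext fun m => by
          simp [φ, ← hc₂, hq.apply_apply]
      have h2 : φ.rangeRestrict (HMod.map (psiAct k A M) (c ∘ₗ LinearMap.inr _ _ _) x) = 0 :=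
        Subtype.ext h1
      simp only [LinearMap.comp_apply, h2, map_zero, LinearMap.zero_apply])
    simpa using DFunLike.congr_fun h0 x
  obtain ⟨ν, hν⟩ := (hab 0).desc (γ ∘ₗ c ∘ₗ LinearMap.inl _ _ _ ∘ₗ l₁) (fun x => by
    obtain ⟨x, rfl⟩ := (hab 1).surj x
    have h1 : c (l₁ (a 0 (b 1 x)), 0) = c (0, l₂ x) := hv₃ (by
      rw [← hc₁, ← hc₂]
      have h3 := ht (b 1 x)
      rw [← hl'] at h3
      exact h3.symm)
    simp [h1, hβ])
  have hzν : ∀ x, z (ν (e.symm x)) = f x := fun x => by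
    obtain ⟨x, rfl⟩ := e.surjective x
    obtain ⟨x, rfl⟩ := (hab 0).surj x
    rw [e.symm_apply_apply, hν, ← hl]
    simp [hzγ, hc₁]
  obtain ⟨r, hr⟩ := (hU L hL) hs (ν ∘ₗ e.symm.toLinearMap)
  obtain ⟨J₀, u, w, huw⟩ := hU.exists_factor hs hE (LinearMap.id - z ∘ₗ r) (fun x => by
    simp [hr, hzν])
  refine FGGen.of_retract (J₀ := J₀) hs hE hU hL ⟨r.prod u, z.coprod w, fun x => ?_⟩
  have := DFunLike.congr_fun huw x
  simp only [LinearMap.sub_apply, LinearMap.id_apply, LinearMap.comp_apply] at this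
  simp [← this]

end Generation


/-! ## Vanishing of `Ext` groups -/

section ExtBridge

variable {A : Type} [Ring A]

/-- `C` is the sequence of syzygies of a projective resolution of `X`. -/
def PRes (A : Type) [Ring A] (X : Type) [AddCommGroup X] [Module A X]
    (C : ℕ → ModuleCat.{0} A) : Prop :=
  Nonempty (C 0 ≃ₗ[A] X) ∧ ∀ n, ∃ (P : ModuleCat.{0} A) (a : C (n + 1) →ₗ[A] P)
    (b : P →ₗ[A] C n), SES a b ∧ Module.Projective A P

/-- `N` is the sequence of cosyzygies of an injective coresolution of `Y`. -/
def IRes (A : Type) [Ring A] (Y : Type) [AddCommGroup Y] [Module A Y]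
    (N : ℕ → ModuleCat.{0} A) : Prop :=
  Nonempty (N 0 ≃ₗ[A] Y) ∧ ∀ n, ∃ (I : ModuleCat.{0} A) (a : N n →ₗ[A] I)
    (b : I →ₗ[A] N (n + 1)), SES a b ∧ Module.Injective A I

lemma exists_iRes (Y : Type) [AddCommGroup Y] [Module A Y] : ∃ N, IRes A Y N := by
  obtain ⟨N, h0, hN⟩ := exists_nat_chain (fun X Y : ModuleCat.{0} A =>
    ∃ (I : ModuleCat.{0} A) (a : X →ₗ[A] I) (b : I →ₗ[A] Y), SES a b ∧ Module.Injective A I)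
    (fun X => by
      obtain ⟨I, C, _, _, _, _, f, g, hI, hs⟩ := exists_injective_ses A X
      exact ⟨.of A C, .of A I, f, g, hs, hI⟩) (ModuleCat.of A Y)
  exact ⟨N, ⟨h0 ▸ .refl A Y⟩, hN⟩

lemma PRes.ext1_iff {X Y : Type} [AddCommGroup X] [Module A X] [AddCommGroup Y] [Module A Y]
    {C N : ℕ → ModuleCat.{0} A} (hC : PRes A X C) (hN : IRes A Y N) (n : ℕ) :
    Ext1 A (C n) Y ↔ Ext1 A X (N n) := by
  obtain ⟨⟨e⟩, hC⟩ := hC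
  obtain ⟨⟨e'⟩, hN⟩ := hN
  have key : ∀ m j, Ext1 A (C m) (N j) ↔ Ext1 A (C 0) (N (m + j)) := fun m => by
    induction m with
    | zero => intro j; rw [Nat.zero_add]
    | succ m ih =>
      intro j
      rw [show m + 1 + j = m + (j + 1) by omega, ← ih]
      obtain ⟨P, a, b, h1, _⟩ := hC m
      obtain ⟨I, c, d, h2, _⟩ := hN j
      exact ⟨fun h => Ext1.shift_right h1 h2 .of_projective h,
        fun h => Ext1.shift_left h1 h2 .of_injective .of_projective h⟩
  have := key n 0
  exact ⟨fun h => (this.1 (h.congr_right e'.symm)).congr_left e,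
    fun h => (this.2 (h.congr_left e.symm)).congr_right e'⟩

lemma extZero_succ_iff_resolution (X Y : ModuleCat.{0} A) (P : ProjectiveResolution X) (n : ℕ) :
    extZero A (n + 1) X Y ↔ ∀ φ : P.complex.X (n + 1) ⟶ Y, P.complex.d (n + 2) (n + 1) ≫ φ = 0 →
      ∃ ψ : P.complex.X n ⟶ Y, φ = P.complex.d (n + 1) n ≫ ψ := by
  have h1 : extZero A (n + 1) X Y ↔ (P.complex.linearYonedaObj ℤ Y).ExactAt (n + 1) := by
    rw [HomologicalComplex.exactAt_iff_isZero_homology]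
    rw [← (P.isoExt (R := ℤ) (n + 1) Y).isZero_iff]
    exact ⟨fun h => @ModuleCat.isZero_of_subsingleton _ _ _ h,
      fun h => ModuleCat.subsingleton_of_isZero h⟩
  rw [h1, HomologicalComplex.exactAt_iff' _ n (n + 1) (n + 2) (by simp) (by simp),
    ShortComplex.moduleCat_exact_iff]
  constructor
  · intro h φ hφ
    obtain ⟨ψ, hψ⟩ := h φ hφ
    exact ⟨ψ, hψ.symm⟩
  · intro h φ hφ
    obtain ⟨ψ, hψ⟩ := h φ hφ
    exact ⟨ψ, hψ.symm⟩

lemma exists_pRes_extZero (X : ModuleCat.{0} A) : ∃ C, PRes A X C ∧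
    ∀ (n : ℕ) (Y : ModuleCat.{0} A), extZero A (n + 1) X Y ↔ Ext1 A (C n) Y := by
  let P := ProjectiveResolution.of X
  have hx : ∀ n (y : P.complex.X (n + 1)), (P.complex.d (n + 1) n).hom y = 0 ↔
      ∃ x, (P.complex.d (n + 2) (n + 1)).hom x = y := fun n y => by
    refine ⟨fun h => (ShortComplex.moduleCat_exact_iff _).1 (P.exact_succ n) y h, ?_⟩
    rintro ⟨x, rfl⟩
    rw [← LinearMap.comp_apply, ← ModuleCat.hom_comp, P.complex.d_comp_d]
    rfl
  let a : ∀ n, ((P.complex.X (n + 1)) ⧸ LinearMap.range (P.complex.d (n + 2) (n + 1)).hom) →ₗ[A]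
      P.complex.X n := fun n => Submodule.liftQ _ (P.complex.d (n + 1) n).hom (by
        rintro _ ⟨x, rfl⟩
        exact (hx n _).2 ⟨x, rfl⟩)
  have hs : ∀ n, SES (a n) (LinearMap.range (P.complex.d (n + 1) n).hom).mkQ := fun n => by
    refine ⟨?_, Submodule.mkQ_surjective _, fun y => ?_⟩
    · rw [← LinearMap.ker_eq_bot, Submodule.ker_liftQ_eq_bot]
      intro y hy
      exact (hx n y).1 hy
    · rw [Submodule.mkQ_apply, Submodule.Quotient.mk_eq_zero]
      constructor
      · rintro ⟨x, rfl⟩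
        exact ⟨Submodule.Quotient.mk x, rfl⟩
      · rintro ⟨x, rfl⟩
        obtain ⟨x, rfl⟩ := Submodule.mkQ_surjective _ x
        exact ⟨x, rfl⟩
  have hP : ∀ n, Module.Projective A (P.complex.X n) := fun n =>
    (IsProjective.iff_projective _).2 (P.projective n)
  refine ⟨fun n => ModuleCat.of A (P.complex.X n ⧸ LinearMap.range (P.complex.d (n + 1) n).hom),
    ⟨?_, fun n => ⟨P.complex.X n, a n, _, hs n, hP n⟩⟩, fun n Y => ?_⟩
  · let π : P.complex.X 0 →ₗ[A] X := (P.π.f 0).hom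
    have hπ : Function.Surjective π := (ModuleCat.epi_iff_surjective (P.π.f 0)).1 inferInstance
    have hk : LinearMap.range (P.complex.d 1 0).hom = LinearMap.ker π := by
      ext y
      refine ⟨?_, fun h => (ShortComplex.moduleCat_exact_iff _).1 P.exact₀ y h⟩
      rintro ⟨x, rfl⟩
      exact LinearMap.congr_fun (congrArg ModuleCat.Hom.hom P.complex_d_comp_π_f_zero) x
    exact ⟨(Submodule.quotEquivOfEq _ _ hk).trans (π.quotKerEquivOfSurjective hπ)⟩
  · have := hP n
    rw [extZero_succ_iff_resolution X Y P n]
    constructor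
    · intro h
      refine .of_resolution (hs n) .of_projective fun u => ?_
      obtain ⟨ψ, hψ⟩ := h (ModuleCat.ofHom (u ∘ₗ Submodule.mkQ _)) (by
        ext x
        have : (Submodule.mkQ (LinearMap.range (P.complex.d (n + 2) (n + 1)).hom))
            ((P.complex.d (n + 2) (n + 1)).hom x) = 0 := by
          rw [Submodule.mkQ_apply, Submodule.Quotient.mk_eq_zero]
          exact ⟨x, rfl⟩
        simp [this])
      refine ⟨ψ.hom, fun x => ?_⟩
      obtain ⟨x, rfl⟩ := Submodule.mkQ_surjective _ x
      exact (LinearMap.congr_fun (congrArg ModuleCat.Hom.hom hψ) x).symm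
    · intro h φ hφ
      obtain ⟨v, hv⟩ := h (hs n) (Submodule.liftQ _ φ.hom (by
        rintro _ ⟨x, rfl⟩
        exact LinearMap.congr_fun (congrArg ModuleCat.Hom.hom hφ) x))
      refine ⟨ModuleCat.ofHom v, ?_⟩
      ext x
      exact (hv (Submodule.Quotient.mk x)).symm

lemma extZero_iff_iRes {X Y : ModuleCat.{0} A} {N : ℕ → ModuleCat.{0} A} (hN : IRes A Y N)
    (n : ℕ) : extZero A (n + 1) X Y ↔ Ext1 A X (N n) := by
  obtain ⟨C, hC, h⟩ := exists_pRes_extZero X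
  rw [h, hC.ext1_iff hN]

lemma extZero_iff_pRes {X Y : ModuleCat.{0} A} {C : ℕ → ModuleCat.{0} A} (hC : PRes A X C)
    (n : ℕ) : extZero A (n + 1) X Y ↔ Ext1 A (C n) Y := by
  obtain ⟨N, hN⟩ := exists_iRes (A := A) Y
  rw [extZero_iff_iRes hN, hC.ext1_iff hN]

end ExtBridge

section OrthBridge

variable {k A : Type} [Field k] [Ring A] [Algebra k A] [FiniteDimensional k A]
  {M : ModuleCat.{0} A}

lemma exists_orthData (k : Type) [Field k] [Algebra k A] [FiniteDimensional k A]
    [Module.Finite A M] (hso : SelfOrthogonal A M) : Nonempty (OrthData k A M) := by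
  have : IsNoetherianRing A := IsNoetherianRing.of_finite k A
  obtain ⟨Ω, P, a, b, h1, ⟨e⟩, h2, h3, h4⟩ := exists_fg_resolution A M
  obtain ⟨N, m, c, d, h5, ⟨e'⟩, h6⟩ := exists_fg_coresolution k A M
  have hΩ : PRes A M Ω := ⟨⟨e⟩, fun n => ⟨P n, a n, b n, h1 n, h4 n⟩⟩
  have hN : IRes A M N := ⟨⟨e'⟩, fun n => ⟨.of A (Fin (m n) → W k A), c n, d n, h5 n,
    inferInstanceAs (Module.Injective A (Fin (m n) → W k A))⟩⟩
  exact ⟨⟨Ω, P, N, a, b, h1, e, h2, h3, h4, m, c, d, h5, e', h6,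
    fun n => (extZero_iff_pRes hΩ n).1 (hso (n + 1) (by omega)),
    fun n => (extZero_iff_iRes hN n).1 (hso (n + 1) (by omega))⟩⟩

lemma memG_iff (S : OrthData k A M) (X : ModuleCat.{0} A) : MemG A M X ↔ Gm S X := by
  have hΩ : PRes A M S.Ω := ⟨⟨S.zeroΩ⟩, fun n => ⟨S.P n, S.a n, S.b n, S.sesΩ n, S.projP n⟩⟩
  have hN : IRes A M S.N := ⟨⟨S.zeroN⟩, fun n => ⟨.of A (Fin (S.m n) → W k A), S.c n, S.d n,
    S.sesN n, inferInstanceAs (Module.Injective A (Fin (S.m n) → W k A))⟩⟩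
  constructor
  · intro h n
    exact ⟨(extZero_iff_pRes hΩ n).1 (h (n + 1) (by omega)).1,
      (extZero_iff_iRes hN n).1 (h (n + 1) (by omega)).2⟩
  · intro h n hn
    obtain ⟨n, rfl⟩ : ∃ m, n = m + 1 := ⟨n - 1, by omega⟩
    exact ⟨(extZero_iff_pRes hΩ n).2 (h n).1, (extZero_iff_iRes hN n).2 (h n).2⟩

end OrthBridge


/-! ## Compactness in the relative stable category -/

section Compact

variable {A : Type} [Ring A] {M : ModuleCat.{0} A}

lemma memAddBig_iff {X : ModuleCat.{0} A} :
    MemAddBig A M X ↔ ∃ J : Type, Retract A X (J →₀ M) := by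
  constructor
  · rintro ⟨J, Y, ⟨e⟩⟩
    exact ⟨J, Retract.trans ⟨LinearMap.inl A _ _, LinearMap.fst A _ _, fun _ => rfl⟩
      (.of_equiv e)⟩
  · rintro ⟨J, h⟩
    obtain ⟨C, _, _, ⟨e⟩⟩ := h.exists_equiv
    exact ⟨J, .of A C, ⟨e⟩⟩

lemma factorsThroughAddM_iff {X Y : ModuleCat.{0} A} {f : X ⟶ Y} :
    FactorsThroughAddM A M f ↔ Null M f.hom := by
  constructor
  · rintro ⟨Z, hZ, g, h, rfl⟩
    obtain ⟨J, hJ⟩ := memAddBig_iff.1 hZ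
    exact Null.of_retract hJ g.hom h.hom
  · rintro ⟨J, u, v, h⟩
    exact ⟨.of A (J →₀ M), memAddBig_iff.2 ⟨J, .refl⟩, ModuleCat.ofHom u, ModuleCat.ofHom v,
      ModuleCat.hom_ext h⟩

lemma mem_addMSub_iff {X Y : ModuleCat.{0} A} {f : X ⟶ Y} :
    f ∈ addMSub A M X Y ↔ Null M f.hom := by
  refine ⟨fun h => ?_, fun h => AddSubgroup.subset_closure (factorsThroughAddM_iff.2 h)⟩
  refine AddSubgroup.closure_induction (p := fun f _ => Null M f.hom) ?_ .zero ?_ ?_ h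
  · exact fun f hf => factorsThroughAddM_iff.1 hf
  · exact fun f g _ _ hf hg => hf.add hg
  · exact fun f _ hf => hf.neg

/-- The class of a morphism in the relative stable Hom group. -/
def stMk (M : ModuleCat.{0} A) {X Y : ModuleCat.{0} A} : (X ⟶ Y) →+ StHomM A M X Y :=
  QuotientAddGroup.mk' (addMSub A M X Y)

lemma stMk_surjective {X Y : ModuleCat.{0} A} :
    Function.Surjective (stMk M : (X ⟶ Y) →+ StHomM A M X Y) :=
  QuotientAddGroup.mk'_surjective _

lemma stMk_eq_iff {X Y : ModuleCat.{0} A} {f g : X ⟶ Y} :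
    stMk M f = stMk M g ↔ Null M (f - g).hom := by
  rw [← sub_eq_zero, ← map_sub, ← mem_addMSub_iff]
  exact QuotientAddGroup.eq_zero_iff (N := addMSub A M X Y) (f - g)

lemma stPostComp_stMk {X Y Z : ModuleCat.{0} A} (h : Y ⟶ Z) (f : X ⟶ Y) :
    stPostComp A M X h (stMk M f) = stMk M (f ≫ h) := rfl

lemma stCanonMap_of {X : ModuleCat.{0} A} {I : Type} [hI : DecidableEq I]
    (Y : I → ModuleCat.{0} A) (i : I) (f : X ⟶ Y i) :
    stCanonMap A M X I Y (DirectSum.of (fun i => StHomM A M X (Y i)) i (stMk M f)) =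
      stMk M (f ≫ Limits.Sigma.ι Y i) := by
  obtain rfl : hI = Classical.decEq I := Subsingleton.elim _ _
  rw [← stPostComp_stMk]
  let := Classical.decEq I
  exact DirectSum.toAddMonoid_of (β := fun i => StHomM A M X (Y i))
    (fun i => stPostComp A M X (Limits.Sigma.ι Y i)) i (stMk M f)

lemma stCanonMap_injective (X : ModuleCat.{0} A) {I : Type} (Y : I → ModuleCat.{0} A) :
    Function.Injective (stCanonMap A M X I Y) := by
  classical
  let p : ∀ i, ∐ Y ⟶ Y i := fun i => (ModuleCat.coprodIsoDirectSum Y).hom ≫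
    ModuleCat.ofHom (DirectSum.component A I (fun i => Y i) i)
  have hp : ∀ i, Limits.Sigma.ι Y i ≫ p i = 𝟙 (Y i) := fun i => by
    simp only [p, ← Category.assoc, ModuleCat.ι_coprodIsoDirectSum_hom]
    ext x
    exact DirectSum.component.lof_self (M := fun i => Y i) A i x
  have hp' : ∀ i j, j ≠ i → Limits.Sigma.ι Y j ≫ p i = 0 := fun i j hij => by
    simp only [p, ← Category.assoc, ModuleCat.ι_coprodIsoDirectSum_hom]
    ext x
    exact DirectSum.of_eq_of_ne (β := fun i => Y i) _ _ _ (Ne.symm hij)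
  have key : ∀ i x, stPostComp A M X (p i) (stCanonMap A M X I Y x) = x i := fun i x => by
    induction x using DirectSum.induction_on with
    | zero => simp
    | of j f =>
      obtain ⟨f, rfl⟩ := stMk_surjective f
      rw [stCanonMap_of, stPostComp_stMk, Category.assoc]
      by_cases hij : j = i
      · subst hij
        rw [hp, Category.comp_id, DirectSum.of_eq_same]
      · rw [hp' i j hij, Limits.comp_zero, DirectSum.of_eq_of_ne _ _ _ (Ne.symm hij), map_zero]
    | add x y hx hy => rw [map_add, map_add, hx, hy, DirectSum.add_apply]
  intro x y hxy
  ext i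
  rw [← key, ← key, hxy]

variable {k : Type} [Field k] [Algebra k A] [FiniteDimensional k A] {S : OrthData k A M}

lemma small_of_mCompact {X : ModuleCat.{0} A} (hX : MCompact A M X) : Small S X :=
  fun J V hV f => by
  classical
  obtain ⟨x, hx⟩ := (hX.2 J V fun j => (memG_iff S _).2 (hV j)).2
    (stMk M (ModuleCat.ofHom f ≫ (ModuleCat.coprodIsoDirectSum V).inv))
  have key : ∀ x, ∃ (s : Finset J) (g : X →ₗ[A] DirectSum J (fun j => V j)),
      (∀ y, ∀ j ∉ s, g y j = 0) ∧ stCanonMap A M X J V x =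
        stMk M (ModuleCat.ofHom g ≫ (ModuleCat.coprodIsoDirectSum V).inv) := fun x => by
    induction x using DirectSum.induction_on with
    | zero =>
      refine ⟨∅, 0, fun y j _ => rfl, ?_⟩
      rw [map_zero, ModuleCat.ofHom_zero, Limits.zero_comp, map_zero]
    | of j f =>
      obtain ⟨f, rfl⟩ := stMk_surjective f
      refine ⟨{j}, DirectSum.lof A J (fun j => V j) j ∘ₗ f.hom, fun y i hi => ?_, ?_⟩
      · exact DirectSum.of_eq_of_ne _ _ _ (by simpa using hi)
      · rw [stCanonMap_of, ModuleCat.ofHom_comp, Category.assoc,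
          ModuleCat.lof_coprodIsoDirectSum_inv]
        rfl
    | add x y hx hy =>
      obtain ⟨s, g, h1, h2⟩ := hx
      obtain ⟨s', g', h1', h2'⟩ := hy
      refine ⟨s ∪ s', g + g', fun y j hj => ?_, ?_⟩
      · rw [Finset.mem_union, not_or] at hj
        rw [LinearMap.add_apply, DirectSum.add_apply, h1 y j hj.1, h1' y j hj.2, add_zero]
      · rw [map_add, h2, h2', ← map_add, ← Preadditive.add_comp, ModuleCat.ofHom_add]
  obtain ⟨s, g, hg, h⟩ := key x
  refine ⟨s, g, hg, ?_⟩
  rw [h, eq_comm, stMk_eq_iff, ← Preadditive.sub_comp] at hx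
  have := hx.comp_left (ModuleCat.coprodIsoDirectSum V).hom.hom
  rw [← ModuleCat.hom_comp, Category.assoc, Iso.inv_hom_id, Category.comp_id] at this
  exact this

lemma Small.mCompact {X : ModuleCat.{0} A} (hX : Small S X) (hG : Gm S X) : MCompact A M X := by
  classical
  refine ⟨(memG_iff S X).2 hG, fun J V hV => ⟨stCanonMap_injective X V, fun f => ?_⟩⟩
  obtain ⟨f, rfl⟩ := stMk_surjective f
  obtain ⟨s, g, hg, hn⟩ := hX J V (fun j => (memG_iff S _).1 (hV j))
    (f ≫ (ModuleCat.coprodIsoDirectSum V).hom).hom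
  let π : ∀ j, DirectSum J (fun j => V j) →ₗ[A] V j := fun j =>
    DirectSum.component A J (fun j => V j) j
  refine ⟨∑ j ∈ s, DirectSum.of (fun i => StHomM A M X (V i)) j
    (stMk M (ModuleCat.ofHom (π j ∘ₗ g))), ?_⟩
  rw [map_sum]
  simp_rw [stCanonMap_of]
  rw [← map_sum, eq_comm, stMk_eq_iff]
  have := hn.comp_left (ModuleCat.coprodIsoDirectSum V).inv.hom
  convert this using 1
  have h1 : ∑ j ∈ s, ModuleCat.ofHom (π j ∘ₗ g) ≫ Limits.Sigma.ι V j =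
      ModuleCat.ofHom g ≫ (ModuleCat.coprodIsoDirectSum V).inv := by
    have h2 : ModuleCat.ofHom g = ∑ j ∈ s, ModuleCat.ofHom (π j ∘ₗ g) ≫
        ModuleCat.ofHom (DirectSum.lof A J (fun j => V j) j) := by
      refine ModuleCat.hom_ext (LinearMap.ext fun y => ?_)
      rw [ModuleCat.hom_sum]
      simp only [ModuleCat.hom_ofHom, ModuleCat.hom_comp, LinearMap.sum_apply,
        LinearMap.comp_apply]
      refine (DFinsupp.ext fun i => ?_ : g y = _)
      rw [DFinsupp.finsetSum_apply]
      by_cases hi : i ∈ s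
      · rw [Finset.sum_eq_single_of_mem i hi fun j _ hj =>
          DirectSum.of_eq_of_ne _ _ _ (Ne.symm hj)]
        exact (DirectSum.of_eq_same (β := fun j => V j) i (g y i)).symm
      · rw [hg y i hi, Finset.sum_eq_zero fun j hj =>
          DirectSum.of_eq_of_ne _ _ _ (by rintro rfl; exact hi hj)]
    rw [h2, Preadditive.sum_comp]
    simp_rw [Category.assoc, ModuleCat.lof_coprodIsoDirectSum_inv]
  rw [h1, LinearMap.comp_sub, ← ModuleCat.hom_comp, Category.assoc, Iso.hom_inv_id,
    Category.comp_id]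
  rfl

lemma FGGen.exists_stable_equiv [Module.Finite A M] [Module k M] [IsScalarTower k A M]
    [Module.Injective A A] (hgen : FinRetract A A M) (S : OrthData k A M)
    {D : DomData k (EndOp A M)} (hD : FGGen D) {X : ModuleCat.{0} A} (hX : MCompact A M X) :
    ∃ (Z M₁ M₂ : ModuleCat.{0} A), Module.Finite A ↥Z ∧ MemAddBig A M M₁ ∧
      MemAddBig A M M₂ ∧ Nonempty ((↥X × ↥M₁) ≃ₗ[A] (↥Z × ↥M₂)) := by
  have : IsNoetherianRing A := IsNoetherianRing.of_finite k A
  have : IsArtinianRing A := IsArtinianRing.of_finite k A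
  obtain ⟨Z, a, b, _, -, h⟩ := hD.approx hgen ((memG_iff S X).1 hX.1) X
    (small_of_mCompact hX) LinearMap.id
  obtain ⟨N, C, J, J', _, _, hC, ⟨e⟩⟩ := StEq.exists_fitting (StEq.symm h)
  exact ⟨.of A N, .of A C, .of A (J' →₀ M), inferInstanceAs (Module.Finite A N),
    memAddBig_iff.2 ⟨J, hC⟩, memAddBig_iff.2 ⟨J', .refl⟩, ⟨e⟩⟩

lemma FGGen.of_mCompact [Module.Finite A M] [Module k M] [IsScalarTower k A M]
    [Module.Injective A A] (hgen : FinRetract A A M) (S : OrthData k A M)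
    {D : DomData k (EndOp A M)} (h : ∀ X : ModuleCat.{0} A, MCompact A M X →
      ∃ (Z M₁ M₂ : ModuleCat.{0} A), Module.Finite A ↥Z ∧ MemAddBig A M M₁ ∧
        MemAddBig A M M₂ ∧ Nonempty ((↥X × ↥M₁) ≃ₗ[A] (↥Z × ↥M₂))) : FGGen D :=
  FGGen.of_stable_equiv (S := S) hgen fun X hX hX' => by
    obtain ⟨Z, M₁, M₂, hZ, h1, h2, e⟩ := h X (hX'.mCompact hX)
    obtain ⟨J₁, h1⟩ := memAddBig_iff.1 h1
    obtain ⟨J₂, h2⟩ := memAddBig_iff.1 h2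
    exact ⟨Z, M₁, M₂, J₁, J₂, hZ, h1, h2, e⟩

end Compact


/-! ## Filtered colimits of finitely generated modules in `𝒢` -/

section FilteredColimit

variable {A : Type} [Ring A]

/-- A map from a finitely generated module to a filtered colimit factors through a stage, provided
the ring is noetherian. -/
lemma exists_factor_of_isColimit [IsNoetherianRing A] {J : Type} [SmallCategory J] [IsFiltered J]
    {F : J ⥤ ModuleCat.{0} A} {c : Limits.Cocone F} (hc : Limits.IsColimit c)
    (Y : Type) [AddCommGroup Y] [Module A Y] [Module.Finite A Y] (f : Y →ₗ[A] c.pt) :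
    ∃ (j : J) (g : Y →ₗ[A] F.obj j), f = (c.ι.app j).hom ∘ₗ g := by
  classical
  have hw : ∀ {i j : J} (φ : i ⟶ j) (x : F.obj i),
      (c.ι.app j).hom ((F.map φ).hom x) = (c.ι.app i).hom x := fun φ x =>
    LinearMap.congr_fun (congrArg ModuleCat.Hom.hom (c.w φ)) x
  obtain ⟨n, q, hq⟩ := Module.Finite.exists_fin' A Y
  obtain ⟨j₀, l, hl⟩ : ∃ (j : J) (l : (Fin n → A) →ₗ[A] F.obj j),
      ∀ x, (c.ι.app j).hom (l x) = f (q x) := by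
    choose i z hz using fun t : Fin n =>
      Limits.Concrete.isColimit_exists_rep F hc (f (q (Pi.single t 1)))
    obtain ⟨j, hj⟩ := IsFiltered.sup_objs_exists (Finset.univ.image i)
    let φ : ∀ t, i t ⟶ j := fun t => (hj (Finset.mem_image_of_mem i (Finset.mem_univ t))).some
    let l : (Fin n → A) →ₗ[A] F.obj j :=
      (Pi.basisFun A (Fin n)).constr ℕ fun t => (F.map (φ t)).hom (z t)
    refine ⟨j, l, fun x => ?_⟩
    have : (c.ι.app j).hom ∘ₗ l = f ∘ₗ q := (Pi.basisFun A (Fin n)).ext fun t => by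
      simp only [l, LinearMap.comp_apply, Module.Basis.constr_basis]
      rw [hw, Pi.basisFun_apply]
      exact hz t
    exact LinearMap.congr_fun this x
  have hT : ∀ T : Finset (LinearMap.ker q), ∃ (j : J) (φ : j₀ ⟶ j), ∀ t ∈ T,
      (F.map φ).hom (l t) = 0 := fun T => by
    induction T using Finset.induction_on with
    | empty => exact ⟨j₀, 𝟙 _, by simp⟩
    | insert t T _ ih =>
      obtain ⟨j, φ, hφ⟩ := ih
      obtain ⟨i, α, β, h⟩ := Limits.Concrete.isColimit_exists_of_rep_eq F hc
        (i := j) (j := j) ((F.map φ).hom (l t)) 0 (by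
          refine (hw φ _).trans ((hl _).trans ?_)
          rw [t.2, map_zero]
          exact (map_zero (c.ι.app j).hom).symm)
      have h' : (F.map α).hom ((F.map φ).hom (l t)) = 0 := h.trans (map_zero (F.map β).hom)
      refine ⟨i, φ ≫ α, fun s hs => ?_⟩
      rw [F.map_comp, ModuleCat.hom_comp, LinearMap.comp_apply]
      rcases Finset.mem_insert.1 hs with rfl | hs
      · exact h'
      · rw [hφ s hs, map_zero]
  obtain ⟨T, hT'⟩ := Module.Finite.fg_top (R := A) (M := LinearMap.ker q)
  obtain ⟨j, φ, hφ⟩ := hT T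
  have h0 : (F.map φ).hom ∘ₗ l ∘ₗ (LinearMap.ker q).subtype = 0 :=
    LinearMap.ext_on hT' fun t ht => hφ t ht
  obtain ⟨g, hg⟩ := (ses_ker q hq).desc ((F.map φ).hom ∘ₗ l) fun x => LinearMap.congr_fun h0 x
  refine ⟨j, g, LinearMap.ext fun y => ?_⟩
  obtain ⟨x, rfl⟩ := hq y
  rw [LinearMap.comp_apply, hg, LinearMap.comp_apply, hw, hl]

/-- The presented finitely generated modules satisfying `p` over `X`. -/
structure FgOver (p : ModuleCat.{0} A → Prop) (X : ModuleCat.{0} A) : Type where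
  n : ℕ
  N : Submodule A (Fin n → A)
  hom : ((Fin n → A) ⧸ N) →ₗ[A] X
  prop : p (ModuleCat.of A ((Fin n → A) ⧸ N))

/-- Every map from a finitely generated module to `X` factors through a finitely generated module
satisfying `p`, and `p` is closed under isomorphisms and finite sums. -/
structure FgFactors (p : ModuleCat.{0} A → Prop) (X : ModuleCat.{0} A) : Prop where
  congr : ∀ Z T : ModuleCat.{0} A, (Z ≃ₗ[A] T) → p Z → p T
  prod : ∀ Z T : ModuleCat.{0} A, p Z → p T → p (.of A (Z × T))
  factor : ∀ Y : ModuleCat.{0} A, Module.Finite A Y → ∀ f : Y →ₗ[A] X,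
    ∃ (Z : ModuleCat.{0} A) (a : Y →ₗ[A] Z) (b : Z →ₗ[A] X),
      Module.Finite A Z ∧ p Z ∧ f = b ∘ₗ a

namespace FgOver

variable {p : ModuleCat.{0} A → Prop} {X : ModuleCat.{0} A}

/-- The module underlying an object of `FgOver p X`. -/
abbrev Mod (Z : FgOver p X) : Type := (Fin Z.n → A) ⧸ Z.N

instance : SmallCategory (FgOver p X) where
  Hom Z T := {g : Z.Mod →ₗ[A] T.Mod // T.hom ∘ₗ g = Z.hom}
  id Z := ⟨LinearMap.id, rfl⟩
  comp {Z T U} f g := ⟨g.1 ∘ₗ f.1, by rw [← LinearMap.comp_assoc, g.2, f.2]⟩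

variable (p X) in
/-- The functor sending an object over `X` to its underlying module. -/
def functor : FgOver p X ⥤ ModuleCat.{0} A where
  obj Z := ModuleCat.of A Z.Mod
  map f := ModuleCat.ofHom f.1

variable (p X) in
/-- The tautological cocone. -/
def cocone : Limits.Cocone (functor p X) where
  pt := X
  ι := { app := fun Z => ModuleCat.ofHom Z.hom
         naturality := fun _ _ f => ModuleCat.hom_ext f.2 }

lemma exists_equiv (h : FgFactors p X) {Z : Type}
    [AddCommGroup Z] [Module A Z] [Module.Finite A Z] (hZ : p (.of A Z)) (z : Z →ₗ[A] X) :
    ∃ (T : FgOver p X) (e : Z ≃ₗ[A] T.Mod), T.hom ∘ₗ e.toLinearMap = z := by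
  obtain ⟨n, q, hq⟩ := Module.Finite.exists_fin' A Z
  let e := q.quotKerEquivOfSurjective hq
  exact ⟨⟨n, LinearMap.ker q, z ∘ₗ e.toLinearMap, h.congr _ _ e.symm hZ⟩, e.symm, by ext; simp⟩

lemma exists_factor (h : FgFactors p X) {Y : Type} [AddCommGroup Y] [Module A Y]
    [Module.Finite A Y]
    (f : Y →ₗ[A] X) : ∃ (T : FgOver p X) (g : Y →ₗ[A] T.Mod), T.hom ∘ₗ g = f := by
  obtain ⟨Z, a, b, _, hZ, hf⟩ := h.factor (.of A Y) inferInstance f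
  obtain ⟨T, e, he⟩ := exists_equiv h hZ b
  exact ⟨T, e.toLinearMap ∘ₗ a, by rw [← LinearMap.comp_assoc, he, hf]⟩

lemma exists_hom_comp_eq_zero (h : FgFactors p X) (Z : FgOver p X)
    (N : Submodule A Z.Mod) (hN : ∀ x ∈ N, Z.hom x = 0) :
    ∃ (T : FgOver p X) (g : Z ⟶ T), ∀ x ∈ N, g.1 x = 0 := by
  obtain ⟨T, g, hg⟩ := exists_factor h (N.liftQ Z.hom hN)
  refine ⟨T, ⟨g ∘ₗ N.mkQ, by rw [← LinearMap.comp_assoc, hg]; exact N.liftQ_mkQ _ hN⟩,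
    fun x hx => ?_⟩
  rw [LinearMap.comp_apply, Submodule.mkQ_apply, (Submodule.Quotient.mk_eq_zero N).2 hx, map_zero]

lemma exists_coprod (h : FgFactors p X) (Z T : FgOver p X) :
    ∃ (U : FgOver p X) (_ : Z ⟶ U) (_ : T ⟶ U), True := by
  obtain ⟨U, e, he⟩ := exists_equiv (Z := Z.Mod × T.Mod) h (h.prod _ _ Z.prop T.prop)
    (Z.hom.coprod T.hom)
  refine ⟨U, ⟨e.toLinearMap ∘ₗ LinearMap.inl A _ _, ?_⟩, ⟨e.toLinearMap ∘ₗ LinearMap.inr A _ _, ?_⟩,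
    trivial⟩
  · rw [← LinearMap.comp_assoc, he, LinearMap.coprod_inl]
  · rw [← LinearMap.comp_assoc, he, LinearMap.coprod_inr]

lemma isFiltered (h : FgFactors p X) : IsFiltered (FgOver p X) where
  cocone_objs Z T := exists_coprod h Z T
  cocone_maps Z T f g := by
    obtain ⟨U, u, hh⟩ := exists_hom_comp_eq_zero h T (LinearMap.range (f.1 - g.1)) (by
      rintro _ ⟨x, rfl⟩
      have h1 := LinearMap.congr_fun f.2 x
      have h2 := LinearMap.congr_fun g.2 x
      simp only [LinearMap.comp_apply] at h1 h2
      rw [LinearMap.sub_apply, map_sub, h1, h2, sub_self])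
    refine ⟨U, u, Subtype.ext (LinearMap.ext fun x => ?_)⟩
    have := hh _ ⟨x, rfl⟩
    rwa [LinearMap.sub_apply, map_sub, sub_eq_zero] at this
  nonempty := by
    obtain ⟨T, -, -⟩ := exists_factor h (0 : PUnit.{1} →ₗ[A] X)
    exact ⟨T⟩

lemma nonempty_isColimit (h : FgFactors p X) : Nonempty (Limits.IsColimit (cocone p X)) := by
  have := isFiltered h
  refine ⟨Limits.isColimitOfReflects (forget (ModuleCat.{0} A))
    (Limits.Types.FilteredColimit.isColimitOf _ _ ?_ ?_)⟩
  · intro x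
    obtain ⟨T, g, hg⟩ := exists_factor h (LinearMap.toSpanSingleton A X x)
    exact ⟨T, g 1, by
      have := LinearMap.congr_fun hg 1
      exact ((LinearMap.toSpanSingleton_apply_one A X x).symm.trans this.symm)⟩
  · intro Z T x y hxy
    obtain ⟨U, f, g, -⟩ := exists_coprod h Z T
    have h1 : U.hom (f.1 x) = Z.hom x := LinearMap.congr_fun f.2 x
    have h2 : U.hom (g.1 y) = T.hom y := LinearMap.congr_fun g.2 y
    obtain ⟨V, u, hh⟩ := exists_hom_comp_eq_zero h U (Submodule.span A {f.1 x - g.1 y}) (by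
      intro z hz
      obtain ⟨r, rfl⟩ := Submodule.mem_span_singleton.1 hz
      rw [map_smul, map_sub, h1, h2, show Z.hom x = T.hom y from hxy, sub_self, smul_zero])
    refine ⟨V, f ≫ u, g ≫ u, ?_⟩
    have := hh _ (Submodule.mem_span_singleton_self _)
    rw [map_sub, sub_eq_zero] at this
    exact this

end FgOver

variable {k : Type} [Field k] [Algebra k A] [FiniteDimensional k A] {M : ModuleCat.{0} A}
  [Module.Finite A M] [Module k M] [IsScalarTower k A M] [Module.Injective A A]
  {S : OrthData k A M} {D : DomData k (EndOp A M)}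

lemma FGGen.exists_factor (hgen : FinRetract A A M) (hD : FGGen D) {X : ModuleCat.{0} A}
    (hX : Gm S X) (Y : ModuleCat.{0} A) (hY : Module.Finite A Y) (f : Y →ₗ[A] X) :
    ∃ (Z : ModuleCat.{0} A) (a : Y →ₗ[A] Z) (b : Z →ₗ[A] X),
      Module.Finite A Z ∧ Gm S Z ∧ f = b ∘ₗ a := by
  obtain ⟨Z, a, b, _, hZ, J, u, v, huv⟩ := hD.approx hgen hX Y small_of_finite f
  obtain ⟨n, u', v', -, rfl⟩ := exists_fin_factor u
  refine ⟨.of A (Z × (Fin n →₀ M)), a.prod u', b.coprod (v ∘ₗ v'),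
    inferInstanceAs (Module.Finite A (Z × (Fin n →₀ M))), hZ.prod ((gm_self S).finsupp _), ?_⟩
  ext y
  have := LinearMap.congr_fun huv y
  simp only [LinearMap.sub_apply, LinearMap.comp_apply, sub_eq_iff_eq_add] at this
  simp only [LinearMap.comp_apply, LinearMap.prod_apply, Function.prod,
    LinearMap.coprod_apply, this]
  abel

lemma FGGen.filtColimOfFgG (hgen : FinRetract A A M) (S : OrthData k A M) (hD : FGGen D)
    {X : ModuleCat.{0} A} (hX : MemG A M X) : FiltColimOfFgG A M X := by
  have h : FgFactors (fun Z => Gm S Z) X := ⟨fun _ _ e h => h.congr e.symm,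
    fun _ _ h h' => h.prod h',
    hD.exists_factor hgen ((memG_iff S X).1 hX)⟩
  have := FgOver.isFiltered h
  exact ⟨Cat.of (FgOver (fun Z => Gm S Z) X), this, FgOver.functor _ X, FgOver.cocone _ X,
    fun Z => ⟨inferInstanceAs (Module.Finite A ((Fin Z.n → A) ⧸ Z.N)), (memG_iff S _).2 Z.prop⟩,
    FgOver.nonempty_isColimit h, ⟨Iso.refl _⟩⟩

lemma FGGen.of_filtColimOfFgG (hgen : FinRetract A A M) (S : OrthData k A M)
    (h : ∀ X : ModuleCat.{0} A, MemG A M X → FiltColimOfFgG A M X) : FGGen D :=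
  FGGen.of_factor (S := S) hgen fun X hX Y hY f => by
    have : IsNoetherianRing A := IsNoetherianRing.of_finite k A
    obtain ⟨J, _, F, c, hF, ⟨hc⟩, ⟨e⟩⟩ := h X ((memG_iff S X).2 hX)
    obtain ⟨j, g, hg⟩ := exists_factor_of_isColimit hc Y (e.inv.hom ∘ₗ f)
    refine ⟨F.obj j, g, e.hom.hom ∘ₗ (c.ι.app j).hom, (hF j).1, (memG_iff S _).1 (hF j).2, ?_⟩
    rw [LinearMap.comp_assoc, ← hg, ← LinearMap.comp_assoc, ← ModuleCat.hom_comp, e.inv_hom_id]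
    rfl

end FilteredColimit


/-! ## Gorenstein-projective and Gorenstein-injective modules -/

section Gorenstein

variable {B : Type} [Ring B]

/-- The splicing of short exact sequences is exact. -/
lemma range_comp_eq_ker {X P X' P' X'' : Type} [AddCommGroup X] [Module B X] [AddCommGroup P]
    [Module B P] [AddCommGroup X'] [Module B X'] [AddCommGroup P'] [Module B P']
    [AddCommGroup X''] [Module B X''] {Q : Type} [AddCommGroup Q] [Module B Q]
    {f : X →ₗ[B] P} {g : P →ₗ[B] X'} {f' : X' →ₗ[B] P'} {g' : P' →ₗ[B] X''} {f'' : X'' →ₗ[B] Q}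
    (h : SES f g) (h' : SES f' g') (h'' : Function.Injective f'') :
    LinearMap.range (f' ∘ₗ g) = LinearMap.ker (f'' ∘ₗ g') := by
  ext y
  rw [LinearMap.mem_range, LinearMap.mem_ker, LinearMap.comp_apply, map_eq_zero_iff _ h'',
    h'.exact]
  constructor
  · rintro ⟨x, rfl⟩
    exact ⟨g x, rfl⟩
  · rintro ⟨x, rfl⟩
    obtain ⟨z, rfl⟩ := h.surj x
    exact ⟨z, rfl⟩

lemma SES.ker_equiv {X P X' Q : Type} [AddCommGroup X] [Module B X] [AddCommGroup P]
    [Module B P] [AddCommGroup X'] [Module B X'] [AddCommGroup Q] [Module B Q]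
    {f : X →ₗ[B] P} {g : P →ₗ[B] X'} {f' : X' →ₗ[B] Q} (h : SES f g)
    (h' : Function.Injective f') : Nonempty (X ≃ₗ[B] LinearMap.ker (f' ∘ₗ g)) := by
  have e : LinearMap.range f = LinearMap.ker (f' ∘ₗ g) := by
    ext y
    rw [LinearMap.mem_range, LinearMap.mem_ker, LinearMap.comp_apply, map_eq_zero_iff _ h',
      h.exact]
  exact ⟨LinearEquiv.ofInjective f h.inj ≪≫ₗ LinearEquiv.ofEq _ _ e⟩

lemma isGProj_of_chain {X P : ℤ → ModuleCat.{0} B} (hP : ∀ i, Module.Projective B (P i))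
    (f : ∀ i, X i →ₗ[B] P i) (g : ∀ i, P i →ₗ[B] X (i + 1)) (h : ∀ i, SES (f i) (g i))
    (hX : ∀ i, Ext1 B (X i) B) {G : ModuleCat.{0} B} (e : G ≃ₗ[B] X 0) : IsGProj B G := by
  refine ⟨P, fun i => ModuleCat.ofHom (f (i + 1) ∘ₗ g i), hP,
    fun i => range_comp_eq_ker (h i) (h (i + 1)) (h (i + 1 + 1)).inj, fun i φ => ?_, ?_⟩
  · constructor
    · intro hφ
      obtain ⟨ψ, hψ⟩ := (h (i + 1)).desc φ.hom fun x => by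
        obtain ⟨y, rfl⟩ := (h i).surj x
        exact LinearMap.congr_fun (congrArg ModuleCat.Hom.hom hφ) y
      obtain ⟨θ, hθ⟩ := hX _ (h (i + 1 + 1)) ψ
      refine ⟨ModuleCat.ofHom θ, ?_⟩
      ext y
      exact ((hθ _).trans (hψ _)).symm
    · rintro ⟨ψ, rfl⟩
      ext y
      change ψ.hom (f (i + 1 + 1) (g (i + 1) (f (i + 1) (g i y)))) = 0
      rw [(h (i + 1)).apply_apply, map_zero, map_zero]
  · obtain ⟨ε⟩ := (h 0).ker_equiv (h (0 + 1)).inj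
    exact ⟨e ≪≫ₗ ε⟩

lemma isGInj_of_chain {X I : ℤ → ModuleCat.{0} B} (hI : ∀ i, Module.Injective B (I i))
    (f : ∀ i, X i →ₗ[B] I i) (g : ∀ i, I i →ₗ[B] X (i + 1)) (h : ∀ i, SES (f i) (g i))
    (hX : ∀ i (E : ModuleCat.{0} B), Module.Injective B E → Ext1 B E (X i))
    {G : ModuleCat.{0} B} (e : G ≃ₗ[B] X 0) : IsGInj B G := by
  refine ⟨I, fun i => ModuleCat.ofHom (f (i + 1) ∘ₗ g i), hI,
    fun i => range_comp_eq_ker (h i) (h (i + 1)) (h (i + 1 + 1)).inj, fun E hE i φ => ?_, ?_⟩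
  · constructor
    · intro hφ
      obtain ⟨ψ, hψ⟩ := (h (i + 1)).lift φ.hom fun x => (h (i + 1 + 1)).inj (by
        rw [map_zero]
        exact LinearMap.congr_fun (congrArg ModuleCat.Hom.hom hφ) x)
      obtain ⟨θ, hθ⟩ := (hX i E hE).lift (h i) ψ
      refine ⟨ModuleCat.ofHom θ, ?_⟩
      ext y
      exact ((congrArg (f (i + 1)) (hθ y)).trans (hψ y)).symm
    · rintro ⟨ψ, rfl⟩
      ext y
      change f (i + 1 + 1) (g (i + 1) (f (i + 1) (g i (ψ.hom y)))) = 0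
      rw [(h (i + 1)).apply_apply, map_zero]
  · obtain ⟨ε⟩ := (h 0).ker_equiv (h (0 + 1)).inj
    exact ⟨e ≪≫ₗ ε⟩

/-- A projective module is a complement of a projective module in a free one. -/
lemma exists_free_complement (P : Type) [AddCommGroup P] [Module B P] [Module.Projective B P] :
    ∃ (J Q : Type) (_ : AddCommGroup Q) (_ : Module B Q), Module.Projective B Q ∧
      Nonempty ((P × Q) ≃ₗ[B] (J →₀ B)) := by
  obtain ⟨s, hs⟩ := Module.projective_def'.1 ‹Module.Projective B P›
  obtain ⟨Q, _, _, ⟨e⟩⟩ := Retract.exists_equiv (R := B) (X := P) (Y := P →₀ B)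
    ⟨s, Finsupp.linearCombination B id, fun x => LinearMap.congr_fun hs x⟩
  refine ⟨P, Q, _, _, ?_, ⟨e⟩⟩
  have : Module.Projective B (P × Q) := Module.Projective.of_equiv e.symm
  exact Module.Projective.of_split (LinearMap.inr B P Q) (LinearMap.snd B P Q)
    (LinearMap.ext fun _ => rfl)

/-- Adding projective summands makes the middle term of a short exact sequence free. -/
lemma SES.exists_free_left {K P K' Q : Type} [AddCommGroup K] [Module B K] [AddCommGroup P]
    [Module B P] [AddCommGroup K'] [Module B K'] [AddCommGroup Q] [Module B Q]
    {f : K →ₗ[B] P} {g : P →ₗ[B] K'} (h : SES f g) [Module.Projective B P]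
    [Module.Projective B Q] :
    ∃ (J Q' : Type) (_ : AddCommGroup Q') (_ : Module B Q') (a : (K × Q) →ₗ[B] (J →₀ B))
      (b : (J →₀ B) →ₗ[B] (K' × Q')), SES a b ∧ Module.Projective B Q' := by
  obtain ⟨J, Q', _, _, hQ', ⟨e⟩⟩ := exists_free_complement (B := B) (P × Q)
  have h1 := h.prodMap (ses_prod (R := B) (X := Q) (Y := Q'))
  let e' := (LinearEquiv.prodAssoc B P Q Q').symm ≪≫ₗ e
  exact ⟨J, Q', _, _, e'.toLinearMap ∘ₗ _, _ ∘ₗ e'.symm.toLinearMap,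
    ⟨e'.injective.comp h1.inj, h1.surj.comp e'.symm.surjective, fun y => by
      rw [LinearMap.comp_apply, h1.exact]
      exact exists_congr fun x => e'.eq_symm_apply⟩, hQ'⟩

lemma SES.exists_free_right {K P K' Q : Type} [AddCommGroup K] [Module B K] [AddCommGroup P]
    [Module B P] [AddCommGroup K'] [Module B K'] [AddCommGroup Q] [Module B Q]
    {f : K →ₗ[B] P} {g : P →ₗ[B] K'} (h : SES f g) [Module.Projective B P]
    [Module.Projective B Q] :
    ∃ (J Q' : Type) (_ : AddCommGroup Q') (_ : Module B Q') (a : (K × Q') →ₗ[B] (J →₀ B))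
      (b : (J →₀ B) →ₗ[B] (K' × Q)), SES a b ∧ Module.Projective B Q' := by
  obtain ⟨J, Q', _, _, hQ', ⟨e⟩⟩ := exists_free_complement (B := B) (P × Q)
  have h1 := h.prodMap ((ses_prod (R := B) (X := Q') (Y := Q)))
  let e' := (LinearEquiv.refl B P).prodCongr (LinearEquiv.prodComm B Q' Q) ≪≫ₗ
    (LinearEquiv.prodAssoc B P Q Q').symm ≪≫ₗ e
  exact ⟨J, Q', _, _, e'.toLinearMap ∘ₗ _, _ ∘ₗ e'.symm.toLinearMap,
    ⟨e'.injective.comp h1.inj, h1.surj.comp e'.symm.surjective, fun y => by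
      rw [LinearMap.comp_apply, h1.exact]
      exact exists_congr fun x => e'.eq_symm_apply⟩, hQ'⟩

end Gorenstein

section VirtuallyGorenstein

variable {k Λ : Type} [Field k] [Ring Λ] [Algebra k Λ] [FiniteDimensional k Λ] (D : DomData k Λ)

lemma isGInj_iff (L : ModuleCat.{0} Λ) : IsGInj Λ L ↔ GI D L := by
  constructor
  · rintro ⟨I, d, hI, hd, hE, ⟨e⟩⟩
    refine GI.congr (GI.of_chain (L := fun i => LinearMap.ker (d i).hom) (I := fun i => I i) _ _
      (fun i => ses_of_exact (hd i)) (fun i u => ?_) 0) e.symm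
    obtain ⟨ψ, hψ⟩ := (hE (ModuleCat.of Λ (W k Λ)) W.injective i
      (ModuleCat.ofHom ((LinearMap.ker (d (i + 1)).hom).subtype ∘ₗ u))).1
      (by ext x; exact (u x).2)
    exact ⟨ψ.hom, fun x => Subtype.ext
      (LinearMap.congr_fun (congrArg ModuleCat.Hom.hom hψ) x).symm⟩
  · intro hL
    obtain ⟨N, J, f, g, h, hN, ⟨e⟩⟩ := hL.exists_chain
    exact isGInj_of_chain (I := fun i => ModuleCat.of Λ (J i →₀ W k Λ))
      (fun i => W.injective_finsupp _) f g h (fun i E hE => (hN i).ext1_injective) e.symm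

variable {D} in
lemma GI.isGProj_nak {L : Type} [AddCommGroup L] [Module Λ L] (hL : GI D L) :
    IsGProj Λ (ModuleCat.of Λ (Nak k Λ L)) := by
  obtain ⟨N, J, f, g, h, hN, ⟨e⟩⟩ := hL.exists_chain
  have hρ := hFull_rightAct k Λ
  exact isGProj_of_chain (X := fun i => ModuleCat.of Λ (Nak k Λ (N i)))
    (P := fun i => ModuleCat.of Λ (Nak k Λ (J i →₀ W k Λ))) (fun i => nak_projective _) _ _
    (fun i => hρ.ses (hN i) (h i))
    (fun i => (hρ.ext1_right (hN i) (.congr_left .of_projective (nakEquiv k Λ))).congr_right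
      (nakEquiv k Λ).symm) (HMod.mapEquiv _ e.symm)

lemma exists_nak_of_isGProj {G : ModuleCat.{0} Λ} (hG : IsGProj Λ G) :
    ∃ (L : Type) (_ : AddCommGroup L) (_ : Module Λ L),
      GI D L ∧ Nonempty (G ≃ₗ[Λ] Nak k Λ L) := by
  obtain ⟨P, d, hP, hd, hφ, ⟨e⟩⟩ := hG
  have hs := fun i => ses_of_exact (hd i)
  have hK : ∀ i, Ext1 Λ (LinearMap.ker (d i).hom) Λ := by
    intro i
    obtain ⟨i, rfl⟩ : ∃ j, i = j + 1 + 1 + 1 := ⟨i - 3, by ring⟩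
    refine .of_resolution (hs (i + 1 + 1)) .of_projective fun u => ?_
    obtain ⟨ψ, hψ⟩ := (hφ i (ModuleCat.ofHom (u ∘ₗ (d (i + 1)).hom.codRestrict
      (LinearMap.ker (d (i + 1 + 1)).hom) fun x => hd (i + 1) ▸ LinearMap.mem_range_self _ x))).1
      (by
        ext x
        refine (congrArg u (Subtype.ext ?_)).trans (map_zero u)
        have : (d i).hom x ∈ LinearMap.ker (d (i + 1)).hom := hd i ▸ LinearMap.mem_range_self _ x
        exact this)
    refine ⟨ψ.hom, fun x => ?_⟩
    obtain ⟨y, rfl⟩ := (hs (i + 1)).surj x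
    exact (LinearMap.congr_fun (congrArg ModuleCat.Hom.hom hψ) y).symm
  refine (hFull_rightAct k Λ).exists_equiv D (nakEquiv k Λ) (fun X => ∃ (i : ℤ) (Q : Type)
    (_ : AddCommGroup Q) (_ : Module Λ Q), Module.Projective Λ Q ∧
      Nonempty ((LinearMap.ker (d i).hom × Q) ≃ₗ[Λ] X)) (fun X _ => .of_projective) ?_ ?_ ?_ G ?_
  · rintro X ⟨i, Q, _, _, hQ, ⟨e⟩⟩
    exact ((hK i).prod_left .of_projective).congr_left e
  · rintro X ⟨i, Q, _, _, hQ, ⟨e⟩⟩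
    have := hP i
    obtain ⟨J, Q', _, _, a, b, h, hQ'⟩ := (hs i).exists_free_left (Q := Q)
    exact ⟨ModuleCat.of Λ (LinearMap.ker (d (i + 1)).hom × Q'), J, _, b,
      h.congr_left e.symm, i + 1, Q', _, _, hQ', ⟨.refl _ _⟩⟩
  · rintro X ⟨i, Q, _, _, hQ, ⟨e⟩⟩
    obtain ⟨i, rfl⟩ : ∃ j, i = j + 1 := ⟨i - 1, by ring⟩
    have := hP i
    obtain ⟨J, Q', _, _, a, b, h, hQ'⟩ := (hs i).exists_free_right (Q := Q)
    exact ⟨ModuleCat.of Λ (LinearMap.ker (d i).hom × Q'), J, a, _,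
      h.congr_right e, i, Q', _, _, hQ', ⟨.refl _ _⟩⟩
  · exact ⟨0, PUnit, inferInstance, inferInstance, inferInstance,
      ⟨LinearEquiv.prodUnique ≪≫ₗ e.symm⟩⟩

lemma gProj_orthogonal_iff (X : ModuleCat.{0} Λ) :
    (∀ G : ModuleCat.{0} Λ, IsGProj Λ G → ∀ n : ℕ, 1 ≤ n → extZero' Λ n G X) ↔
      ∀ (L : Type) [AddCommGroup L] [Module Λ L], GI D L → Ext1 Λ (Nak k Λ L) X := by
  obtain ⟨N, hN⟩ := exists_iRes (A := Λ) X
  obtain ⟨e⟩ := hN.1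
  constructor
  · intro h L _ _ hL
    exact ((extZero_iff_iRes hN 0).1 (h _ hL.isGProj_nak 1 le_rfl)).congr_right e
  · intro h G hG n hn
    obtain ⟨n, rfl⟩ : ∃ m, n = m + 1 := ⟨n - 1, by omega⟩
    obtain ⟨L, _, _, hL, ⟨ε⟩⟩ := exists_nak_of_isGProj D hG
    refine (extZero_iff_iRes hN n).2 (Ext1.congr_left ?_ ε.symm)
    clear ε
    induction n generalizing L with
    | zero => exact (h L hL).congr_right e.symm
    | succ n ih =>
      obtain ⟨J, K, _, _, f, g, hs, hK⟩ := hL.exists_cover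
      obtain ⟨I, a, b, hab, hI⟩ := hN.2 n
      exact .shift_right ((hFull_rightAct k Λ).ses hK hs) hab .of_projective
        (ih (by omega) K _ _ hK)

lemma gInj_orthogonal_iff (X : ModuleCat.{0} Λ) :
    (∀ E : ModuleCat.{0} Λ, IsGInj Λ E → ∀ n : ℕ, 1 ≤ n → extZero' Λ n X E) ↔ PerpGI D X := by
  obtain ⟨C, hC, -⟩ := exists_pRes_extZero X
  obtain ⟨e⟩ := hC.1
  constructor
  · intro h L _ _ hL
    exact ((extZero_iff_pRes hC 0).1
      (h (ModuleCat.of Λ L) ((isGInj_iff D _).2 hL) 1 le_rfl)).congr_left e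
  · intro h E hE n hn
    obtain ⟨n, rfl⟩ : ∃ m, n = m + 1 := ⟨n - 1, by omega⟩
    refine (extZero_iff_pRes hC n).2 ?_
    have hE' := (isGInj_iff D E).1 hE
    clear hE hn
    induction n generalizing E with
    | zero => exact (h E hE').congr_left e.symm
    | succ n ih =>
      obtain ⟨J, C', _, _, f, g, hs⟩ := exists_finsupp_W_ses k (Λ := Λ) E
      obtain ⟨P, a, b, hab, hP⟩ := hC.2 n
      exact .shift_left hab hs .of_injective .of_projective
        (ih (ModuleCat.of Λ C') (hE'.coker hs))

lemma virtGorenstein_iff_fgGen : VirtGorenstein Λ ↔ FGGen D := by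
  constructor
  · intro h
    refine FGGen.of_pi D fun U _ _ hU J => ?_
    have key := fun X : ModuleCat.{0} Λ =>
      (gProj_orthogonal_iff D X).symm.trans ((h X).trans (gInj_orthogonal_iff D X))
    exact (key (ModuleCat.of Λ (J → U))).1 fun L _ _ hL =>
      .pi_right fun _ => (key (ModuleCat.of Λ U)).2 hU L hL
  · intro h X
    rw [gProj_orthogonal_iff D, gInj_orthogonal_iff D, h.perp_iff]

end VirtuallyGorenstein

end VG

open VG in
/-- **Proposition 3.12**. For a self-orthogonal generator `M` over a finite-dimensional
self-injective algebra `A` with `Λ = End_A(M)` (composition written on the right):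
`Λ` is virtually Gorenstein iff every module in `𝒢` is a filtered colimit of finitely
generated modules in `𝒢`, iff every `M`-compact module is `M`-stably isomorphic to a
finitely generated module. -/
theorem virtually_gorenstein_iff_G_filtered_colimits_iff_M_compacts_stably_fg
    (k A : Type) [Field k] [Ring A] [Algebra k A] [FiniteDimensional k A]
    [Module.Injective A A]
    (M : ModuleCat.{0} A) [Module.Finite A ↥M]
    (hgen : IsGen A M) (hso : SelfOrthogonal A M) :
    (VirtGorenstein (Module.End A ↥M)ᵐᵒᵖ ↔
      ∀ X : ModuleCat.{0} A, MemG A M X → FiltColimOfFgG A M X) ∧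
    (VirtGorenstein (Module.End A ↥M)ᵐᵒᵖ ↔
      ∀ X : ModuleCat.{0} A, MCompact A M X →
        ∃ (Z M₁ M₂ : ModuleCat.{0} A), Module.Finite A ↥Z ∧ MemAddBig A M M₁ ∧
          MemAddBig A M M₂ ∧ Nonempty ((↥X × ↥M₁) ≃ₗ[A] (↥Z × ↥M₂))) := by
  obtain ⟨_, _⟩ := exists_tower k A M
  obtain ⟨n, Y, ⟨e⟩⟩ := hgen
  have hg : FinRetract A A M :=
    .of_pi (Retract.trans ⟨LinearMap.inl A A Y, LinearMap.fst A A Y, fun _ => rfl⟩ (.of_equiv e))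
  obtain ⟨S⟩ := exists_orthData k hso
  obtain ⟨D⟩ := exists_domData hg S
  have hVG : VirtGorenstein (Module.End A M)ᵐᵒᵖ ↔ FGGen D := virtGorenstein_iff_fgGen D
  rw [hVG]
  exact ⟨⟨fun hD _ hX => hD.filtColimOfFgG hg S hX, fun h => .of_filtColimOfFgG hg S h⟩,
    ⟨fun hD _ hX => hD.exists_stable_equiv hg S hX, fun h => .of_mCompact hg S h⟩⟩
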